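/- Let p be a prime number with p ≡ 23 (mod 48). Then every rational solution (x, y) ∈ ℚ × ℚ of the equation y² = x(x² − p²)(x² − 4p²) satisfies y = 0 (hence x ∈ {0, p, −p, 2p, −2p}). In other words, the set of rational points of the genus 2 curve C_p consists of only its six Weierstrass points. -/

import Mathlib

namespace ZsqrtdNegTwo

open Zsqrtd

/-- The ring `ℤ[√-2]`. -/
abbrev O := ℤ√(-2)

lemma norm_eq (x : O) : x.norm = x.re ^ 2 + 2 * x.im ^ 2 := by
  rw [Zsqrtd.norm_def]; ring

lemma norm_nonneg' (x : O) : 0 ≤ x.norm := by rw [norm_eq]; positivity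

lemma norm_pos' {x : O} (hx : x ≠ 0) : 0 < x.norm :=
  lt_of_le_of_ne (norm_nonneg' x)
    fun h => hx ((Zsqrtd.norm_eq_zero_iff (by norm_num) x).1 h.symm)

lemma exists_nearest (a n : ℤ) (hn : 0 < n) : ∃ q, 2 * |a - q * n| ≤ n := by
  refine ⟨(2 * a + n) / (2 * n), ?_⟩
  have h1 := Int.emod_add_mul_ediv (2 * a + n) (2 * n)
  have h2 := Int.emod_nonneg (2 * a + n) (show 2 * n ≠ 0 by omega)
  have h3 := Int.emod_lt_of_pos (2 * a + n) (show 0 < 2 * n by omega)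
  set q := (2 * a + n) / (2 * n)
  have : 2 * |a - q * n| = |2 * (a - q * n)| := by rw [abs_mul]; simp
  rw [this, abs_le]
  constructor <;> nlinarith

lemma exists_quotient (x y : O) (hy : y ≠ 0) : ∃ q, (x - q * y).norm < y.norm := by
  have hn := norm_pos' hy
  obtain ⟨q1, h1⟩ := exists_nearest (x * star y).re y.norm hn
  obtain ⟨q2, h2⟩ := exists_nearest (x * star y).im y.norm hn
  refine ⟨⟨q1, q2⟩, ?_⟩
  have hs : (x - ⟨q1, q2⟩ * y) * star y
      = ⟨(x * star y).re - q1 * y.norm, (x * star y).im - q2 * y.norm⟩ := by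
    ext <;> simp [norm_eq] <;> ring
  have h3 : (x - ⟨q1, q2⟩ * y).norm * y.norm
      = ((x * star y).re - q1 * y.norm) ^ 2 + 2 * ((x * star y).im - q2 * y.norm) ^ 2 := by
    rw [← Zsqrtd.norm_conj y, ← Zsqrtd.norm_mul, hs, norm_eq, Zsqrtd.norm_conj]
  set A := (x * star y).re - q1 * y.norm
  set B := (x * star y).im - q2 * y.norm
  have hA : 4 * A ^ 2 ≤ y.norm ^ 2 := by
    rw [← sq_abs A]; nlinarith [abs_nonneg A]
  have hB : 4 * B ^ 2 ≤ y.norm ^ 2 := by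
    rw [← sq_abs B]; nlinarith [abs_nonneg B]
  nlinarith

instance : Nontrivial O := ⟨⟨0, 1, by decide⟩⟩

instance : NoZeroDivisors O where
  eq_zero_or_eq_zero_of_mul_eq_zero {a b} h := by
    have : a.norm * b.norm = 0 := by rw [← Zsqrtd.norm_mul, h]; rfl
    rcases mul_eq_zero.1 this with h | h
    · exact Or.inl ((Zsqrtd.norm_eq_zero_iff (by norm_num) a).1 h)
    · exact Or.inr ((Zsqrtd.norm_eq_zero_iff (by norm_num) b).1 h)

instance : IsDomain O := NoZeroDivisors.to_isDomain O

instance : IsPrincipalIdealRing O where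
  principal I := by
    by_cases hI : I = ⊥
    · subst hI; exact ⟨0, by simp⟩
    obtain ⟨y0, hy0, hy0'⟩ := Submodule.exists_mem_ne_zero_of_ne_bot hI
    obtain ⟨y, ⟨hyI, hy⟩, hmin⟩ := WellFounded.has_min
      (InvImage.wf (fun x : O => x.norm.natAbs) Nat.lt_wfRel.wf) {y | y ∈ I ∧ y ≠ 0}
      ⟨y0, hy0, hy0'⟩
    refine ⟨y, le_antisymm (fun x hx => ?_) ?_⟩
    · obtain ⟨q, hq⟩ := exists_quotient x y hy
      have hr : x - q * y ∈ I := I.sub_mem hx (I.mul_mem_left q hyI)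
      by_cases h0 : x - q * y = 0
      · rw [sub_eq_zero] at h0
        rw [h0]
        exact Submodule.mem_span_singleton.2 ⟨q, rfl⟩
      · refine absurd ?_ (hmin _ ⟨hr, h0⟩)
        have := norm_nonneg' (x - q * y)
        change (x - q * y).norm.natAbs < y.norm.natAbs
        omega
    · rw [Submodule.span_singleton_le_iff_mem]; exact hyI

lemma isUnit_iff (x : O) : IsUnit x ↔ x = 1 ∨ x = -1 := by
  constructor
  · intro h
    have h1 := (Zsqrtd.norm_eq_one_iff' (by norm_num) x).2 h
    rw [norm_eq] at h1
    have h2 : x.im = 0 := by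
      by_contra h
      have : 1 ≤ x.im ^ 2 := Int.one_le_abs (pow_ne_zero 2 h) |>.trans (by simp)
      nlinarith [sq_nonneg x.re]
    rw [h2] at h1
    have h3 : x.re = 1 ∨ x.re = -1 := mul_self_eq_one_iff.1 (by linarith [sq x.re])
    rcases h3 with h3 | h3
    · left; ext <;> simp [h2, h3]
    · right; ext <;> simp [h2, h3]
  · rintro (rfl | rfl)
    · exact isUnit_one
    · exact isUnit_one.neg

/-- The square root of `-2`. -/
abbrev s : O := ⟨0, 1⟩
/-- The prime `1 + √-2` above `3`. -/
abbrev be : O := ⟨1, 1⟩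
/-- The prime `1 - √-2` above `3`. -/
abbrev bb : O := ⟨1, -1⟩

lemma s_sq : s ^ 2 = -2 := by decide

lemma be_eq : be = 1 + s := by decide

lemma bb_eq : bb = 1 - s := by decide

lemma prime_of_norm_prime {x : O} (h : x.norm.natAbs.Prime) : Prime x := by
  rw [← irreducible_iff_prime]
  refine ⟨fun hu => ?_, fun a b hab => ?_⟩
  · rcases (isUnit_iff x).1 hu with rfl | rfl <;> revert h <;> decide
  · rw [hab, Zsqrtd.norm_mul, Int.natAbs_mul, Nat.prime_mul_iff] at h
    rcases h with ⟨_, h⟩ | ⟨_, h⟩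
    · exact Or.inr (Zsqrtd.norm_eq_one_iff.1 h)
    · exact Or.inl (Zsqrtd.norm_eq_one_iff.1 h)

lemma prime_s : Prime s := prime_of_norm_prime (by decide)

lemma prime_be : Prime be := prime_of_norm_prime (by decide)

lemma prime_bb : Prime bb := prime_of_norm_prime (by decide)

lemma prime_natCast {p : ℕ} (hp : p.Prime) (h8 : p % 8 = 7) : Prime (p : O) := by
  rw [← irreducible_iff_prime]
  have hn : (p : O).norm = p * p := by rw [norm_eq]; simp; ring
  refine ⟨fun hu => ?_, fun a b hab => ?_⟩
  · have := Zsqrtd.norm_eq_one_iff.2 hu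
    rw [hn] at this
    have h2 : p * p = 1 := by exact_mod_cast this
    have := Nat.eq_one_of_mul_eq_one_right h2
    omega
  · have h1 : a.norm.natAbs * b.norm.natAbs = p * p := by
      rw [← Int.natAbs_mul, ← Zsqrtd.norm_mul, ← hab, hn]; rfl
    by_contra! hu
    have ha : a.norm.natAbs ≠ 1 := fun h => hu.1 (Zsqrtd.norm_eq_one_iff.1 h)
    have hb : b.norm.natAbs ≠ 1 := fun h => hu.2 (Zsqrtd.norm_eq_one_iff.1 h)
    have hap : a.norm.natAbs = p := by
      have h2 : a.norm.natAbs * b.norm.natAbs = p ^ 2 := by rw [h1, sq]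
      exact (Nat.Prime.mul_eq_prime_sq_iff hp ha hb).1 h2 |>.1
    have h3 : a.re ^ 2 + 2 * a.im ^ 2 = p := by
      rw [← norm_eq, ← hap]
      exact (Int.natAbs_of_nonneg (norm_nonneg' a)).symm
    have h4 : (a.re ^ 2 + 2 * a.im ^ 2) % 8 = 7 := by rw [h3]; omega
    generalize a.re = m at h4
    generalize a.im = n at h4
    have hm : m ^ 2 % 8 = 0 ∨ m ^ 2 % 8 = 1 ∨ m ^ 2 % 8 = 4 := by
      have : m % 8 = 0 ∨ m % 8 = 1 ∨ m % 8 = 2 ∨ m % 8 = 3 ∨ m % 8 = 4 ∨ m % 8 = 5 ∨ m % 8 = 6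
        ∨ m % 8 = 7 := by omega
      rcases this with h | h | h | h | h | h | h | h <;> simp [pow_two, Int.mul_emod, h]
    have hn : n ^ 2 % 8 = 0 ∨ n ^ 2 % 8 = 1 ∨ n ^ 2 % 8 = 4 := by
      have : n % 8 = 0 ∨ n % 8 = 1 ∨ n % 8 = 2 ∨ n % 8 = 3 ∨ n % 8 = 4 ∨ n % 8 = 5 ∨ n % 8 = 6
        ∨ n % 8 = 7 := by omega
      rcases this with h | h | h | h | h | h | h | h <;> simp [pow_two, Int.mul_emod, h]
    omega

lemma s_dvd_iff (x : O) : s ∣ x ↔ 2 ∣ x.re := by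
  constructor
  · rintro ⟨y, rfl⟩
    exact ⟨-y.im, by simp⟩
  · rintro ⟨k, hk⟩
    exact ⟨⟨x.im, -k⟩, by ext <;> simp [hk]⟩

/-- Reduction modulo `1 + √-2`. -/
def modBe : O →+* ZMod 3 := Zsqrtd.lift ⟨-1, by decide⟩
/-- Reduction modulo `1 - √-2`. -/
def modBb : O →+* ZMod 3 := Zsqrtd.lift ⟨1, by decide⟩

lemma modBe_apply (x : O) : modBe x = x.re - x.im := by
  simp [modBe, sub_eq_add_neg]

lemma modBb_apply (x : O) : modBb x = x.re + x.im := by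
  simp [modBb]

lemma modBe_eq_zero (x : O) : modBe x = 0 ↔ be ∣ x := by
  rw [modBe_apply, ← Int.cast_sub, ZMod.intCast_zmod_eq_zero_iff_dvd]
  constructor
  · rintro ⟨k, hk⟩
    refine ⟨⟨x.re - 2 * k, -k⟩, ?_⟩
    push_cast at hk
    ext
    · simp
    · simp; linarith
  · rintro ⟨y, rfl⟩
    exact ⟨-y.im, by simp; ring⟩

lemma modBb_eq_zero (x : O) : modBb x = 0 ↔ bb ∣ x := by
  rw [modBb_apply, ← Int.cast_add, ZMod.intCast_zmod_eq_zero_iff_dvd]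
  constructor
  · rintro ⟨k, hk⟩
    refine ⟨⟨x.re - 2 * k, k⟩, ?_⟩
    push_cast at hk
    ext
    · simp
    · simp; linarith
  · rintro ⟨y, rfl⟩
    exact ⟨y.im, by simp; ring⟩

lemma modBe_s : modBe s = -1 := by rw [modBe_apply]; decide

lemma modBe_be : modBe be = 0 := by rw [modBe_apply]; decide

lemma modBe_bb : modBe bb = -1 := by rw [modBe_apply]; decide

lemma modBb_s : modBb s = 1 := by rw [modBb_apply]; decide

lemma modBb_be : modBb be = -1 := by rw [modBb_apply]; decide

lemma modBb_bb : modBb bb = 0 := by rw [modBb_apply]; decide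

lemma natCast_zmod_three {p : ℕ} (h : p % 3 = 2) : (p : ZMod 3) = -1 := by
  rw [← Nat.mod_add_div p 3, h]; push_cast
  rw [show (3 : ZMod 3) = 0 from rfl, zero_mul]; decide

lemma modBe_natCast {p : ℕ} (h : p % 3 = 2) : modBe (p : O) = -1 := by
  rw [map_natCast, natCast_zmod_three h]

lemma modBb_natCast {p : ℕ} (h : p % 3 = 2) : modBb (p : O) = -1 := by
  rw [map_natCast, natCast_zmod_three h]

lemma norm_sq_lt {x m : O} (hx : ¬ IsUnit x) (hx0 : x ≠ 0) (hm : m ≠ 0) :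
    m.norm.natAbs < (x * m).norm.natAbs := by
  rw [Zsqrtd.norm_mul, Int.natAbs_mul]
  have h1 : x.norm.natAbs ≠ 1 := fun h => hx (Zsqrtd.norm_eq_one_iff.1 h)
  have h2 := norm_pos' hx0
  have h3 := norm_pos' hm
  have h4 : 2 ≤ x.norm.natAbs := by omega
  have h5 : 0 < m.norm.natAbs := by omega
  nlinarith

lemma exists_sqfree_mul_sq (l : O) (hl : l ≠ 0) : ∃ d t, Squarefree d ∧ l = d * t ^ 2 := by
  induction h : l.norm.natAbs using Nat.strong_induction_on generalizing l with
  | _ n ih =>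
    by_cases hs : Squarefree l
    · exact ⟨l, 1, hs, by ring⟩
    · simp only [Squarefree, not_forall] at hs
      obtain ⟨x, ⟨m, hm⟩, hx⟩ := hs
      have hx0 : x ≠ 0 := by rintro rfl; exact hl (by simp [hm])
      have hm0 : m ≠ 0 := by rintro rfl; exact hl (by simp [hm])
      have h1 := norm_sq_lt hx hx0 hm0
      have h2 := norm_sq_lt hx hx0 (mul_ne_zero hx0 hm0)
      rw [← mul_assoc, ← hm, h] at h2
      obtain ⟨d, t, hd, ht⟩ := ih _ (by omega) m hm0 rfl
      exact ⟨d, x * t, hd, by rw [hm, ht]; ring⟩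

lemma eq_zero_of_odd_eq_even {q u w : O} (hq : Prime q) (hu : ¬ q ∣ u) (hw : ¬ q ∣ w) (t m : O)
    (h : q * u * t ^ 2 = w * m ^ 2) : t = 0 := by
  by_contra ht
  induction hn : t.norm.natAbs using Nat.strong_induction_on generalizing t m with
  | _ n ih =>
    have h1 : q ∣ m := by
      have : q ∣ w * m ^ 2 := ⟨u * t ^ 2, by rw [← h]; ring⟩
      exact hq.dvd_of_dvd_pow ((hq.dvd_or_dvd this).resolve_left hw)
    obtain ⟨m', rfl⟩ := h1
    have h2 : u * t ^ 2 = q * (w * m' ^ 2) :=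
      mul_left_cancel₀ hq.ne_zero (by linear_combination h)
    have h3 : q ∣ t :=
      hq.dvd_of_dvd_pow ((hq.dvd_or_dvd (Dvd.intro _ h2.symm)).resolve_left hu)
    obtain ⟨t', rfl⟩ := h3
    have ht' : t' ≠ 0 := by rintro rfl; simp at ht
    refine ih _ ?_ t' m' ?_ ht' rfl
    · rw [← hn]; exact norm_sq_lt hq.not_isUnit hq.ne_zero ht'
    · exact mul_left_cancel₀ hq.ne_zero (by linear_combination h2)

/-- The prime divisors of the square class of `l`, when `l * l'` is `δ` times a square. -/
lemma exists_class {l l' δ m : O} (hl : l ≠ 0) (h : l * l' = δ * m ^ 2) :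
    ∃ d t, Squarefree d ∧ l = d * t ^ 2 ∧
      ∀ q, Prime q → q ∣ d → q ∣ l ∧ (q ∣ δ ∨ q ∣ l') := by
  obtain ⟨d, t, hd, rfl⟩ := exists_sqfree_mul_sq l hl
  refine ⟨d, t, hd, rfl, fun q hq hqd => ⟨hqd.mul_right _, ?_⟩⟩
  by_contra! hc
  obtain ⟨d', rfl⟩ := hqd
  have h1 : ¬ q ∣ d' := by
    rintro ⟨e, rfl⟩
    exact hq.not_isUnit (hd q ⟨e, by ring⟩)
  have h2 := eq_zero_of_odd_eq_even hq (u := d' * l') (w := δ)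
    (fun h => (hq.dvd_or_dvd h).elim h1 hc.2) hc.1 t m (by rw [← h]; ring)
  exact hl (by simp [h2])

lemma dvd_of_prime_dvd {q P : O} (hq : Prime q) (hP : Prime P) (h : q ∣ P) : P ∣ q :=
  (hq.associated_of_dvd hP h).dvd'

lemma sqfree_peel {d P : O} {Q : O → Prop} (hP : Prime P) (hd : Squarefree d)
    (H : ∀ q, Prime q → q ∣ d → q ∣ P ∨ Q q) :
    ∃ i d', (i = 1 ∨ i = P) ∧ d = i * d' ∧ Squarefree d' ∧ ∀ q, Prime q → q ∣ d' → Q q := by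
  by_cases h : P ∣ d
  · obtain ⟨d', rfl⟩ := h
    refine ⟨P, d', Or.inr rfl, rfl, hd.squarefree_of_dvd (Dvd.intro_left _ rfl),
      fun q hq hqd => (H q hq (hqd.mul_left _)).resolve_left fun hqP => ?_⟩
    obtain ⟨e, rfl⟩ := (dvd_of_prime_dvd hq hP hqP).trans hqd
    exact hP.not_isUnit (hd P ⟨e, by ring⟩)
  · exact ⟨1, d, Or.inl rfl, by ring, hd, fun q hq hqd => (H q hq hqd).resolve_left
      fun hqP => h ((dvd_of_prime_dvd hq hP hqP).trans hqd)⟩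

lemma eq_one_or_of_no_prime {d : O} (hd : d ≠ 0) (H : ∀ q, Prime q → q ∣ d → False) :
    d = 1 ∨ d = -1 := by
  rw [← isUnit_iff]
  by_contra hu
  obtain ⟨i, hi, hid⟩ := WfDvdMonoid.exists_irreducible_factor hu hd
  exact H i hi.prime hid

lemma exists_class_one {l l' δ m P : O} (hP : Prime P) (hl : l ≠ 0) (h : l * l' = δ * m ^ 2)
    (H : ∀ q, Prime q → q ∣ l → (q ∣ δ ∨ q ∣ l') → q ∣ P) :
    ∃ e i t : O, (e = 1 ∨ e = -1) ∧ (i = 1 ∨ i = P) ∧ l = e * i * t ^ 2 ∧ t ≠ 0 := by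
  obtain ⟨d, t, hd, h1, h2⟩ := exists_class hl h
  obtain ⟨i, d', hi, rfl, hd', h3⟩ := sqfree_peel (Q := fun _ => False) hP hd
    (fun q hq hqd => Or.inl (H q hq (h2 q hq hqd).1 (h2 q hq hqd).2))
  exact ⟨d', i, t, eq_one_or_of_no_prime hd'.ne_zero h3, hi, by rw [h1]; ring,
    by rintro rfl; exact hl (by simp [h1])⟩

lemma exists_class_two {l l' δ m P P' : O} (hP : Prime P) (hP' : Prime P')
    (hl : l ≠ 0) (h : l * l' = δ * m ^ 2)
    (H : ∀ q, Prime q → q ∣ l → (q ∣ δ ∨ q ∣ l') → q ∣ P ∨ q ∣ P') :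
    ∃ e i j t : O, (e = 1 ∨ e = -1) ∧ (i = 1 ∨ i = P) ∧ (j = 1 ∨ j = P') ∧
      l = e * i * j * t ^ 2 ∧ t ≠ 0 := by
  obtain ⟨d, t, hd, h1, h2⟩ := exists_class hl h
  obtain ⟨i, d', hi, rfl, hd', h3⟩ := sqfree_peel (Q := fun q => q ∣ P' ∨ False) hP hd
    (fun q hq hqd => by simpa using H q hq (h2 q hq hqd).1 (h2 q hq hqd).2)
  obtain ⟨j, d'', hj, rfl, hd'', h4⟩ := sqfree_peel hP' hd' h3
  exact ⟨d'', i, j, t, eq_one_or_of_no_prime hd''.ne_zero h4, hi, hj, by rw [h1]; ring,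
    by rintro rfl; exact hl (by simp [h1])⟩

/-- The odd part of the norm of `x` is `r` modulo `4`. -/
def OddNorm (r : ℤ) (x : O) : Prop := ∃ (n : ℕ) (m : ℤ), x.norm = 2 ^ n * m ∧ m % 4 = r

lemma OddNorm.eq {r r' : ℤ} {x : O} (h : OddNorm r x) (h' : OddNorm r' x)
    (hr : r % 2 = 1) (hr' : r' % 2 = 1) : r = r' := by
  obtain ⟨n, m, h1, h2⟩ := h
  obtain ⟨n', m', h3, h4⟩ := h'
  rw [h1] at h3
  clear h1
  induction n generalizing n' with
  | zero =>
    cases n' with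
    | zero => simp at h3; omega
    | succ k =>
      rw [pow_succ, mul_comm, mul_comm _ (2 : ℤ), mul_assoc] at h3
      omega
  | succ k ih =>
    cases n' with
    | zero =>
      rw [pow_succ, mul_comm, mul_comm _ (2 : ℤ), ← mul_assoc, mul_comm m, mul_assoc] at h3
      omega
    | succ k' =>
      refine ih k' ?_
      rw [pow_succ, pow_succ] at h3
      linarith

lemma OddNorm.mul {r r' : ℤ} {x y : O} (h : OddNorm r x) (h' : OddNorm r' y) :
    OddNorm (r * r' % 4) (x * y) := by
  obtain ⟨n, m, h1, h2⟩ := h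
  obtain ⟨n', m', h3, h4⟩ := h'
  exact ⟨n + n', m * m', by rw [Zsqrtd.norm_mul, h1, h3]; ring, by rw [Int.mul_emod, h2, h4]⟩

lemma exists_two_pow_mul (n : ℤ) (hn : n ≠ 0) : ∃ (k : ℕ) (m : ℤ), n = 2 ^ k * m ∧ m % 2 = 1 := by
  induction h : n.natAbs using Nat.strong_induction_on generalizing n with
  | _ N ih =>
    by_cases h2 : n % 2 = 1
    · exact ⟨0, n, by simp, h2⟩
    · obtain ⟨k, m, h3, h4⟩ := ih (n / 2).natAbs (by omega) (n / 2) (by omega) rfl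
      exact ⟨k + 1, m, by rw [pow_succ, mul_assoc, mul_left_comm, ← h3]; omega, h4⟩

lemma OddNorm.sq {t : O} (ht : t ≠ 0) : OddNorm 1 (t ^ 2) := by
  obtain ⟨k, m, h, hm⟩ := exists_two_pow_mul t.norm (norm_pos' ht).ne'
  refine ⟨2 * k, m ^ 2, by rw [pow_two, Zsqrtd.norm_mul, h]; ring, ?_⟩
  have : m % 4 = 1 ∨ m % 4 = 3 := by omega
  rcases this with h | h <;> simp [pow_two, Int.mul_emod, h]

lemma OddNorm.unit {e : O} (he : e = 1 ∨ e = -1) : OddNorm 1 e := by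
  rcases he with rfl | rfl
  · exact ⟨0, 1, by decide, rfl⟩
  · exact ⟨0, 1, by decide, rfl⟩

lemma oddNorm_s : OddNorm 1 s := ⟨1, 1, by decide, rfl⟩

lemma OddNorm.natCast {p : ℕ} (hp : p % 2 = 1) : OddNorm 1 (p : O) := by
  refine ⟨0, (p : ℤ) ^ 2, by rw [norm_eq]; simp, ?_⟩
  have : (p : ℤ) % 4 = 1 ∨ (p : ℤ) % 4 = 3 := by omega
  rcases this with h | h <;> simp [pow_two, Int.mul_emod, h]

lemma OddNorm.of_odd_even {x : O} (h : x.re % 2 = 1) (h' : x.im % 2 = 0) : OddNorm 1 x := by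
  refine ⟨0, x.norm, by simp, ?_⟩
  rw [norm_eq]
  have h1 : x.re % 4 = 1 ∨ x.re % 4 = 3 := by omega
  have h2 : x.im % 4 = 0 ∨ x.im % 4 = 2 := by omega
  rcases h1 with h1 | h1 <;> rcases h2 with h2 | h2 <;>
    simp [pow_two, Int.add_emod, Int.mul_emod, h1, h2]

lemma OddNorm.of_odd_odd {x : O} (h : x.re % 2 = 1) (h' : x.im % 2 = 1) : OddNorm 3 x := by
  refine ⟨0, x.norm, by simp, ?_⟩
  rw [norm_eq]
  have h1 : x.re % 4 = 1 ∨ x.re % 4 = 3 := by omega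
  have h2 : x.im % 4 = 1 ∨ x.im % 4 = 3 := by omega
  rcases h1 with h1 | h1 <;> rcases h2 with h2 | h2 <;>
    simp [pow_two, Int.add_emod, Int.mul_emod, h1, h2]

lemma exists_nearest_elt (x : O) (n : ℤ) (hn : 0 < n) :
    ∃ q : O, 4 * (x - q * n).norm ≤ 3 * n ^ 2 := by
  obtain ⟨q1, h1⟩ := exists_nearest x.re n hn
  obtain ⟨q2, h2⟩ := exists_nearest x.im n hn
  refine ⟨⟨q1, q2⟩, ?_⟩
  have h3 : (x - ⟨q1, q2⟩ * (n : O)).norm = (x.re - q1 * n) ^ 2 + 2 * (x.im - q2 * n) ^ 2 := by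
    rw [norm_eq]; simp
  rw [h3]
  set A := x.re - q1 * n
  set B := x.im - q2 * n
  have hA : 4 * A ^ 2 ≤ n ^ 2 := by rw [← sq_abs A]; nlinarith [abs_nonneg A]
  have hB : 4 * B ^ 2 ≤ n ^ 2 := by rw [← sq_abs B]; nlinarith [abs_nonneg B]
  linarith

/-- A positive definite Hermitian form on `O²`. -/
def hform (u v : O) : ℤ := 2 * u.norm + 3 * v.norm

lemma hform_lagrange (u v u' v' : O) :
    hform u v * hform u' v' = (2 * u' * star u + 3 * v' * star v).norm
      + 6 * (u * v' - u' * v).norm := by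
  simp only [hform, norm_eq]
  simp
  ring

lemma norm_sq_sub_le (u v : O) :
    4 * (u ^ 2 - s * v ^ 2).norm + v.norm ^ 2 ≤ hform u v ^ 2 := by
  simp only [hform, norm_eq, pow_two]
  simp
  have := sq_nonneg (u.re * v.re + 2 * u.im * v.im)
  set c := u.re * v.re + 2 * u.im * v.im with hc
  set d := u.im * v.re - u.re * v.im with hd
  have h : 0 ≤ 3 * c ^ 2 + 8 * c * d + 6 * d ^ 2 := by
    nlinarith [sq_nonneg (3 * c + 4 * d), sq_nonneg d]
  have h' : 0 ≤ 3 * c ^ 2 - 8 * c * d + 6 * d ^ 2 := by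
    nlinarith [sq_nonneg (3 * c - 4 * d), sq_nonneg d]
  rw [hc, hd] at h h'
  nlinarith

lemma exists_sqrt_mod {p : ℕ} (hp : p.Prime) (h8 : p % 8 = 7) : ∃ r : O, (p : O) ∣ r ^ 2 - s := by
  have := Fact.mk hp
  have hp2 : p ≠ 2 := by omega
  obtain ⟨t, ht⟩ := (ZMod.exists_sq_eq_two_iff hp2).2 (Or.inr h8)
  have ht0 : t ≠ 0 := by
    rintro rfl
    have : ((2 : ℕ) : ZMod p) = 0 := by push_cast; simpa using ht
    rw [ZMod.natCast_eq_zero_iff] at this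
    have := Nat.le_of_dvd (by norm_num) this
    omega
  have h1 : ∃ w : ZMod p, w ^ 4 = 2 := by
    have hn1 : ¬ IsSquare (-1 : ZMod p) := by
      rw [ZMod.exists_sq_eq_neg_one_iff]; omega
    by_cases hsq : IsSquare t
    · obtain ⟨w, rfl⟩ := hsq
      exact ⟨w, by rw [ht]; ring⟩
    · have hsq' : IsSquare (-t) := by
        have e1 : quadraticChar (ZMod p) t = -1 := quadraticChar_neg_one_iff_not_isSquare.2 hsq
        have e2 : quadraticChar (ZMod p) (-1) = -1 := quadraticChar_neg_one_iff_not_isSquare.2 hn1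
        rw [← quadraticChar_one_iff_isSquare (neg_ne_zero.2 ht0), neg_eq_neg_one_mul, map_mul,
          e1, e2]
        rfl
      obtain ⟨w, hw⟩ := hsq'
      exact ⟨w, by rw [ht]; linear_combination (w * w - t) * (-hw)⟩
  obtain ⟨w, hw⟩ := h1
  have hw0 : w ≠ 0 := by
    rintro rfl
    apply ht0
    have : t * t = 0 := by rw [← ht, ← hw]; ring
    simpa using this
  obtain ⟨x, hx⟩ := ZMod.intCast_surjective (w⁻¹)
  obtain ⟨y, hy⟩ := ZMod.intCast_surjective (w⁻¹ ^ 3)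
  refine ⟨⟨x, y⟩, ?_⟩
  have : (p : O) = ((p : ℤ) : O) := by simp
  rw [this, Zsqrtd.intCast_dvd, ← ZMod.intCast_zmod_eq_zero_iff_dvd,
    ← ZMod.intCast_zmod_eq_zero_iff_dvd]
  simp only [pow_two, Zsqrtd.re_sub, Zsqrtd.im_sub, Zsqrtd.re_mul, Zsqrtd.im_mul]
  push_cast
  rw [hx, hy]
  constructor
  · field_simp
    rw [hw]; ring
  · field_simp
    rw [hw]; ring

lemma exists_small_norm {p : ℕ} (hp : p.Prime) (h8 : p % 8 = 7) :
    ∃ u v k : O, u ^ 2 - s * v ^ 2 = p * k ∧ k ≠ 0 ∧ k.norm < 6 := by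
  obtain ⟨r, k0, hr⟩ := exists_sqrt_mod hp h8
  have hp0 : (p : O) ≠ 0 := by exact_mod_cast hp.ne_zero
  let U : O × O → O := fun x => x.1 * p + x.2 * r
  obtain ⟨⟨α, γ⟩, hne, hmin⟩ := WellFounded.has_min
    (InvImage.wf (fun x : O × O => (hform (U x) x.2).natAbs) Nat.lt_wfRel.wf) {x | x ≠ 0}
    ⟨(1, 0), by simp⟩
  have hpos : ∀ u v : O, 0 ≤ hform u v := fun u v => by
    have := norm_nonneg' u; have := norm_nonneg' v; simp only [hform]; positivity
  have hU : ∀ x : O × O, x ≠ 0 → ¬ (U x = 0 ∧ x.2 = 0) := by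
    rintro ⟨a, b⟩ hx ⟨h1, h2⟩
    simp only [U] at h1 h2
    subst h2
    simp [hp0] at h1
    exact hx (by simp [h1])
  have hpos' : ∀ x : O × O, x ≠ 0 → 0 < hform (U x) x.2 := fun x hx => by
    have h1 := norm_nonneg' (U x); have h2 := norm_nonneg' x.2
    by_contra hc
    refine hU x hx ⟨?_, ?_⟩ <;> rw [← Zsqrtd.norm_eq_zero_iff (by norm_num)] <;>
      simp only [hform] at hc <;> omega
  have hmin' : ∀ x : O × O, x ≠ 0 → hform (U (α, γ)) γ ≤ hform (U x) x.2 := fun x hx => by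
    have h1 := hmin x hx
    change ¬ ((hform (U x) x.2).natAbs < (hform (U (α, γ)) γ).natAbs) at h1
    have := hpos (U x) x.2
    have := hpos (U (α, γ)) γ
    omega
  have hcop : IsCoprime α γ := by
    refine isCoprime_of_prime_dvd (fun h => hne (by ext <;> simp [h.1, h.2])) ?_
    rintro q hq ⟨α', rfl⟩ ⟨γ', rfl⟩
    have hne' : (α', γ') ≠ 0 := by
      rintro h
      simp only [Prod.mk_eq_zero] at h
      exact hne (by simp [h.1, h.2])
    have h1 := hmin' _ hne'
    have h2 : hform (U (q * α', q * γ')) (q * γ') = q.norm * hform (U (α', γ')) γ' := by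
      have : U (q * α', q * γ') = q * U (α', γ') := by simp only [U]; ring
      rw [this, hform, hform, Zsqrtd.norm_mul, Zsqrtd.norm_mul]; ring
    rw [h2] at h1
    have h3 := hpos' _ hne'
    simp only at h3 h1
    have h4 : 2 ≤ q.norm := by
      have := norm_pos' hq.ne_zero
      have h5 : q.norm.natAbs ≠ 1 := fun h => hq.not_isUnit (Zsqrtd.norm_eq_one_iff.1 h)
      omega
    nlinarith
  obtain ⟨a, b, hab⟩ := hcop
  set m := hform (U (α, γ)) γ with hm
  have hm0 : 0 < m := hpos' _ hne
  let ip : O × O → O := fun x => 2 * U x * star (U (α, γ)) + 3 * x.2 * star γ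
  obtain ⟨q, hq⟩ := exists_nearest_elt (ip (-b, a)) m hm0
  have hip : ip (-b - q * α, a - q * γ) = ip (-b, a) - q * m := by
    have : (m : O) = ip (α, γ) := by
      simp only [ip, hm, hform]
      push_cast
      rw [Zsqrtd.norm_eq_mul_conj, Zsqrtd.norm_eq_mul_conj]; ring
    rw [this]; simp only [ip, U]; ring
  have hdet : U (α, γ) * (a - q * γ) - U (-b - q * α, a - q * γ) * γ = p := by
    simp only [U]; linear_combination (p : O) * hab
  have hne2 : ((-b - q * α, a - q * γ) : O × O) ≠ 0 := by
    intro h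
    simp only [Prod.mk_eq_zero] at h
    rw [h.1, h.2] at hdet
    simp [U] at hdet
    exact hp0 hdet.symm
  have hL := hform_lagrange (U (α, γ)) γ (U (-b - q * α, a - q * γ)) (a - q * γ)
  rw [hdet] at hL
  have h5 := hmin' _ hne2
  simp only at h5
  change m * _ = (ip (-b - q * α, a - q * γ)).norm + _ at hL
  rw [hip] at hL
  have hpn : (p : O).norm = (p : ℤ) ^ 2 := by rw [norm_eq]; simp
  rw [hpn] at hL
  have h6 : m ^ 2 ≤ 24 * (p : ℤ) ^ 2 := by nlinarith
  have h7 := norm_sq_sub_le (U (α, γ)) γ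
  rw [← hm] at h7
  have h8' : U (α, γ) ^ 2 - s * γ ^ 2 = p * (α ^ 2 * p + 2 * α * γ * r + γ ^ 2 * k0) := by
    simp only [U]; linear_combination γ ^ 2 * hr
  rw [h8', Zsqrtd.norm_mul, hpn] at h7
  set k := α ^ 2 * p + 2 * α * γ * r + γ ^ 2 * k0
  have hpp : 0 < (p : ℤ) ^ 2 := by have := hp.pos; positivity
  refine ⟨_, _, k, h8', ?_, ?_⟩
  · intro hk
    rw [hk, mul_zero, sub_eq_zero] at h8'
    have hγ : γ = 0 := eq_zero_of_odd_eq_even prime_s (u := 1) (w := 1)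
      prime_s.not_dvd_one prime_s.not_dvd_one γ (U (α, γ)) (by rw [one_mul, mul_one, h8'])
    refine hU _ hne ⟨?_, hγ⟩
    rw [hγ] at h8' ⊢
    simpa using h8'
  · by_cases hγ : γ = 0
    · exfalso
      have : m = 2 * ((p : ℤ) ^ 2 * α.norm) := by
        rw [hm, hγ]; simp [hform, U, Zsqrtd.norm_mul, hpn, Zsqrtd.norm_zero]; ring
      have h9 : α ≠ 0 := by rintro rfl; exact hne (by simp [hγ])
      have h10 := norm_pos' h9
      have h11 : 2 * (p : ℤ) ^ 2 ≤ m := by nlinarith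
      have h12 : (7 : ℤ) ≤ p := by omega
      have h13 : 49 ≤ (p : ℤ) ^ 2 := by nlinarith
      have h14 : (2 * (p : ℤ) ^ 2) ^ 2 ≤ m ^ 2 := by gcongr
      nlinarith
    · have := norm_pos' hγ
      nlinarith [pow_pos this 2]

lemma exists_norm_form_of_mul {k p : O} (h : ∃ u v : O, u ^ 2 - s * v ^ 2 = p * (s * k)) :
    ∃ u v : O, u ^ 2 - s * v ^ 2 = p * -k := by
  obtain ⟨u, v, h⟩ := h
  have : s ∣ u := prime_s.dvd_of_dvd_pow (n := 2) ⟨v ^ 2 + p * k, by linear_combination h⟩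
  obtain ⟨u', rfl⟩ := this
  exact ⟨v, u', mul_left_cancel₀ prime_s.ne_zero (by linear_combination -h)⟩

lemma exists_norm_form_neg {p : O} (h : ∃ u v : O, u ^ 2 - s * v ^ 2 = p) :
    ∃ u v : O, u ^ 2 - s * v ^ 2 = -p := by
  obtain ⟨u, v, h⟩ := h
  refine ⟨u * (s - 1) + s * v * s, u * s + v * (s - 1), ?_⟩
  linear_combination -h + (u ^ 2 * (1 - s) + v ^ 2 * s * (s - 1)) * s_sq

lemma exists_norm_form_bb {p : O} (h : ∃ u v : O, u ^ 2 - s * v ^ 2 = p * bb) :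
    ∃ u v : O, u ^ 2 - s * v ^ 2 = p := by
  obtain ⟨u, v, h⟩ := h
  have key : ∀ v : O, u ^ 2 - s * v ^ 2 = p * bb → bb ∣ v - u →
      ∃ u v : O, u ^ 2 - s * v ^ 2 = p := by
    rintro v h ⟨w, hw⟩
    have hv : v = u + bb * w := by linear_combination hw
    subst hv
    refine ⟨u - s * w, w, mul_left_cancel₀ prime_bb.ne_zero ?_⟩
    rw [bb_eq] at h ⊢
    linear_combination h
  have h1 : bb ∣ (v - u) * (-v - u) := ⟨p - v ^ 2, by
    rw [bb_eq] at h ⊢; linear_combination h⟩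
  rcases prime_bb.dvd_or_dvd h1 with h1 | h1
  · exact key v h h1
  · exact key (-v) (by linear_combination h) h1

lemma exists_norm_form {p : ℕ} (hp : p.Prime) (h8 : p % 8 = 7) (h3 : p % 3 = 2) :
    ∃ u v : O, u ^ 2 - s * v ^ 2 = p := by
  have main : ∀ k : O, (∃ u v : O, u ^ 2 - s * v ^ 2 = p * k) → k ≠ 0 → k.norm < 6 →
      ∃ u v : O, u ^ 2 - s * v ^ 2 = p := by
    rintro ⟨x, y⟩ h hk hn
    have one : (∃ u v : O, u ^ 2 - s * v ^ 2 = p * 1) → ∃ u v : O, u ^ 2 - s * v ^ 2 = p := by simp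
    have neg : (∃ u v : O, u ^ 2 - s * v ^ 2 = p * -1) → ∃ u v : O, u ^ 2 - s * v ^ 2 = p :=
      fun h => by simpa using exists_norm_form_neg h
    have nos : ∀ e : O, e = 1 ∨ e = -1 → (∃ u v : O, u ^ 2 - s * v ^ 2 = p * (be * e)) → False := by
      rintro e he ⟨u, v, h⟩
      have h1 := congrArg modBe h
      simp only [map_sub, map_mul, map_pow, modBe_s, modBe_be, zero_mul, mul_zero] at h1
      have h2 : modBe u = 0 ∧ modBe v = 0 := by
        generalize modBe u = a at h1; generalize modBe v = b at h1; decide +revert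
      rw [modBe_eq_zero, modBe_eq_zero] at h2
      obtain ⟨⟨u', rfl⟩, ⟨v', rfl⟩⟩ := h2
      have h3 : be * (u' ^ 2 - s * v' ^ 2) = p * e :=
        mul_left_cancel₀ prime_be.ne_zero (by linear_combination h)
      have h4 := congrArg modBe h3
      rw [map_mul, map_mul, modBe_be, modBe_natCast ‹_›] at h4
      rcases he with rfl | rfl <;> simp at h4
    rw [norm_eq] at hn
    simp only at hn
    have hx : x ≤ 2 := by nlinarith [sq_nonneg y]
    have hx' : -2 ≤ x := by nlinarith [sq_nonneg y]
    have hy : y ≤ 1 := by nlinarith [sq_nonneg x]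
    have hy' : -1 ≤ y := by nlinarith [sq_nonneg x]
    interval_cases x <;> interval_cases y <;> first | (exfalso; omega) | skip
    · rw [show (⟨-2, 0⟩ : O) = s * s by decide] at h
      have := exists_norm_form_of_mul h
      rw [show (p : O) * -s = p * (s * -1) by ring] at this
      exact one (by simpa using exists_norm_form_of_mul this)
    · rw [show (⟨-1, -1⟩ : O) = be * -1 by decide] at h
      exact (nos _ (Or.inr rfl) h).elim
    · exact neg h
    · rw [show (⟨-1, 1⟩ : O) = -1 * bb by decide, ← mul_assoc] at h
      exact neg (exists_norm_form_bb h)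
    · rw [show (⟨0, -1⟩ : O) = s * -1 by decide] at h
      exact one (by simpa using exists_norm_form_of_mul h)
    · exact (hk rfl).elim
    · rw [show (⟨0, 1⟩ : O) = s * 1 by decide] at h
      exact neg (exists_norm_form_of_mul h)
    · exact exists_norm_form_bb h
    · exact one h
    · rw [show (⟨1, 1⟩ : O) = be * 1 by decide] at h
      exact (nos _ (Or.inl rfl) h).elim
    · rw [show (⟨2, 0⟩ : O) = s * (s * -1) by decide] at h
      have := exists_norm_form_of_mul h
      rw [show (p : O) * -(s * -1) = p * (s * 1) by ring] at this
      exact neg (exists_norm_form_of_mul this)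
  obtain ⟨u, v, k, h, hk, hn⟩ := exists_small_norm hp h8
  exact main k ⟨u, v, h⟩ hk hn

/-- Thue's lemma. -/
lemma thue {p : ℕ} (hp : p.Prime) (t : ZMod p) :
    ∃ x y : ℤ, (x : ZMod p) = t * y ∧ (x ≠ 0 ∨ y ≠ 0) ∧ x ^ 2 < p ∧ y ^ 2 < p := by
  have := Fact.mk hp
  let n := Nat.sqrt p
  have hn1 : p < (n + 1) * (n + 1) := Nat.lt_succ_sqrt p
  have hn2 : n * n ≤ p := Nat.sqrt_le p
  have hn3 : n * n < p := lt_of_le_of_ne hn2 fun h => Irreducible.not_isSquare hp ⟨n, h.symm⟩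
  let f : Fin (n + 1) × Fin (n + 1) → ZMod p := fun a => (a.1 : ℕ) - t * (a.2 : ℕ)
  obtain ⟨a, b, hab, hf⟩ := Fintype.exists_ne_map_eq_of_card_lt f (by simpa [ZMod.card] using hn1)
  have bd : ∀ i j : Fin (n + 1), (((i : ℕ) : ℤ) - (j : ℕ)) ^ 2 < p := fun i j => by
    have h1 : ((i : ℕ) : ℤ) ≤ n := by have := i.2; omega
    have h2 : ((j : ℕ) : ℤ) ≤ n := by have := j.2; omega
    have h3 : ((n : ℤ) * n) < p := by exact_mod_cast hn3
    have h4 : |((i : ℕ) : ℤ) - (j : ℕ)| ≤ n := by rw [abs_le]; constructor <;> omega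
    rw [← sq_abs]; nlinarith [abs_nonneg (((i : ℕ) : ℤ) - (j : ℕ))]
  refine ⟨(a.1 : ℕ) - (b.1 : ℕ), (a.2 : ℕ) - (b.2 : ℕ), ?_, ?_, bd _ _, bd _ _⟩
  · simp only [f] at hf
    push_cast
    linear_combination hf
  · by_contra! hc
    apply hab
    ext
    · have := hc.1; omega
    · have := hc.2; omega

lemma exists_eq_sq_sub_two_sq {p : ℕ} (hp : p.Prime) (h8 : p % 8 = 7) :
    ∃ x y : ℤ, x ^ 2 - 2 * y ^ 2 = p := by
  have := Fact.mk hp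
  obtain ⟨t, ht⟩ := (ZMod.exists_sq_eq_two_iff (p := p) (by omega)).2 (Or.inr h8)
  obtain ⟨x, y, h1, h2, h3, h4⟩ := thue hp t
  have h5 : (p : ℤ) ∣ x ^ 2 - 2 * y ^ 2 := by
    rw [← ZMod.intCast_zmod_eq_zero_iff_dvd]
    push_cast
    rw [h1, ht]; ring
  obtain ⟨k, hk⟩ := h5
  have hp0 : (0 : ℤ) < p := by exact_mod_cast hp.pos
  have hk1 : k < 1 := by nlinarith [sq_nonneg y]
  have hk2 : -2 < k := by nlinarith [sq_nonneg x]
  have hk3 : k ≠ 0 := by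
    rintro rfl
    have h6 : x ^ 2 = 2 * y ^ 2 := by linarith
    by_cases hy : y = 0
    · subst hy; simp at h6; simp [h6] at h2
    · have hirr := irrational_sqrt_two
      apply hirr
      refine ⟨|(x : ℚ) / y|, ?_⟩
      rw [eq_comm, Real.sqrt_eq_iff_mul_self_eq (by norm_num) (by positivity)]
      have h6' : (x : ℝ) ^ 2 = 2 * y ^ 2 := by exact_mod_cast h6
      have hy' : (y : ℝ) ≠ 0 := by exact_mod_cast hy
      push_cast
      rw [abs_mul_abs_self]
      field_simp
      linarith
  obtain rfl : k = -1 := by omega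
  exact ⟨x + 2 * y, x + y, by linear_combination -hk⟩

lemma mod_eight_of_coprime_form (u w v1 v2 : ℤ) (hu : u % 2 = 1) (hc : IsCoprime u w)
    (hv : v1 ≠ 0 ∨ v2 ≠ 0) (h : u * w = v1 ^ 2 - 2 * v2 ^ 2) : u % 8 = 1 ∨ u % 8 = 7 := by
  induction hN : v1.natAbs + v2.natAbs using Nat.strong_induction_on generalizing u w v1 v2 with
  | _ N ih =>
  by_cases hg : Int.gcd v1 v2 = 1
  · have hcop : IsCoprime v2 u := by
      refine isCoprime_of_prime_dvd (by omega) ?_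
      rintro q hq hq2 hqu
      have h1 : q ∣ v1 ^ 2 := by
        have : v1 ^ 2 = u * w + 2 * v2 * v2 := by linarith
        rw [this]
        exact dvd_add (hqu.mul_right _) (hq2.mul_left _)
      have h2 := hq.dvd_of_dvd_pow h1
      have h3 : IsCoprime v1 v2 := Int.isCoprime_iff_gcd_eq_one.2 hg
      exact hq.not_isUnit (h3.isUnit_of_dvd' h2 hq2)
    have hcop1 : IsCoprime v1 u := by
      refine isCoprime_of_prime_dvd (by omega) ?_
      rintro q hq hq1 hqu
      have h1 : q ∣ 2 * v2 ^ 2 := by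
        have : 2 * v2 ^ 2 = v1 * v1 - u * w := by linarith
        rw [this]
        exact dvd_sub (hq1.mul_right _) (hqu.mul_right _)
      rcases hq.dvd_or_dvd h1 with h2 | h2
      · have h3 : IsCoprime (2 : ℤ) u := ⟨-(u / 2), 1, by omega⟩
        exact hq.not_isUnit (h3.isUnit_of_dvd' h2 hqu)
      · exact hq.not_isUnit (hcop.isUnit_of_dvd' (hq.dvd_of_dvd_pow h2) hqu)
    have hj : jacobiSym 2 u.natAbs = 1 := by
      have e1 : jacobiSym (2 * v2 ^ 2) u.natAbs = jacobiSym (v1 ^ 2) u.natAbs := by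
        apply jacobiSym.mod_left'
        rw [Int.natCast_natAbs, Int.emod_abs, Int.emod_abs]
        rw [show 2 * v2 ^ 2 = v1 ^ 2 + u * (-w) by linarith]
        simp
      rw [jacobiSym.mul_left, jacobiSym.sq_one', jacobiSym.sq_one', mul_one] at e1
      · exact e1
      · rw [Int.isCoprime_iff_gcd_eq_one] at hcop1
        simpa [Int.gcd, Int.natAbs_abs] using hcop1
      · rw [Int.isCoprime_iff_gcd_eq_one] at hcop
        simpa [Int.gcd, Int.natAbs_abs] using hcop
    rw [jacobiSym.at_two] at hj
    · have : u.natAbs % 8 = 1 ∨ u.natAbs % 8 = 7 := by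
        have e2 : u.natAbs % 8 < 8 := by omega
        rw [ZMod.χ₈_nat_mod_eight] at hj
        have e3 : (u.natAbs % 8) % 2 = 1 := by omega
        generalize u.natAbs % 8 = r at hj e2 e3 ⊢
        interval_cases r <;> first | omega | (revert hj; decide)
      omega
    · rw [Nat.odd_iff]; omega
  · obtain ⟨q, hq, hqg⟩ := Nat.exists_prime_and_dvd hg
    have hq' : Prime (q : ℤ) := Nat.prime_iff_prime_int.1 hq
    have hq1 : (q : ℤ) ∣ v1 := (Int.natCast_dvd_natCast.2 hqg).trans (Int.gcd_dvd_left ..)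
    have hq2 : (q : ℤ) ∣ v2 := (Int.natCast_dvd_natCast.2 hqg).trans (Int.gcd_dvd_right ..)
    obtain ⟨a, rfl⟩ := hq1
    obtain ⟨b, rfl⟩ := hq2
    have hab : a ≠ 0 ∨ b ≠ 0 := by
      rcases hv with hv | hv
      · left; rintro rfl; simp at hv
      · right; rintro rfl; simp at hv
    have hlt : a.natAbs + b.natAbs < N := by
      rw [← hN, Int.natAbs_mul, Int.natAbs_mul, Int.natAbs_natCast]
      have := hq.two_le
      have : 0 < a.natAbs + b.natAbs := by omega
      nlinarith
    have hsq : (q : ℤ) ^ 2 ∣ u * w := ⟨a ^ 2 - 2 * b ^ 2, by rw [h]; ring⟩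
    have hq0 : (q : ℤ) ^ 2 ≠ 0 := pow_ne_zero 2 hq'.ne_zero
    by_cases hqu : (q : ℤ) ∣ u
    · have hqw : IsCoprime ((q : ℤ) ^ 2) w :=
        ((hc.of_isCoprime_of_dvd_left hqu)).pow_left
      obtain ⟨u', rfl⟩ := hqw.dvd_of_dvd_mul_right hsq
      have hqodd : (q : ℤ) % 2 = 1 := by
        rcases Int.emod_two_eq_zero_or_one q with h0 | h0
        · simp [pow_two, Int.mul_emod, h0] at hu
        · exact h0
      have hq8 : (q : ℤ) ^ 2 % 8 = 1 := by
        have : (q : ℤ) % 8 = 1 ∨ (q : ℤ) % 8 = 3 ∨ (q : ℤ) % 8 = 5 ∨ (q : ℤ) % 8 = 7 := by omega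
        rcases this with h | h | h | h <;> simp [pow_two, Int.mul_emod, h]
      have hu8 : ((q : ℤ) ^ 2 * u') % 8 = u' % 8 := by
        rw [Int.mul_emod, hq8]; simp
      rw [hu8]
      refine ih _ hlt u' w a b (by omega) (hc.of_isCoprime_of_dvd_left (Dvd.intro_left _ rfl)) hab
        (mul_left_cancel₀ hq0 (by linear_combination h)) rfl
    · have hqw : IsCoprime ((q : ℤ) ^ 2) u :=
        ((hq'.coprime_iff_not_dvd).2 hqu).pow_left
      obtain ⟨w', rfl⟩ := hqw.dvd_of_dvd_mul_left hsq
      exact ih _ hlt u w' a b hu (hc.of_isCoprime_of_dvd_right (Dvd.intro_left _ rfl)) hab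
        (mul_left_cancel₀ hq0 (by linear_combination h)) rfl

/-- A variant of `mod_eight_of_coprime_form` with a weaker coprimality assumption. -/
lemma mod_eight_of_form (u w v1 v2 : ℤ) (hu : u % 2 = 1)
    (hc : ∀ q : ℤ, Prime q → q ∣ u → q ∣ w → q ∣ v1 → q ∣ v2 → False)
    (hv : v1 ≠ 0 ∨ v2 ≠ 0) (h : u * w = v1 ^ 2 - 2 * v2 ^ 2) : u % 8 = 1 ∨ u % 8 = 7 := by
  induction hN : u.natAbs using Nat.strong_induction_on generalizing u w with
  | _ N ih =>
  by_cases hcop : IsCoprime u w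
  · exact mod_eight_of_coprime_form u w v1 v2 hu hcop hv h
  · rw [Int.isCoprime_iff_gcd_eq_one] at hcop
    obtain ⟨q, hq, hqg⟩ := Nat.exists_prime_and_dvd hcop
    have hq' : Prime (q : ℤ) := Nat.prime_iff_prime_int.1 hq
    have hqu : (q : ℤ) ∣ u := (Int.natCast_dvd_natCast.2 hqg).trans (Int.gcd_dvd_left ..)
    have hqw : (q : ℤ) ∣ w := (Int.natCast_dvd_natCast.2 hqg).trans (Int.gcd_dvd_right ..)
    have hq2 : q ≠ 2 := by rintro rfl; omega
    have hv2 : ¬ (q : ℤ) ∣ v2 := fun h2 => hc q hq' hqu hqw (hq'.dvd_of_dvd_pow (n := 2) (by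
      rw [show v1 ^ 2 = u * w + 2 * v2 * v2 by linarith]
      exact dvd_add (hqu.mul_right _) (h2.mul_left _))) h2
    have := Fact.mk hq
    have h2 : IsSquare (2 : ZMod q) := by
      have e1 : ((u * w : ℤ) : ZMod q) = ((v1 ^ 2 - 2 * v2 ^ 2 : ℤ) : ZMod q) := by rw [h]
      push_cast at e1
      rw [(ZMod.intCast_zmod_eq_zero_iff_dvd u q).2 hqu, zero_mul] at e1
      have e2 : (v2 : ZMod q) ≠ 0 := by rwa [Ne, ZMod.intCast_zmod_eq_zero_iff_dvd]
      exact ⟨v1 / v2, by field_simp; linear_combination e1⟩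
    have hq8 := (ZMod.exists_sq_eq_two_iff hq2).1 h2
    obtain ⟨u', rfl⟩ := hqu
    have hu' : u' ≠ 0 := by rintro rfl; simp at hu
    have hlt : u'.natAbs < N := by
      rw [← hN, Int.natAbs_mul, Int.natAbs_natCast]
      have := hq.two_le
      have : 0 < u'.natAbs := by omega
      nlinarith
    have hodd : u' % 2 = 1 := by
      rcases Int.emod_two_eq_zero_or_one u' with h0 | h0
      · simp [Int.mul_emod, h0] at hu
      · exact h0
    have hnd : ∀ r : ℤ, Prime r → r ∣ u' → r ∣ w * q → r ∣ v1 → r ∣ v2 → False := by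
      intro r hr h1 h2 h3 h4
      refine hc r hr (h1.mul_left _) ?_ h3 h4
      rcases hr.dvd_or_dvd h2 with h5 | h5
      · exact h5
      · exact absurd ((hr.associated_of_dvd hq' h5).dvd'.trans h4) hv2
    have := ih _ hlt u' (w * q) hodd hnd (by linear_combination h) rfl
    have hq8' : (q : ℤ) % 8 = 1 ∨ (q : ℤ) % 8 = 7 := by omega
    rcases this with h1 | h1 <;> rcases hq8' with h2 | h2 <;> simp [Int.mul_emod, h1, h2]

lemma sq_mod_eight {x : O} (h : x.re % 2 = 1) :
    (x.im % 4 = 0 ∧ (x ^ 2).re % 8 = 1 ∧ (x ^ 2).im % 8 = 0) ∨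
    (x.im % 4 = 2 ∧ (x ^ 2).re % 8 = 1 ∧ (x ^ 2).im % 8 = 4) ∨
    (x.im % 2 = 1 ∧ (x ^ 2).re % 8 = 7 ∧ ((x ^ 2).im % 8 = 2 ∨ (x ^ 2).im % 8 = 6)) := by
  have h1 : x.re % 8 = 1 ∨ x.re % 8 = 3 ∨ x.re % 8 = 5 ∨ x.re % 8 = 7 := by omega
  have h2 : x.im % 8 = 0 ∨ x.im % 8 = 1 ∨ x.im % 8 = 2 ∨ x.im % 8 = 3 ∨ x.im % 8 = 4 ∨
    x.im % 8 = 5 ∨ x.im % 8 = 6 ∨ x.im % 8 = 7 := by omega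
  have e1 : (x ^ 2).re = x.re * x.re + -2 * (x.im * x.im) := by simp [pow_two]; ring
  have e2 : (x ^ 2).im = 2 * (x.re * x.im) := by simp [pow_two]; ring
  have key : ∀ i j : ℤ, x.re % 8 = i → x.im % 8 = j →
      (x ^ 2).re % 8 = (i * i + -2 * (j * j)) % 8 ∧ (x ^ 2).im % 8 = (2 * (i * j)) % 8 := by
    rintro i j rfl rfl
    rw [e1, e2]
    constructor <;> (rw [← Int.ModEq.eq (n := 8)]; gcongr <;> exact Int.mod_modEq _ _)
  rcases h1 with h1 | h1 | h1 | h1 <;>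
    rcases h2 with h2 | h2 | h2 | h2 | h2 | h2 | h2 | h2 <;>
    · obtain ⟨k1, k2⟩ := key _ _ h1 h2
      norm_num at k1 k2
      omega

lemma exists_inverse_mod {z : O} (h : z.re % 2 = 1) :
    ∃ w : O, w.re % 2 = 1 ∧ (w * z).re % 16 = 1 ∧ (w * z).im % 16 = 0 := by
  have h1 : IsCoprime z.norm 16 := by
    have : z.norm % 2 = 1 := by
      rw [norm_eq]
      have : (z.re ^ 2) % 2 = 1 := by simp [pow_two, Int.mul_emod, h]
      omega
    have h2 : IsCoprime z.norm (2 ^ 4) := IsCoprime.pow_right ⟨1, -(z.norm / 2), by omega⟩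
    simpa using h2
  obtain ⟨a, b, hab⟩ := h1
  have hz : (a : O) * star z * z = ((a * z.norm : ℤ) : O) := by
    push_cast; rw [Zsqrtd.norm_eq_mul_conj]; ring
  refine ⟨a * star z, ?_, ?_, ?_⟩
  · have : a % 2 = 1 := by
      rcases Int.emod_two_eq_zero_or_one a with h0 | h0
      · have : (a * z.norm) % 2 = 0 := by simp [Int.mul_emod, h0]
        omega
      · exact h0
    simp [Int.mul_emod, h, this]
  · rw [hz, Zsqrtd.re_intCast]; omega
  · rw [hz, Zsqrtd.im_intCast]; rfl

lemma OddNorm.mk_mul_s {x : O} {r : ℤ} (h : OddNorm r (⟨x.im, -(x.re / 2)⟩ : O))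
    (hx : x.re % 2 = 0) : OddNorm r x := by
  have : x = s * ⟨x.im, -(x.re / 2)⟩ := by
    ext
    · simp; omega
    · simp
  rw [this]
  obtain ⟨n, m, h1, h2⟩ := h
  exact ⟨n + 1, m, by rw [Zsqrtd.norm_mul, h1, show s.norm = 2 by decide]; ring, h2⟩

lemma OddNorm.one_of_s {x : O} (h : x.re % 4 = 0) (h' : x.im % 2 = 1) : OddNorm 1 x :=
  (OddNorm.of_odd_even (by simpa using h') (by simp; omega)).mk_mul_s (by omega)

lemma OddNorm.three_of_s {x : O} (h : x.re % 4 = 2) (h' : x.im % 2 = 1) : OddNorm 3 x :=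
  (OddNorm.of_odd_odd (by simpa using h') (by simp; omega)).mk_mul_s (by omega)

lemma OddNorm.one_of_two {x : O} (h : x.re % 4 = 2) (h' : x.im % 4 = 0) : OddNorm 1 x :=
  (OddNorm.one_of_s (x := ⟨x.im, -(x.re / 2)⟩) h' (by simp; omega)).mk_mul_s (by omega)

lemma OddNorm.three_of_two {x : O} (h : x.re % 4 = 2) (h' : x.im % 4 = 2) : OddNorm 3 x :=
  (OddNorm.three_of_s (x := ⟨x.im, -(x.re / 2)⟩) h' (by simp; omega)).mk_mul_s (by omega)

lemma re_sq_mod_two (x : O) : (x ^ 2).re % 2 = x.re % 2 := by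
  have : (x ^ 2).re = x.re * x.re + -2 * (x.im * x.im) := by simp [pow_two]; ring
  rcases Int.emod_two_eq_zero_or_one x.re with h | h <;>
    simp [this, Int.add_emod, Int.mul_emod, h]

lemma im_sq_mod_two (x : O) : (x ^ 2).im % 2 = 0 := by
  have : (x ^ 2).im = 2 * (x.re * x.im) := by simp [pow_two]; ring
  omega

lemma one_sq_mod {p : ℕ} (hp : p % 16 = 7) {z : O} (h : z.re % 16 = 1) (h' : z.im % 16 = 0) :
    ((p : ℤ) * (z ^ 2).re) % 16 = 7 ∧ ((p : ℤ) * (z ^ 2).im) % 16 = 0 := by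
  have e1 : (z ^ 2).re = z.re * z.re + -2 * (z.im * z.im) := by simp [pow_two]; ring
  have e2 : (z ^ 2).im = 2 * (z.re * z.im) := by simp [pow_two]; ring
  have hp' : (p : ℤ) % 16 = 7 := by omega
  have e3 : (z.im * z.im) % 16 = 0 := by simp [Int.mul_emod, h']
  have e4 : (z.re * z.re) % 16 = 1 := by simp [Int.mul_emod, h]
  have e5 : (z.re * z.im) % 16 = 0 := by simp [Int.mul_emod, h']
  have e6 : (z ^ 2).re % 16 = 1 := by omega
  have e7 : (z ^ 2).im % 16 = 0 := by omega
  simp [Int.mul_emod, e6, e7, hp']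

lemma mod_four_cast {x i : ℤ} (h : x % 4 = i) : (x : ZMod 4) = i := by
  rw [← h]; exact ((ZMod.intCast_eq_intCast_iff _ _ 4).2 (Int.mod_modEq x 4)).symm

lemma mod_four_of_cast {x i : ℤ} (h : (x : ZMod 4) = i) : x % 4 = i % 4 :=
  (ZMod.intCast_eq_intCast_iff _ _ 4).1 h

set_option maxHeartbeats 4000000 in
lemma mulS_two_adic {p : ℕ} (hp : p % 16 = 7) {a b c z u v : O}
    (hz : z.re % 16 = 1) (hz' : z.im % 16 = 0)
    (h1 : s * c ^ 2 - a ^ 2 = p * bb * z ^ 2) (h2 : be ^ 2 * c ^ 2 + bb * b ^ 2 = s * a ^ 2)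
    (h3 : bb * c ^ 2 - b ^ 2 = s * p * z ^ 2)
    (hu : u.re % 2 = 1) (hu' : u.im % 4 = 2) (hv : v.re % 4 = 2) (hv' : v.im % 2 = 0)
    (hau : (a.re + u.re) % 4 = 0) (hbc : (b.re + c.re) % 4 = 0) :
    OddNorm 3 ((s * c * (u + v) - a * (u + s * v) - p * bb * z) *
      (be ^ 2 * c + bb * b - s * a)) := by
  obtain ⟨k1, k2⟩ := one_sq_mod hp hz hz'
  have a1 := re_sq_mod_two a
  have b1 := re_sq_mod_two b
  have c1 := re_sq_mod_two c
  have b2 := im_sq_mod_two b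
  have c2 := im_sq_mod_two c
  have e1 := congrArg Zsqrtd.re h1
  have e2 := congrArg Zsqrtd.im h1
  have e3 := congrArg Zsqrtd.re h2
  have e4 := congrArg Zsqrtd.im h2
  have e5 := congrArg Zsqrtd.re h3
  have e6 := congrArg Zsqrtd.im h3
  rw [show be ^ 2 = (⟨-1, 2⟩ : O) by decide] at e3 e4
  simp at e1 e2 e3 e4 e5 e6
  ring_nf at e1 e2 e3 e4 e5 e6
  generalize (p : ℤ) * (z ^ 2).re = P1 at *
  generalize (p : ℤ) * (z ^ 2).im = P2 at *
  have ha : a.re % 2 = 1 := by omega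
  have hc : c.re % 2 = 1 := by omega
  have hb : b.re % 2 = 1 := by omega
  have key : a.im % 4 = 0 ∧ (b.im % 4 = 0 ∧ c.im % 4 = 0 ∨ b.im % 4 = 2 ∧ c.im % 4 = 2) := by
    rcases sq_mod_eight ha with ⟨a3, a4, a5⟩ | ⟨a3, a4, a5⟩ | ⟨a3, a4, a5⟩ <;>
    rcases sq_mod_eight hb with ⟨b3, b4, b5⟩ | ⟨b3, b4, b5⟩ | ⟨b3, b4, b5⟩ <;>
    rcases sq_mod_eight hc with ⟨c3, c4, c5⟩ | ⟨c3, c4, c5⟩ | ⟨c3, c4, c5⟩ <;>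
    omega
  clear k1 k2 a1 b1 c1 b2 c2 e1 e2 e3 e4 e5 e6 h1 h2 h3
  obtain ⟨ka, kbc⟩ := key
  have hre : a.re % 4 = 1 ∧ u.re % 4 = 3 ∨ a.re % 4 = 3 ∧ u.re % 4 = 1 := by omega
  have hre' : b.re % 4 = 1 ∧ c.re % 4 = 3 ∨ b.re % 4 = 3 ∧ c.re % 4 = 1 := by omega
  have hv4 : v.im % 4 = 0 ∨ v.im % 4 = 2 := by omega
  have z1 : z.re % 4 = 1 := by omega
  have z2 : z.im % 4 = 0 := by omega
  have p1 : (p : ℤ) % 4 = 3 := by omega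
  have m1 := mod_four_cast z1
  have m2 := mod_four_cast z2
  have m3 := mod_four_cast p1
  have m4 := mod_four_cast ka
  have m5 := mod_four_cast hv
  have m6 := mod_four_cast hu'
  set L := s * c * (u + v) - a * (u + s * v) - p * bb * z with hL
  set M := be ^ 2 * c + bb * b - s * a with hM
  have l1 := congrArg (fun x : O => (x.re : ZMod 4)) hL
  have l2 := congrArg (fun x : O => (x.im : ZMod 4)) hL
  have l3 := congrArg (fun x : O => (x.re : ZMod 4)) hM
  have l4 := congrArg (fun x : O => (x.im : ZMod 4)) hM
  rw [show be ^ 2 = (⟨-1, 2⟩ : O) by decide] at l3 l4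
  simp at l1 l2 l3 l4
  simp only [Int.cast_natCast] at m3
  have main : (L.re % 4 = 2 ∧ L.im % 4 = 0 ∧ M.re % 4 = 2 ∧ M.im % 4 = 2) ∨
      (L.re % 4 = 2 ∧ L.im % 4 = 2 ∧ M.re % 4 = 2 ∧ M.im % 4 = 0) := by
    rcases hre with ⟨q1, q2⟩ | ⟨q1, q2⟩ <;> rcases hre' with ⟨q3, q4⟩ | ⟨q3, q4⟩ <;>
    rcases kbc with ⟨q5, q6⟩ | ⟨q5, q6⟩ <;> rcases hv4 with q7 | q7 <;>
    · replace q1 := mod_four_cast q1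
      replace q2 := mod_four_cast q2
      replace q3 := mod_four_cast q3
      replace q4 := mod_four_cast q4
      replace q5 := mod_four_cast q5
      replace q6 := mod_four_cast q6
      replace q7 := mod_four_cast q7
      rw [q1, q2, q4, q6, q7, m1, m2, m3, m4, m5, m6] at l1
      rw [q1, q2, q4, q6, q7, m1, m2, m3, m4, m5, m6] at l2
      rw [q3, q4, q5, q6, m4] at l3
      rw [q1, q3, q4, q5, q6] at l4
      first
      | exact Or.inl ⟨mod_four_of_cast (i := 2) (l1.trans (by decide)),
          mod_four_of_cast (i := 0) (l2.trans (by decide)),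
          mod_four_of_cast (i := 2) (l3.trans (by decide)),
          mod_four_of_cast (i := 2) (l4.trans (by decide))⟩
      | exact Or.inr ⟨mod_four_of_cast (i := 2) (l1.trans (by decide)),
          mod_four_of_cast (i := 2) (l2.trans (by decide)),
          mod_four_of_cast (i := 2) (l3.trans (by decide)),
          mod_four_of_cast (i := 0) (l4.trans (by decide))⟩
  rcases main with ⟨w1, w2, w3, w4⟩ | ⟨w1, w2, w3, w4⟩
  · exact (OddNorm.one_of_two w1 w2).mul (OddNorm.three_of_two w3 w4)
  · exact (OddNorm.three_of_two w1 w2).mul (OddNorm.one_of_two w3 w4)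

lemma dvd_of_sq_dvd_mul {q P w : O} (hq : Prime q) (hP : Prime P) (h : q ^ 2 ∣ P * w) : q ∣ w := by
  by_cases hqP : q ∣ P
  · obtain ⟨e, rfl⟩ := hqP
    have he : IsUnit e := by
      rcases hP.irreducible.isUnit_or_isUnit rfl with h | h
      · exact absurd h hq.not_isUnit
      · exact h
    obtain ⟨k, hk⟩ := h
    have : e * w = q * k := mul_left_cancel₀ hq.ne_zero (by linear_combination hk)
    exact (he.dvd_mul_left).1 ⟨k, this⟩
  · exact (hq.dvd_or_dvd ((dvd_pow_self q two_ne_zero).trans h)).resolve_left hqP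

lemma dvd_s_of_dvd_two {q : O} (hq : Prime q) (h : q ∣ 2) : q ∣ s := by
  have : q ∣ s ^ 2 := by rw [s_sq]; exact h.neg_right
  exact hq.dvd_of_dvd_pow this

lemma bb_not_dvd {x : O} : ¬ bb ∣ x ↔ modBb x ≠ 0 := by rw [Ne, modBb_eq_zero]

lemma norm_form_neg_two_adic {p : ℕ} (hp : p.Prime) (h16 : p % 16 = 7) {u v : O}
    (h : u ^ 2 - s * v ^ 2 = -p) :
    u.re % 2 = 1 ∧ u.im % 4 = 2 ∧ v.re % 4 = 2 ∧ v.im % 2 = 0 := by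
  have e1 := congrArg Zsqrtd.re h
  have e2 := congrArg Zsqrtd.im h
  simp at e1 e2
  have u1 := re_sq_mod_two u
  have rv1 := re_sq_mod_two v
  have u2 := im_sq_mod_two u
  have hu : u.re % 2 = 1 := by omega
  have hv : v.re % 2 = 0 := by omega
  have f1 : (v ^ 2).re = v.re * v.re + -2 * (v.im * v.im) := by simp [pow_two]; ring
  have f2 : (v ^ 2).im = 2 * (v.re * v.im) := by simp [pow_two]; ring
  have f3 : (v.re * v.re) % 4 = 0 := by
    have : v.re % 4 = 0 ∨ v.re % 4 = 2 := by omega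
    rcases this with h | h <;> simp [Int.mul_emod, h]
  have f4 : (v.re * v.im) % 2 = 0 := by simp [Int.mul_emod, hv]
  have hvi : v.im % 2 = 0 := by
    by_contra hc
    have f5 : (v.im * v.im) % 2 = 1 := by
      have : v.im % 2 = 1 := by omega
      simp [Int.mul_emod, this]
    rcases sq_mod_eight hu with ⟨a, b, c⟩ | ⟨a, b, c⟩ | ⟨a, b, c⟩ <;> omega
  have hui : u.im % 2 = 0 := by
    have f5 : (v.im * v.im) % 4 = 0 := by
      have : v.im % 4 = 0 ∨ v.im % 4 = 2 := by omega
      rcases this with h | h <;> simp [Int.mul_emod, h]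
    rcases sq_mod_eight hu with ⟨a, b, c⟩ | ⟨a, b, c⟩ | ⟨a, b, c⟩ <;> omega
  obtain ⟨x, y⟩ := u
  obtain ⟨x', y'⟩ := v
  simp only at hu hv hvi hui
  obtain ⟨u3, rfl⟩ : ∃ k, y = 2 * k := ⟨y / 2, by omega⟩
  obtain ⟨v1, rfl⟩ : ∃ k, x' = 2 * k := ⟨x' / 2, by omega⟩
  obtain ⟨v2, rfl⟩ : ∃ k, y' = 2 * k := ⟨y' / 2, by omega⟩
  have g1 : x ^ 2 - 8 * u3 ^ 2 + 16 * (v1 * v2) = -(p : ℤ) := by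
    simp [pow_two] at e1; linarith
  have g2 : x * u3 = v1 ^ 2 - 2 * v2 ^ 2 := by
    simp [pow_two] at e2; linarith
  have hx : x % 8 = 1 ∨ x % 8 = 7 := by
    refine mod_eight_of_form x u3 v1 v2 hu ?_ ?_ g2
    · rintro q hq ⟨x, rfl⟩ ⟨u3, rfl⟩ ⟨v1, rfl⟩ ⟨v2, rfl⟩
      have h1 : q ^ 2 ∣ (p : ℤ) := ⟨-(x ^ 2 - 8 * u3 ^ 2 + 16 * (v1 * v2)), by linarith⟩
      have hp' : Prime (p : ℤ) := Nat.prime_iff_prime_int.1 hp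
      exact hq.not_isUnit (hp'.irreducible.squarefree q (by rwa [← pow_two]))
    · by_contra! hc
      rw [hc.1, hc.2] at g1 g2
      have : x ≠ 0 := by omega
      have hu3 : u3 = 0 := by simpa [this] using g2
      rw [hu3] at g1
      have := hp.pos
      nlinarith [sq_nonneg x]
  have hxx : (x ^ 2) % 16 = 1 := by
    have : x % 16 = 1 ∨ x % 16 = 7 ∨ x % 16 = 9 ∨ x % 16 = 15 := by omega
    rcases this with h | h | h | h <;> simp [pow_two, Int.mul_emod, h]
  have hu3 : u3 ^ 2 % 2 = 1 := by omega
  have hu3' : u3 % 2 = 1 := by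
    by_contra hc
    have : u3 % 2 = 0 := by omega
    simp [pow_two, Int.mul_emod, this] at hu3
  have hprod : (x * u3) % 2 = 1 := by simp [Int.mul_emod, hu, hu3']
  have hv1 : v1 % 2 = 1 := by
    by_contra hc
    have h0 : v1 % 2 = 0 := by omega
    have : v1 ^ 2 % 2 = 0 := by simp [pow_two, Int.mul_emod, h0]
    omega
  refine ⟨hu, ?_, ?_, ?_⟩ <;> simp only <;> omega

section
variable {p : ℕ} {a b c z : O}

lemma mulS_modBe {x y t : ZMod 3} : -x ^ 2 - y ^ 2 = t ^ 2 → ¬ (y = 0 ∧ t = 0) → x ≠ 0 ∧ y ≠ 0 := by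
  decide +revert

lemma mulS_oddNorm_lz (hp : p.Prime) (h16 : p % 16 = 7) (h3 : p % 3 = 2)
    (hcop : ∀ q, Prime q → q ∣ a → q ∣ z → False)
    (h1 : s * c ^ 2 - a ^ 2 = p * bb * z ^ 2) (h2 : be ^ 2 * c ^ 2 + bb * b ^ 2 = s * a ^ 2)
    (hl : ¬ bb ∣ be ^ 2 * c + bb * b - s * a) : OddNorm 1 (be ^ 2 * c + bb * b - s * a) := by
  have hpP : Prime (p : O) := prime_natCast hp (by omega)
  have hm := congrArg modBe h1
  simp only [map_sub, map_mul, map_pow, modBe_s, modBe_bb, modBe_natCast h3] at hm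
  have hm' : modBe c ≠ 0 ∧ modBe a ≠ 0 := by
    refine mulS_modBe (t := modBe z) (by linear_combination hm) ?_
    rw [modBe_eq_zero, modBe_eq_zero]
    exact fun h => hcop _ prime_be h.1 h.2
  have hmul : (be ^ 2 * c + bb * b - s * a) * (-(be ^ 2 * c) + bb * b - s * a)
      = s * bb * (a - b) ^ 2 := by
    rw [be_eq, bb_eq] at h2 ⊢
    have hs := s_sq
    linear_combination (-(1 + s) ^ 2) * h2 + (b ^ 2 * (1 - s) - a ^ 2 * s) * hs
  set l := be ^ 2 * c + bb * b - s * a with hldef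
  set l' := -(be ^ 2 * c) + bb * b - s * a with hldef'
  have hl0 : l ≠ 0 := fun h => hl (h ▸ dvd_zero _)
  have hlp : ∀ q, Prime q → q ∣ l → (q ∣ s * bb ∨ q ∣ l') → q ∣ s ∨ q ∣ be := by
    intro q hq hql hq'
    have hqbb : ¬ q ∣ bb := fun h => hl ((dvd_of_prime_dvd hq prime_bb h).trans hql)
    rcases hq' with hq' | hq'
    · exact Or.inl ((hq.dvd_or_dvd hq').resolve_right hqbb)
    · have h4 : q ∣ 2 * (be ^ 2 * c) := by
        rw [show 2 * (be ^ 2 * c) = l - l' by rw [hldef, hldef']; ring]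
        exact dvd_sub hql hq'
      rcases hq.dvd_or_dvd h4 with h4 | h4
      · exact Or.inl (dvd_s_of_dvd_two hq h4)
      rcases hq.dvd_or_dvd h4 with h4 | hqc
      · exact Or.inr (hq.dvd_of_dvd_pow h4)
      have h5 : q ∣ s * bb * (a - b) ^ 2 := by rw [← hmul]; exact hql.mul_right _
      rcases hq.dvd_or_dvd h5 with h5 | h5
      · exact Or.inl ((hq.dvd_or_dvd h5).resolve_right hqbb)
      replace h5 := hq.dvd_of_dvd_pow h5
      have h6 : q ∣ be ^ 2 * a := by
        have : be ^ 2 * a = -l + be ^ 2 * c - bb * (a - b) := by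
          rw [hldef, be_eq, bb_eq]; linear_combination a * s_sq
        rw [this]
        exact dvd_sub (dvd_add hql.neg_right (hqc.mul_left _)) (h5.mul_left _)
      rcases hq.dvd_or_dvd h6 with h6 | hqa
      · exact Or.inr (hq.dvd_of_dvd_pow h6)
      have h7 : q ^ 2 ∣ p * (bb * z ^ 2) := by
        rw [← mul_assoc, ← h1]
        exact dvd_sub ((pow_dvd_pow_of_dvd hqc 2).mul_left _) (pow_dvd_pow_of_dvd hqa 2)
      have h8 := (hq.dvd_or_dvd (dvd_of_sq_dvd_mul hq hpP h7)).resolve_left hqbb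
      exact (hcop q hq hqa (hq.dvd_of_dvd_pow h8)).elim
  by_cases hbe : be ∣ l
  · have h4 : be ∣ a - b := by
      rw [← modBe_eq_zero] at hbe ⊢
      rw [hldef] at hbe
      simp only [map_sub, map_add, map_mul, map_pow, modBe_s, modBe_bb, modBe_be] at hbe
      rw [map_sub]; linear_combination hbe
    obtain ⟨m, hm2⟩ := h4
    have h5 : s * (m * (a + b)) = be * (c ^ 2 - b ^ 2) := by
      refine mul_left_cancel₀ prime_be.ne_zero ?_
      rw [be_eq, bb_eq] at *
      linear_combination (-(s * (a + b))) * hm2 - h2 + b ^ 2 * s_sq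
    have h6 : be ∣ m := by
      rw [← modBe_eq_zero] at hbe ⊢
      have h7 := congrArg modBe h5
      have h8 := congrArg modBe hm2
      simp only [map_sub, map_add, map_mul, map_pow, modBe_s, modBe_be] at h7 h8
      have := hm'.2
      generalize modBe a = a at *
      generalize modBe b = b at *
      generalize modBe m = m at *
      simp only [zero_mul] at h7 h8
      clear * - h7 h8 this
      decide +revert
    obtain ⟨m', rfl⟩ := h6
    have hl2 : l = be ^ 2 * (c - b - s * m') := by
      rw [hldef]
      have ha : a = b + be * (be * m') := by linear_combination hm2
      rw [ha, be_eq, bb_eq]; linear_combination b * s_sq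
    have hl2' : l' = be ^ 2 * (-c - b - s * m') := by
      rw [hldef']
      have ha : a = b + be * (be * m') := by linear_combination hm2
      rw [ha, be_eq, bb_eq]; linear_combination b * s_sq
    have hmul2 : (c - b - s * m') * (-c - b - s * m') = s * bb * m' ^ 2 := by
      refine mul_left_cancel₀ (pow_ne_zero 4 prime_be.ne_zero) ?_
      rw [hl2, hl2', hm2] at hmul
      linear_combination hmul
    have hl20 : c - b - s * m' ≠ 0 := by
      intro h; exact hl0 (by rw [hl2, h, mul_zero])
    obtain ⟨e, i, t, he, hi, hlt, ht⟩ := exists_class_one prime_s hl20 hmul2 (by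
      intro q hq hql hq'
      refine (hlp q hq (hl2 ▸ hql.mul_left _)
        (hq'.imp id fun h => hl2' ▸ h.mul_left _)).resolve_right
        fun hqbe => ?_
      have hbq := dvd_of_prime_dvd hq prime_be hqbe
      rcases hq' with hq' | hq'
      · have := (modBe_eq_zero _).2 (hbq.trans hq')
        rw [map_mul, modBe_s, modBe_bb] at this
        exact absurd this (by decide)
      · have := dvd_sub (hbq.trans hql) (hbq.trans hq')
        rw [show c - b - s * m' - (-c - b - s * m') = 2 * c by ring,
            ← modBe_eq_zero, map_mul] at this
        rcases mul_eq_zero.1 this with h | h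
        · rw [map_ofNat] at h; exact absurd h (by decide)
        · exact hm'.1 h)
    rw [hl2, hlt]
    have h9 := OddNorm.sq prime_be.ne_zero
    rcases hi with rfl | rfl
    · exact h9.mul (((OddNorm.unit he).mul (OddNorm.unit (Or.inl rfl))).mul (OddNorm.sq ht))
    · exact h9.mul (((OddNorm.unit he).mul oddNorm_s).mul (OddNorm.sq ht))
  · obtain ⟨e, i, t, he, hi, hlt, ht⟩ := exists_class_one prime_s hl0 hmul (by
      intro q hq hql hq'
      exact (hlp q hq hql hq').resolve_right
        fun hqbe => hbe ((dvd_of_prime_dvd hq prime_be hqbe).trans hql))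
    rw [hlt]
    rcases hi with rfl | rfl
    · exact ((OddNorm.unit he).mul (OddNorm.unit (Or.inl rfl))).mul (OddNorm.sq ht)
    · exact ((OddNorm.unit he).mul oddNorm_s).mul (OddNorm.sq ht)

/-- The relevant linear form on the conic `s * c ^ 2 - a ^ 2 = r * z ^ 2`, using a point of
`s * c ^ 2 - a ^ 2 = r`. -/
lemma oddNorm_conic (hp : p.Prime) (h16 : p % 16 = 7) {a0 c0 r : O} {τ : O}
    (hr : r = p * bb * τ) (hτ : τ = 1 ∨ τ = -1)
    (hcop : ∀ q, Prime q → q ∣ a → q ∣ z → q ∣ bb)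
    (h1 : s * c ^ 2 - a ^ 2 = r * z ^ 2) (h0 : s * c0 ^ 2 - a0 ^ 2 = r)
    (hl : ¬ bb ∣ s * c * c0 - a * a0 - r * z) : OddNorm 1 (s * c * c0 - a * a0 - r * z) := by
  have hpP : Prime (p : O) := prime_natCast hp (by omega)
  have hmul : (s * c * c0 - a * a0 - r * z) * (s * c * c0 - a * a0 + r * z)
      = s * (a * c0 - c * a0) ^ 2 := by
    linear_combination r * h1 + (s * c ^ 2 - a ^ 2) * h0
  have hl0 : s * c * c0 - a * a0 - r * z ≠ 0 := fun h => hl (h ▸ dvd_zero _)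
  obtain ⟨e, i, j, t, he, hi, hj, hlt, ht⟩ := exists_class_two prime_s hpP hl0 hmul (by
    intro q hq hql hq'
    have hqbb : ¬ q ∣ bb := fun h => hl ((dvd_of_prime_dvd hq prime_bb h).trans hql)
    have hqr : q ∣ r → q ∣ p := by
      rw [hr]
      intro h
      rcases hq.dvd_or_dvd h with h | h
      · exact (hq.dvd_or_dvd h).resolve_right hqbb
      · exact absurd (isUnit_of_dvd_unit h ((isUnit_iff τ).2 hτ)) hq.not_isUnit
    rcases hq' with hq' | hq'
    · exact Or.inl hq'
    have h4 := dvd_sub hq' hql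
    rw [show s * c * c0 - a * a0 + r * z - (s * c * c0 - a * a0 - r * z) = 2 * (r * z) by
      ring] at h4
    rcases hq.dvd_or_dvd h4 with h4 | h4
    · exact Or.inl (dvd_s_of_dvd_two hq h4)
    rcases hq.dvd_or_dvd h4 with h4 | hqz
    · exact Or.inr (hqr h4)
    have h5 : q ∣ a ^ 2 * r := by
      have : a ^ 2 * r = (s * c * c0 - a * a0 - r * z) * (s * c * c0 + a * a0)
          + z * (r * (s * c * c0 + a * a0) - r * z * s * c0 ^ 2) := by
        linear_combination -a ^ 2 * h0 - s * c0 ^ 2 * h1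
      rw [this]
      exact dvd_add (hql.mul_right _) (hqz.mul_right _)
    rcases hq.dvd_or_dvd h5 with h5 | h5
    · exact absurd (hcop q hq (hq.dvd_of_dvd_pow h5) hqz) hqbb
    · exact Or.inr (hqr h5))
  rw [hlt]
  have n1 : OddNorm 1 i := by
    rcases hi with rfl | rfl
    · exact OddNorm.unit (Or.inl rfl)
    · exact oddNorm_s
  have n2 : OddNorm 1 j := by
    rcases hj with rfl | rfl
    · exact OddNorm.unit (Or.inl rfl)
    · exact OddNorm.natCast (by omega)
  exact (((OddNorm.unit he).mul n1).mul n2).mul (OddNorm.sq ht)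

end

lemma exists_sign_add_mod_four {x y : O} (w : O) (hx : (w * x).re % 2 = 1) (hy : y.re % 2 = 1) :
    ∃ x', (x' = x ∨ x' = -x) ∧ ((w * x').re + y.re) % 4 = 0 := by
  by_cases h : ((w * x).re + y.re) % 4 = 0
  · exact ⟨x, Or.inl rfl, h⟩
  · refine ⟨-x, Or.inr rfl, ?_⟩
    rw [mul_neg, re_neg]; omega

lemma sq_eq_of_eq_or_neg {x x' : O} (h : x' = x ∨ x' = -x) : x' ^ 2 = x ^ 2 := by
  rcases h with rfl | rfl <;> ring

lemma exists_sign_zmod_three {x y : ZMod 3} (h : x ^ 2 = y ^ 2) : x = -y ∨ -x = -y := by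
  decide +revert

lemma OddNorm.false {x y : O} (h : OddNorm 1 x) (h' : OddNorm 3 y) (hxy : x = y) : False := by
  subst hxy
  exact absurd (h.eq h' (by decide) (by decide)) (by decide)

lemma no_mulS {p : ℕ} (hp : p.Prime) (h16 : p % 16 = 7) (hp3 : p % 3 = 2) {a b c z : O}
    (hcop : ∀ q, Prime q → q ∣ a → q ∣ z → False)
    (h1 : s * c ^ 2 - a ^ 2 = p * bb * z ^ 2) (h2 : be ^ 2 * c ^ 2 + bb * b ^ 2 = s * a ^ 2)
    (h3 : bb * c ^ 2 - b ^ 2 = s * p * z ^ 2) : False := by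
  have hzo : z.re % 2 = 1 := by
    by_contra hc
    have hsz : s ∣ z := (s_dvd_iff z).2 (by omega)
    refine hcop s prime_s (prime_s.dvd_of_dvd_pow (n := 2) ?_) hsz
    rw [show a ^ 2 = s * c ^ 2 - p * bb * z ^ 2 by rw [← h1]; ring]
    exact dvd_sub (dvd_mul_right _ _) ((dvd_pow hsz two_ne_zero).mul_left _)
  obtain ⟨w, hw, hwz, hwz'⟩ := exists_inverse_mod hzo
  have hbb2 : modBb c ^ 2 = modBb a ^ 2 := by
    have := congrArg modBb h1
    simp only [map_sub, map_mul, map_pow, modBb_s, modBb_bb] at this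
    linear_combination this
  have hab : modBb a ≠ 0 := by
    rw [← bb_not_dvd]
    intro ha
    have hc : bb ∣ c := by
      rw [← modBb_eq_zero] at ha ⊢
      rw [ha] at hbb2; simpa using hbb2
    have h7 : bb ^ 2 ∣ bb * (p * z ^ 2) := by
      rw [show bb * (p * z ^ 2) = s * c ^ 2 - a ^ 2 by rw [h1]; ring]
      exact dvd_sub ((pow_dvd_pow_of_dvd hc 2).mul_left _) (pow_dvd_pow_of_dvd ha 2)
    rcases prime_bb.dvd_or_dvd (dvd_of_sq_dvd_mul prime_bb prime_bb h7) with h | h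
    · rw [← modBb_eq_zero, modBb_natCast hp3] at h; exact absurd h (by decide)
    · exact hcop _ prime_bb ha (prime_bb.dvd_of_dvd_pow h)
  obtain ⟨c', hc', hca⟩ : ∃ c', (c' = c ∨ c' = -c) ∧ modBb c' = -modBb a := by
    rcases exists_sign_zmod_three hbb2 with h | h
    · exact ⟨c, Or.inl rfl, h⟩
    · exact ⟨-c, Or.inr rfl, by rw [map_neg, h]⟩
  rw [← sq_eq_of_eq_or_neg hc'] at h1 h2 h3
  clear hbb2 hc'
  clear c
  rename' c' => c
  have H1 : s * (w * c) ^ 2 - (w * a) ^ 2 = p * bb * (w * z) ^ 2 := by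
    linear_combination w ^ 2 * h1
  have H3 : bb * (w * c) ^ 2 - (w * b) ^ 2 = s * p * (w * z) ^ 2 := by
    linear_combination w ^ 2 * h3
  have par : (w * a).re % 2 = 1 ∧ (w * b).re % 2 = 1 ∧ (w * c).re % 2 = 1 := by
    obtain ⟨k1, k2⟩ := one_sq_mod h16 hwz hwz'
    have a1 := re_sq_mod_two (w * a)
    have b1 := re_sq_mod_two (w * b)
    have c1 := re_sq_mod_two (w * c)
    have b2 := im_sq_mod_two (w * b)
    have c2 := im_sq_mod_two (w * c)
    generalize w * a = A at *
    generalize w * b = B at *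
    generalize w * c = C at *
    generalize w * z = Z at *
    have e1 := congrArg Zsqrtd.re H1
    have e5 := congrArg Zsqrtd.re H3
    have e6 := congrArg Zsqrtd.im H3
    simp at e1 e5 e6
    ring_nf at e1 e5 e6
    generalize (p : ℤ) * (Z ^ 2).re = P1 at *
    generalize (p : ℤ) * (Z ^ 2).im = P2 at *
    omega
  obtain ⟨pa, pb, pc⟩ := par
  obtain ⟨b', hb', hbc⟩ := exists_sign_add_mod_four w pb pc
  rw [← sq_eq_of_eq_or_neg hb'] at h2 h3
  obtain ⟨u, v, huv⟩ := exists_norm_form_neg (exists_norm_form hp (by omega) hp3)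
  obtain ⟨hu1, hu2, hv1, hv2⟩ := norm_form_neg_two_adic hp h16 huv
  obtain ⟨u, v, huv, hu1, hu2, hv1, hv2, hau⟩ : ∃ u v : O, u ^ 2 - s * v ^ 2 = -p ∧ u.re % 2 = 1 ∧
      u.im % 4 = 2 ∧ v.re % 4 = 2 ∧ v.im % 2 = 0 ∧ ((w * a).re + u.re) % 4 = 0 := by
    by_cases h : ((w * a).re + u.re) % 4 = 0
    · exact ⟨u, v, huv, hu1, hu2, hv1, hv2, h⟩
    · refine ⟨-u, -v, by linear_combination huv, ?_⟩
      simp only [re_neg, im_neg]; omega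
  have H1 : s * (w * c) ^ 2 - (w * a) ^ 2 = p * bb * (w * z) ^ 2 := by
    linear_combination w ^ 2 * h1
  have H2 : be ^ 2 * (w * c) ^ 2 + bb * (w * b') ^ 2 = s * (w * a) ^ 2 := by
    linear_combination w ^ 2 * h2
  have H3 : bb * (w * c) ^ 2 - (w * b') ^ 2 = s * p * (w * z) ^ 2 := by
    linear_combination w ^ 2 * h3
  have K := mulS_two_adic h16 hwz hwz' H1 H2 H3 hu1 hu2 hv1 hv2 hau hbc
  have h0 : s * (u + v) ^ 2 - (u + s * v) ^ 2 = p * bb := by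
    rw [bb_eq]; linear_combination (s - 1) * huv
  have hu0 : modBb u + modBb v ≠ 0 := by
    intro h
    have e1 : bb ∣ u + v := by rw [← modBb_eq_zero, map_add, h]
    have e2 : bb ∣ u + s * v := by
      rw [← modBb_eq_zero, map_add, map_mul, modBb_s, one_mul, h]
    have h7 : bb ^ 2 ∣ bb * p := by
      rw [mul_comm, ← h0]
      exact dvd_sub ((pow_dvd_pow_of_dvd e1 2).mul_left _) (pow_dvd_pow_of_dvd e2 2)
    have h := dvd_of_sq_dvd_mul prime_bb prime_bb h7
    rw [← modBb_eq_zero, modBb_natCast hp3] at h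
    exact absurd h (by decide)
  have L1 := oddNorm_conic (τ := 1) hp h16 (by ring) (Or.inl rfl)
    (fun q hq h h' => (hcop q hq h h').elim) h1 h0 (by
      rw [← modBb_eq_zero]
      simp only [map_sub, map_add, map_mul, modBb_s, modBb_bb, hca]
      intro h
      refine mul_ne_zero hab hu0 (mul_left_cancel₀ (show (-2 : ZMod 3) ≠ 0 by decide) ?_)
      linear_combination h)
  have L2 := mulS_oddNorm_lz hp h16 hp3 hcop h1 h2 (by
      rw [← modBb_eq_zero]
      simp only [map_sub, map_add, map_mul, map_pow, modBb_s, modBb_bb, modBb_be, hca]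
      intro h
      refine hab (mul_left_cancel₀ (show (-2 : ZMod 3) ≠ 0 by decide) ?_)
      linear_combination h)
  have hw0 : w ≠ 0 := by rintro rfl; simp at hw
  exact ((OddNorm.sq hw0).mul (L1.mul L2)).false K (by ring)

lemma norm_form_pos_two_adic {p : ℕ} (hp : p.Prime) (h16 : p % 16 = 7) {u v : O}
    (h : u ^ 2 - s * v ^ 2 = p) :
    u.re % 2 = 1 ∧ u.im % 4 = u.re % 4 ∧ v.re % 4 = 2 ∧ v.im % 2 = 1 := by
  have e1 := congrArg Zsqrtd.re h
  have e2 := congrArg Zsqrtd.im h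
  simp at e1 e2
  have ru := re_sq_mod_two u
  have rv := re_sq_mod_two v
  have iu := im_sq_mod_two u
  have hu : u.re % 2 = 1 := by omega
  have hv : v.re % 2 = 0 := by omega
  clear ru rv iu
  obtain ⟨x, y⟩ := u
  obtain ⟨x', m⟩ := v
  simp only at hu hv
  obtain ⟨k, rfl⟩ : ∃ k, x' = 2 * k := ⟨x' / 2, by omega⟩
  have g1 : x ^ 2 - 2 * y ^ 2 + 8 * (m * k) = p := by
    simp [pow_two] at e1; linarith
  have g2 : x * (-y) = m ^ 2 - 2 * k ^ 2 := by
    simp [pow_two] at e2; linarith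
  have hxs : x ^ 2 % 8 = 1 := by
    have : x % 8 = 1 ∨ x % 8 = 3 ∨ x % 8 = 5 ∨ x % 8 = 7 := by omega
    rcases this with h | h | h | h <;> simp [pow_two, Int.mul_emod, h]
  have hy : y % 2 = 1 := by
    by_contra hc
    have h0 : y % 2 = 0 := by omega
    have : y ^ 2 % 2 = 0 := by simp [pow_two, Int.mul_emod, h0]
    omega
  have hcop : ∀ q : ℤ, Prime q → q ∣ x → q ∣ y → q ∣ m → q ∣ k → False := by
    rintro q hq ⟨x, rfl⟩ ⟨y, rfl⟩ ⟨m, rfl⟩ ⟨k, rfl⟩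
    have h1 : q ^ 2 ∣ (p : ℤ) := ⟨x ^ 2 - 2 * y ^ 2 + 8 * (m * k), by linarith⟩
    have hp' : Prime (p : ℤ) := Nat.prime_iff_prime_int.1 hp
    exact hq.not_isUnit (hp'.irreducible.squarefree q (by rwa [← pow_two]))
  have hnz : m ≠ 0 ∨ k ≠ 0 := by
    by_contra! hc
    rw [hc.1, hc.2] at g2
    have hx0 : x ≠ 0 := by omega
    have hy0 : y ≠ 0 := by omega
    simp [hx0, hy0] at g2
  have hx : x % 8 = 1 ∨ x % 8 = 7 :=
    mod_eight_of_form x (-y) m k hu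
      (fun q hq a b c d => hcop q hq a ((dvd_neg).1 b) c d) hnz g2
  have hy8 : y % 8 = 1 ∨ y % 8 = 7 :=
    mod_eight_of_form y (-x) m k hy
      (fun q hq a b c d => hcop q hq ((dvd_neg).1 b) a c d) hnz (by linarith)
  have sq16 : ∀ t : ℤ, t % 8 = 1 ∨ t % 8 = 7 → t ^ 2 % 16 = 1 := by
    intro t ht
    have : t % 16 = 1 ∨ t % 16 = 7 ∨ t % 16 = 9 ∨ t % 16 = 15 := by omega
    rcases this with h | h | h | h <;> simp [pow_two, Int.mul_emod, h]
  have hx16 := sq16 x hx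
  have hy16 := sq16 y hy8
  have hmk : m * k % 2 = 1 := by omega
  have hm : m % 2 = 1 := by
    by_contra hc
    have h0 : m % 2 = 0 := by omega
    simp [Int.mul_emod, h0] at hmk
  have hk : k % 2 = 1 := by
    by_contra hc
    have h0 : k % 2 = 0 := by omega
    simp [Int.mul_emod, h0] at hmk
  have hm8 : m ^ 2 % 8 = 1 := by
    have : m % 8 = 1 ∨ m % 8 = 3 ∨ m % 8 = 5 ∨ m % 8 = 7 := by omega
    rcases this with h | h | h | h <;> simp [pow_two, Int.mul_emod, h]
  have hk4 : k ^ 2 % 4 = 1 := by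
    have : k % 4 = 1 ∨ k % 4 = 3 := by omega
    rcases this with h | h <;> simp [pow_two, Int.mul_emod, h]
  refine ⟨hu, ?_, ?_, hm⟩ <;> simp only
  · have g3 : (x * -y) % 8 = 7 := by omega
    rcases hx with h1 | h1 <;> rcases hy8 with h2 | h2
    · omega
    · have h3 : -y % 8 = 1 := by omega
      rw [Int.mul_emod, h1, h3] at g3; exact absurd g3 (by decide)
    · have h3 : -y % 8 = 7 := by omega
      rw [Int.mul_emod, h1, h3] at g3; exact absurd g3 (by decide)
    · omega
  · omega

set_option maxHeartbeats 4000000 in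
lemma mulRS_two_adic {p : ℕ} (hp : p % 16 = 7) {a b c z u v : O}
    (hz : z.re % 16 = 1) (hz' : z.im % 16 = 0)
    (h1 : s * c ^ 2 - be ^ 2 * a ^ 2 = -(p * bb * z ^ 2)) (h2 : c ^ 2 - bb * b ^ 2 = s * a ^ 2)
    (h4 : bb * a ^ 2 + s * b ^ 2 = -(p * z ^ 2))
    (hu : u.re % 2 = 1) (hu' : u.im % 4 = u.re % 4) (hv : v.re % 4 = 2)
    (hv' : v.im % 4 = u.re % 4)
    (hau : (a.re - u.re) % 4 = 0) (hbc : (b.re - c.re) % 4 = 0) :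
    OddNorm 3 ((s * c * (u + v) - be * a * (u + s * v) + p * bb * z) *
      (c + bb * b + s * a)) := by
  obtain ⟨k1, k2⟩ := one_sq_mod hp hz hz'
  have a1 := re_sq_mod_two a
  have b1 := re_sq_mod_two b
  have c1 := re_sq_mod_two c
  have a2 := im_sq_mod_two a
  have b2 := im_sq_mod_two b
  have c2 := im_sq_mod_two c
  have e1 := congrArg Zsqrtd.re h1
  have e2 := congrArg Zsqrtd.im h1
  have e3 := congrArg Zsqrtd.re h2
  have e4 := congrArg Zsqrtd.im h2
  have e5 := congrArg Zsqrtd.re h4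
  have e6 := congrArg Zsqrtd.im h4
  rw [show be ^ 2 = (⟨-1, 2⟩ : O) by decide] at e1 e2
  simp at e1 e2 e3 e4 e5 e6
  ring_nf at e1 e2 e3 e4 e5 e6
  generalize (p : ℤ) * (z ^ 2).re = P1 at *
  generalize (p : ℤ) * (z ^ 2).im = P2 at *
  have ha : a.re % 2 = 1 := by omega
  have hc : c.re % 2 = 1 := by omega
  have hb : b.re % 2 = 1 := by omega
  have key : a.im % 4 = 0 ∧ (b.im % 4 = 0 ∧ c.im % 4 = 0 ∨ b.im % 4 = 2 ∧ c.im % 4 = 2) := by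
    rcases sq_mod_eight ha with ⟨a3, a4, a5⟩ | ⟨a3, a4, a5⟩ | ⟨a3, a4, a5⟩ <;>
    rcases sq_mod_eight hb with ⟨b3, b4, b5⟩ | ⟨b3, b4, b5⟩ | ⟨b3, b4, b5⟩ <;>
    rcases sq_mod_eight hc with ⟨c3, c4, c5⟩ | ⟨c3, c4, c5⟩ | ⟨c3, c4, c5⟩ <;>
    omega
  clear k1 k2 a1 a2 b1 c1 b2 c2 e1 e2 e3 e4 e5 e6 h1 h2 h4
  obtain ⟨ka, kbc⟩ := key
  have hre : (a.re % 4 = 1 ∧ u.re % 4 = 1 ∧ u.im % 4 = 1 ∧ v.im % 4 = 1) ∨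
      (a.re % 4 = 3 ∧ u.re % 4 = 3 ∧ u.im % 4 = 3 ∧ v.im % 4 = 3) := by omega
  have hre' : b.re % 4 = 1 ∧ c.re % 4 = 1 ∨ b.re % 4 = 3 ∧ c.re % 4 = 3 := by omega
  have z1 : z.re % 4 = 1 := by omega
  have z2 : z.im % 4 = 0 := by omega
  have p1 : (p : ℤ) % 4 = 3 := by omega
  have m1 := mod_four_cast z1
  have m2 := mod_four_cast z2
  have m3 := mod_four_cast p1
  have m4 := mod_four_cast ka
  have m5 := mod_four_cast hv
  set L := s * c * (u + v) - be * a * (u + s * v) + p * bb * z with hL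
  set M := c + bb * b + s * a with hM
  have l1 := congrArg (fun x : O => (x.re : ZMod 4)) hL
  have l2 := congrArg (fun x : O => (x.im : ZMod 4)) hL
  have l3 := congrArg (fun x : O => (x.re : ZMod 4)) hM
  have l4 := congrArg (fun x : O => (x.im : ZMod 4)) hM
  simp at l1 l2 l3 l4
  simp only [Int.cast_natCast] at m3
  have main : (L.re % 4 = 2 ∧ L.im % 4 = 0 ∧ M.re % 4 = 2 ∧ M.im % 4 = 2) ∨
      (L.re % 4 = 2 ∧ L.im % 4 = 2 ∧ M.re % 4 = 2 ∧ M.im % 4 = 0) := by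
    rcases hre with ⟨q1, q2, q7, q8⟩ | ⟨q1, q2, q7, q8⟩ <;> rcases hre' with ⟨q3, q4⟩ | ⟨q3, q4⟩ <;>
    rcases kbc with ⟨q5, q6⟩ | ⟨q5, q6⟩ <;>
    · replace q1 := mod_four_cast q1
      replace q2 := mod_four_cast q2
      replace q3 := mod_four_cast q3
      replace q4 := mod_four_cast q4
      replace q5 := mod_four_cast q5
      replace q6 := mod_four_cast q6
      replace q7 := mod_four_cast q7
      replace q8 := mod_four_cast q8
      simp only [q1, q2, q4, q6, q7, q8, m1, m2, m3, m4, m5] at l1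
      simp only [q1, q2, q4, q6, q7, q8, m1, m2, m3, m4, m5] at l2
      simp only [q3, q4, q5, m4] at l3
      simp only [q1, q3, q5, q6] at l4
      first
      | exact Or.inl ⟨mod_four_of_cast (i := 2) (l1.trans (by decide)),
          mod_four_of_cast (i := 0) (l2.trans (by decide)),
          mod_four_of_cast (i := 2) (l3.trans (by decide)),
          mod_four_of_cast (i := 2) (l4.trans (by decide))⟩
      | exact Or.inr ⟨mod_four_of_cast (i := 2) (l1.trans (by decide)),
          mod_four_of_cast (i := 2) (l2.trans (by decide)),
          mod_four_of_cast (i := 2) (l3.trans (by decide)),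
          mod_four_of_cast (i := 0) (l4.trans (by decide))⟩
  rcases main with ⟨w1, w2, w3, w4⟩ | ⟨w1, w2, w3, w4⟩
  · exact (OddNorm.one_of_two w1 w2).mul (OddNorm.three_of_two w3 w4)
  · exact (OddNorm.three_of_two w1 w2).mul (OddNorm.one_of_two w3 w4)

lemma mulRS_oddNorm_lz {p : ℕ} (hp : p.Prime) (h16 : p % 16 = 7) {a b c z : O}
    (hcop : ∀ q, Prime q → q ∣ a → q ∣ z → False)
    (h1 : s * c ^ 2 - be ^ 2 * a ^ 2 = -(p * bb * z ^ 2)) (h2 : c ^ 2 - bb * b ^ 2 = s * a ^ 2)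
    (hl : ¬ bb ∣ c + bb * b + s * a) : OddNorm 1 (c + bb * b + s * a) := by
  have hpP : Prime (p : O) := prime_natCast hp (by omega)
  have hmul : (c + bb * b + s * a) * (-c + bb * b + s * a) = -(s * bb) * (a - b) ^ 2 := by
    rw [bb_eq] at h2 ⊢
    linear_combination -h2
  have hl0 : c + bb * b + s * a ≠ 0 := fun h => hl (h ▸ dvd_zero _)
  obtain ⟨e, i, t, he, hi, hlt, ht⟩ := exists_class_one prime_s hl0 hmul (by
    intro q hq hql hq'
    have hqbb : ¬ q ∣ bb := fun h => hl ((dvd_of_prime_dvd hq prime_bb h).trans hql)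
    rcases hq' with hq' | hq'
    · exact (hq.dvd_or_dvd (dvd_neg.1 hq')).resolve_right hqbb
    have h4 := dvd_sub hql hq'
    rw [show c + bb * b + s * a - (-c + bb * b + s * a) = 2 * c by ring] at h4
    rcases hq.dvd_or_dvd h4 with h4 | hqc
    · exact dvd_s_of_dvd_two hq h4
    have h5 : q ∣ -(s * bb) * (a - b) ^ 2 := by rw [← hmul]; exact hql.mul_right _
    rcases hq.dvd_or_dvd h5 with h5 | h5
    · exact (hq.dvd_or_dvd (dvd_neg.1 h5)).resolve_right hqbb
    replace h5 := hq.dvd_of_dvd_pow h5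
    have hqa : q ∣ a := by
      have : a = (c + bb * b + s * a) - c + bb * (a - b) := by rw [bb_eq]; ring
      rw [this]
      exact dvd_add (dvd_sub hql hqc) (h5.mul_left _)
    have h7 : q ^ 2 ∣ p * (bb * z ^ 2) := by
      rw [show p * (bb * z ^ 2) = be ^ 2 * a ^ 2 - s * c ^ 2 by linear_combination h1]
      exact dvd_sub ((pow_dvd_pow_of_dvd hqa 2).mul_left _) ((pow_dvd_pow_of_dvd hqc 2).mul_left _)
    have h8 := (hq.dvd_or_dvd (dvd_of_sq_dvd_mul hq hpP h7)).resolve_left hqbb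
    exact (hcop q hq hqa (hq.dvd_of_dvd_pow h8)).elim)
  rw [hlt]
  rcases hi with rfl | rfl
  · exact ((OddNorm.unit he).mul (OddNorm.unit (Or.inl rfl))).mul (OddNorm.sq ht)
  · exact ((OddNorm.unit he).mul oddNorm_s).mul (OddNorm.sq ht)

lemma no_mulRS {p : ℕ} (hp : p.Prime) (h16 : p % 16 = 7) (hp3 : p % 3 = 2) {a b c z : O}
    (hcop : ∀ q, Prime q → q ∣ a → q ∣ z → False)
    (h1 : s * c ^ 2 - be ^ 2 * a ^ 2 = -(p * bb * z ^ 2)) (h2 : c ^ 2 - bb * b ^ 2 = s * a ^ 2)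
    (h4 : bb * a ^ 2 + s * b ^ 2 = -(p * z ^ 2)) : False := by
  have hzo : z.re % 2 = 1 := by
    by_contra hc
    have hsz : s ∣ z := (s_dvd_iff z).2 (by omega)
    refine hcop s prime_s (prime_s.dvd_of_dvd_pow (n := 2) ?_) hsz
    have : a ^ 2 = s * (a ^ 2 - b ^ 2) - p * z ^ 2 := by
      rw [bb_eq] at h4; linear_combination h4
    rw [this]
    exact dvd_sub (dvd_mul_right _ _) ((dvd_pow hsz two_ne_zero).mul_left _)
  obtain ⟨w, hw, hwz, hwz'⟩ := exists_inverse_mod hzo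
  have hbb2 : modBb c ^ 2 = modBb a ^ 2 := by
    have := congrArg modBb h1
    simp only [map_sub, map_neg, map_mul, map_pow, modBb_s, modBb_bb, modBb_be] at this
    linear_combination this
  have hab : modBb a ≠ 0 := by
    rw [← bb_not_dvd]
    intro ha
    have hc : bb ∣ c := by
      rw [← modBb_eq_zero] at ha ⊢
      rw [ha] at hbb2; simpa using hbb2
    have h7 : bb ^ 2 ∣ bb * (p * z ^ 2) := by
      rw [show bb * (p * z ^ 2) = be ^ 2 * a ^ 2 - s * c ^ 2 by linear_combination h1]
      exact dvd_sub ((pow_dvd_pow_of_dvd ha 2).mul_left _) ((pow_dvd_pow_of_dvd hc 2).mul_left _)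
    rcases prime_bb.dvd_or_dvd (dvd_of_sq_dvd_mul prime_bb prime_bb h7) with h | h
    · rw [← modBb_eq_zero, modBb_natCast hp3] at h; exact absurd h (by decide)
    · exact hcop _ prime_bb ha (prime_bb.dvd_of_dvd_pow h)
  obtain ⟨c', hc', hca⟩ : ∃ c', (c' = c ∨ c' = -c) ∧ modBb c' = modBb a := by
    rcases sq_eq_sq_iff_eq_or_eq_neg.1 hbb2 with h | h
    · exact ⟨c, Or.inl rfl, h⟩
    · exact ⟨-c, Or.inr rfl, by rw [map_neg, h, neg_neg]⟩
  rw [← sq_eq_of_eq_or_neg hc'] at h1 h2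
  clear hbb2 hc'
  clear c
  rename' c' => c
  have H1 : s * (w * c) ^ 2 - be ^ 2 * (w * a) ^ 2 = -(p * bb * (w * z) ^ 2) := by
    linear_combination w ^ 2 * h1
  have H2 : (w * c) ^ 2 - bb * (w * b) ^ 2 = s * (w * a) ^ 2 := by
    linear_combination w ^ 2 * h2
  have H4 : bb * (w * a) ^ 2 + s * (w * b) ^ 2 = -(p * (w * z) ^ 2) := by
    linear_combination w ^ 2 * h4
  have par : (w * a).re % 2 = 1 ∧ (w * b).re % 2 = 1 ∧ (w * c).re % 2 = 1 := by
    obtain ⟨k1, k2⟩ := one_sq_mod h16 hwz hwz'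
    have a1 := re_sq_mod_two (w * a)
    have b1 := re_sq_mod_two (w * b)
    have c1 := re_sq_mod_two (w * c)
    have a2 := im_sq_mod_two (w * a)
    have b2 := im_sq_mod_two (w * b)
    have c2 := im_sq_mod_two (w * c)
    generalize w * a = A at *
    generalize w * b = B at *
    generalize w * c = C at *
    generalize w * z = Z at *
    have e1 := congrArg Zsqrtd.re H4
    have e2 := congrArg Zsqrtd.im H4
    have e3 := congrArg Zsqrtd.re H2
    have e4 := congrArg Zsqrtd.im H2
    simp at e1 e2 e3 e4
    ring_nf at e1 e2 e3 e4
    generalize (p : ℤ) * (Z ^ 2).re = P1 at *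
    generalize (p : ℤ) * (Z ^ 2).im = P2 at *
    omega
  obtain ⟨pa, pb, pc⟩ := par
  obtain ⟨b', hb', hbc⟩ : ∃ b', (b' = b ∨ b' = -b) ∧ ((w * b').re - (w * c).re) % 4 = 0 := by
    obtain ⟨b', hb', hbc⟩ := exists_sign_add_mod_four w pb (y := -(w * c)) (by rw [re_neg]; omega)
    exact ⟨b', hb', by rw [re_neg] at hbc; omega⟩
  rw [← sq_eq_of_eq_or_neg hb'] at h2 h4
  obtain ⟨u, v, huv⟩ := exists_norm_form hp (by omega) hp3
  obtain ⟨hu1, hu2, hv1, hv2⟩ := norm_form_pos_two_adic hp h16 huv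
  obtain ⟨u, huv, hu1, hu2, hau⟩ : ∃ u : O, u ^ 2 - s * v ^ 2 = p ∧ u.re % 2 = 1 ∧
      u.im % 4 = u.re % 4 ∧ ((w * a).re - u.re) % 4 = 0 := by
    by_cases h : ((w * a).re - u.re) % 4 = 0
    · exact ⟨u, huv, hu1, hu2, h⟩
    · refine ⟨-u, by linear_combination huv, ?_⟩
      simp only [re_neg, im_neg]; omega
  obtain ⟨v, huv, hv1, hv2⟩ : ∃ v : O, u ^ 2 - s * v ^ 2 = p ∧ v.re % 4 = 2 ∧
      v.im % 4 = u.re % 4 := by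
    by_cases h : v.im % 4 = u.re % 4
    · exact ⟨v, huv, hv1, h⟩
    · refine ⟨-v, by linear_combination huv, ?_⟩
      simp only [re_neg, im_neg]; omega
  have H2 : (w * c) ^ 2 - bb * (w * b') ^ 2 = s * (w * a) ^ 2 := by
    linear_combination w ^ 2 * h2
  have H4 : bb * (w * a) ^ 2 + s * (w * b') ^ 2 = -(p * (w * z) ^ 2) := by
    linear_combination w ^ 2 * h4
  have K := mulRS_two_adic h16 hwz hwz' H1 H2 H4 hu1 hu2 hv1 hv2 hau hbc
  have h0 : s * (u + v) ^ 2 - (u + s * v) ^ 2 = p * bb * (-1) := by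
    rw [bb_eq]; linear_combination (s - 1) * huv
  have hu0 : modBb u + modBb v ≠ 0 := by
    intro h
    have e1 : bb ∣ u + v := by rw [← modBb_eq_zero, map_add, h]
    have e2 : bb ∣ u + s * v := by
      rw [← modBb_eq_zero, map_add, map_mul, modBb_s, one_mul, h]
    have h7 : bb ^ 2 ∣ bb * p := by
      rw [show bb * (p : O) = -(p * bb * (-1)) by ring, ← h0, dvd_neg]
      exact dvd_sub ((pow_dvd_pow_of_dvd e1 2).mul_left _) (pow_dvd_pow_of_dvd e2 2)
    have h := dvd_of_sq_dvd_mul prime_bb prime_bb h7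
    rw [← modBb_eq_zero, modBb_natCast hp3] at h
    exact absurd h (by decide)
  have L1 := oddNorm_conic (τ := -1) (a := be * a) (c := c) (z := z) hp h16 rfl (Or.inr rfl)
    (fun q hq h h' => (hq.dvd_or_dvd h).elim (fun h => by
        have hbz := (modBe_eq_zero _).2 ((dvd_of_prime_dvd hq prime_be h).trans h')
        have m2 := congrArg modBe h2
        have m4 := congrArg modBe h4
        have m1 := congrArg modBe h1
        simp only [map_sub, map_neg, map_add, map_mul, map_pow, modBe_s, modBe_bb, modBe_be,
          modBe_natCast hp3, hbz] at m1 m2 m4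
        have hc0 : modBe c = 0 := by
          have : modBe c ^ 2 = 0 := by linear_combination -m1
          simpa using this
        rw [hc0] at m2
        have ha0 : modBe a = 0 := by
          generalize modBe a = x at *
          generalize modBe b' = y at *
          clear * - m2 m4
          decide +revert
        exact (hcop _ prime_be ((modBe_eq_zero _).1 ha0) ((modBe_eq_zero _).1 hbz)).elim)
      (fun h => (hcop q hq h h').elim)) (by linear_combination h1) h0 (by
      rw [← modBb_eq_zero]
      simp only [map_sub, map_add, map_neg, map_mul, map_one, modBb_s, modBb_bb, modBb_be, hca]
      intro h
      refine mul_ne_zero hab hu0 (mul_left_cancel₀ (show (2 : ZMod 3) ≠ 0 by decide) ?_)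
      linear_combination h)
  have L2 := mulRS_oddNorm_lz hp h16 hcop h1 h2 (by
      rw [← modBb_eq_zero]
      simp only [map_add, map_mul, modBb_s, modBb_bb, hca]
      intro h
      refine hab (mul_left_cancel₀ (show (2 : ZMod 3) ≠ 0 by decide) ?_)
      linear_combination h)
  have hw0 : w ≠ 0 := by rintro rfl; simp at hw
  exact ((OddNorm.sq hw0).mul (L1.mul L2)).false K (by ring)

lemma even_sq_mod_eight {x : O} (h : x.re % 2 = 0) :
    (x.re % 4 = 0 ∧ x.im % 2 = 0 ∧ (x ^ 2).re % 8 = 0 ∧ (x ^ 2).im % 8 = 0) ∨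
    (x.re % 4 = 0 ∧ x.im % 2 = 1 ∧ (x ^ 2).re % 8 = 6 ∧ (x ^ 2).im % 8 = 0) ∨
    (x.re % 4 = 2 ∧ x.im % 2 = 0 ∧ (x ^ 2).re % 8 = 4 ∧ (x ^ 2).im % 8 = 0) ∨
    (x.re % 4 = 2 ∧ x.im % 2 = 1 ∧ (x ^ 2).re % 8 = 2 ∧ (x ^ 2).im % 8 = 4) := by
  have e1 : (x ^ 2).re = x.re * x.re + -2 * (x.im * x.im) := by simp [pow_two]; ring
  have e2 : (x ^ 2).im = 2 * (x.re * x.im) := by simp [pow_two]; ring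
  rw [e1, e2]
  obtain ⟨m, hm⟩ : ∃ m, x.re = 4 * m ∨ x.re = 4 * m + 2 := ⟨x.re / 4, by omega⟩
  obtain ⟨n, hn⟩ : ∃ n, x.im = 2 * n ∨ x.im = 2 * n + 1 := ⟨x.im / 2, by omega⟩
  rcases hm with hm | hm <;> rcases hn with hn | hn <;> rw [hm, hn]
  · have f1 : 4 * m * (4 * m) + -2 * (2 * n * (2 * n)) = 8 * (2 * m * m - n * n) := by ring
    have f2 : 2 * (4 * m * (2 * n)) = 8 * (2 * m * n) := by ring
    omega
  · have f1 : 4 * m * (4 * m) + -2 * ((2 * n + 1) * (2 * n + 1)) =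
      8 * (2 * m * m - n * n - n) - 2 := by ring
    have f2 : 2 * (4 * m * (2 * n + 1)) = 8 * (m * (2 * n + 1)) := by ring
    omega
  · have f1 : (4 * m + 2) * (4 * m + 2) + -2 * (2 * n * (2 * n)) =
      8 * (2 * m * m + 2 * m - n * n) + 4 := by ring
    have f2 : 2 * ((4 * m + 2) * (2 * n)) = 8 * ((2 * m + 1) * n) := by ring
    omega
  · have f1 : (4 * m + 2) * (4 * m + 2) + -2 * ((2 * n + 1) * (2 * n + 1)) =
      8 * (2 * m * m + 2 * m - n * n - n) + 2 := by ring
    have f2 : 2 * ((4 * m + 2) * (2 * n + 1)) = 8 * (2 * m * n + m + n) + 4 := by ring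
    omega

/-- `l` is `σ` times a square, up to a power of `s` and of `-p`. -/
def SignClass (p : ℕ) (σ : ZMod 3) (l : O) : Prop :=
  ∃ e i j t : O, (e = 1 ∨ e = -1) ∧ (i = 1 ∨ i = s) ∧ (j = 1 ∨ j = p) ∧ l = e * i * j * t ^ 2 ∧
    t ≠ 0 ∧ modBb (e * j) = σ

lemma signClass_of {p : ℕ} {l : O}
    (h : ∃ e i j t : O, (e = 1 ∨ e = -1) ∧ (i = 1 ∨ i = s) ∧ (j = 1 ∨ j = p) ∧
      l = e * i * j * t ^ 2 ∧ t ≠ 0) : ∃ σ, SignClass p σ l := by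
  obtain ⟨e, i, j, t, h1, h2, h3, h4, h5⟩ := h
  exact ⟨_, e, i, j, t, h1, h2, h3, h4, h5, rfl⟩

variable {p : ℕ} {σ σ' : ZMod 3} {l l' x w : O}

lemma SignClass.oddNorm (h : SignClass p σ l) (hp : p % 2 = 1) : OddNorm 1 l := by
  obtain ⟨e, i, j, t, h1, h2, h3, rfl, h5, -⟩ := h
  have n1 : OddNorm 1 i := by
    rcases h2 with rfl | rfl
    · exact OddNorm.unit (Or.inl rfl)
    · exact oddNorm_s
  have n2 : OddNorm 1 j := by
    rcases h3 with rfl | rfl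
    · exact OddNorm.unit (Or.inl rfl)
    · exact OddNorm.natCast hp
  exact (((OddNorm.unit h1).mul n1).mul n2).mul (OddNorm.sq h5)

lemma SignClass.mul_sq (h : SignClass p σ l) (hw : w ≠ 0) : SignClass p σ (w ^ 2 * l) := by
  obtain ⟨e, i, j, t, h1, h2, h3, rfl, h5, h6⟩ := h
  exact ⟨e, i, j, w * t, h1, h2, h3, by ring, mul_ne_zero hw h5, h6⟩

lemma SignClass.mul (hp : p ≠ 0) (hp3 : p % 3 = 2) (h : SignClass p σ l) (h' : SignClass p σ' l') :
    SignClass p (σ * σ') (l * l') := by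
  obtain ⟨e, i, j, t, h1, h2, h3, rfl, h5, rfl⟩ := h
  obtain ⟨e', i', j', t', h1', h2', h3', rfl, h5', rfl⟩ := h'
  have hp0 : (p : O) ≠ 0 := by exact_mod_cast hp
  have hee : e * e' = 1 ∨ e * e' = -1 := by
    rcases h1 with rfl | rfl <;> rcases h1' with rfl | rfl <;> simp
  obtain ⟨i'', t1, hi, ht1, hi1⟩ : ∃ i'' t1 : O,
      (i'' = 1 ∨ i'' = s) ∧ t1 ≠ 0 ∧ i * i' = i'' * t1 ^ 2 := by
    rcases h2 with rfl | rfl <;> rcases h2' with rfl | rfl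
    · exact ⟨1, 1, Or.inl rfl, one_ne_zero, by ring⟩
    · exact ⟨s, 1, Or.inr rfl, one_ne_zero, by ring⟩
    · exact ⟨s, 1, Or.inr rfl, one_ne_zero, by ring⟩
    · exact ⟨1, s, Or.inl rfl, prime_s.ne_zero, by ring⟩
  obtain ⟨j'', t2, hj, ht2, hj1, hj2⟩ : ∃ j'' t2 : O, (j'' = 1 ∨ j'' = p) ∧ t2 ≠ 0 ∧
      j * j' = j'' * t2 ^ 2 ∧ modBb j'' = modBb j * modBb j' := by
    rcases h3 with rfl | rfl <;> rcases h3' with rfl | rfl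
    · exact ⟨1, 1, Or.inl rfl, one_ne_zero, by ring, by simp⟩
    · exact ⟨p, 1, Or.inr rfl, one_ne_zero, by ring, by simp⟩
    · exact ⟨p, 1, Or.inr rfl, one_ne_zero, by ring, by simp⟩
    · exact ⟨1, p, Or.inl rfl, hp0, by ring, by rw [modBb_natCast hp3, map_one]; decide⟩
  refine ⟨e * e', i'', j'', t1 * t2 * (t * t'), hee, hi, hj, ?_,
    mul_ne_zero (mul_ne_zero ht1 ht2) (mul_ne_zero h5 h5'), ?_⟩
  · linear_combination (e * e' * (j * j') * (t * t') ^ 2) * hi1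
      + (e * e' * (i'' * t1 ^ 2) * (t * t') ^ 2) * hj1
  · simp only [map_mul, hj2]; ring

lemma SignClass.modBb_eq (h : SignClass p σ l) (hl : modBb l ≠ 0) : modBb l = σ := by
  obtain ⟨e, i, j, t, h1, h2, h3, rfl, h5, rfl⟩ := h
  have hi : modBb i = 1 := by rcases h2 with rfl | rfl <;> simp [modBb_s]
  simp only [map_mul, map_pow, hi] at hl ⊢
  have ht : modBb t ≠ 0 := by intro h; simp [h] at hl
  have : modBb t ^ 2 = 1 := by
    generalize modBb t = t at *
    clear * - ht
    decide +revert
  rw [this]; ring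

lemma SignClass.of_mul_s_sq (h : SignClass p σ (s ^ 2 * x)) (hp : p % 2 = 1) : SignClass p σ x := by
  obtain ⟨e, i, j, t, h1, h2, h3, h4, h5, h6⟩ := h
  have hj : ¬ s ∣ j := by
    rw [s_dvd_iff]
    rcases h3 with rfl | rfl
    · simp
    · simp; omega
  have he : ¬ s ∣ e := by
    rw [s_dvd_iff]
    rcases h1 with rfl | rfl <;> simp
  have hst : s ∣ t := by
    rcases h2 with rfl | rfl
    · have : s ∣ e * 1 * j * t ^ 2 := by
        rw [← h4]; exact (dvd_pow_self s two_ne_zero).mul_right _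
      rcases prime_s.dvd_or_dvd this with h | h
      · rw [mul_one] at h
        exact ((prime_s.dvd_or_dvd h).elim he hj).elim
      · exact prime_s.dvd_of_dvd_pow h
    · have : s * x = e * j * t ^ 2 := mul_left_cancel₀ prime_s.ne_zero (by linear_combination h4)
      have h7 : s ∣ e * j * t ^ 2 := this ▸ dvd_mul_right _ _
      rcases prime_s.dvd_or_dvd h7 with h | h
      · exact ((prime_s.dvd_or_dvd h).elim he hj).elim
      · exact prime_s.dvd_of_dvd_pow h
  obtain ⟨t, rfl⟩ := hst
  refine ⟨e, i, j, t, h1, h2, h3, ?_, right_ne_zero_of_mul h5, h6⟩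
  exact mul_left_cancel₀ (pow_ne_zero 2 prime_s.ne_zero) (by linear_combination h4)

lemma SignClass.of_mul_s (h : SignClass p σ (s * x)) (hp : p % 2 = 1) : SignClass p σ x := by
  obtain ⟨e, i, j, t, h1, h2, h3, h4, h5, h6⟩ := h
  refine SignClass.of_mul_s_sq (p := p) ?_ hp
  rcases h2 with rfl | rfl
  · exact ⟨e, s, j, t, h1, Or.inr rfl, h3, by linear_combination s * h4, h5, h6⟩
  · exact ⟨e, 1, j, s * t, h1, Or.inl rfl, h3, by linear_combination s * h4,
      mul_ne_zero prime_s.ne_zero h5, h6⟩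

lemma SignClass.two_adic (h : SignClass p σ x) (h8 : p % 8 = 7) (hp3 : p % 3 = 2)
    (hx : x.re % 2 = 1) :
    σ = 1 ∧ (x.re % 8 = 1 ∧ x.im % 4 = 0 ∨ x.re % 8 = 7 ∧ x.im % 4 = 2) ∨
    σ = -1 ∧ (x.re % 8 = 7 ∧ x.im % 4 = 0 ∨ x.re % 8 = 1 ∧ x.im % 4 = 2) := by
  obtain ⟨e, i, j, t, h1, h2, h3, h4, h5, h6⟩ := h
  have hi : i = 1 := by
    refine h2.resolve_right ?_
    rintro rfl
    have : s ∣ x := ⟨e * j * t ^ 2, by linear_combination h4⟩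
    rw [s_dvd_iff] at this
    omega
  subst hi
  have ht : t.re % 2 = 1 := by
    by_contra hc
    have : s ∣ t := (s_dvd_iff t).2 (by omega)
    have : s ∣ x := by rw [h4]; exact (this.pow two_ne_zero).mul_left _
    rw [s_dvd_iff] at this
    omega
  rw [mul_one] at h4
  obtain ⟨f, hf, hf'⟩ : ∃ f : ℤ, e * j = f ∧ (f % 8 = 1 ∧ σ = 1 ∨ f % 8 = 7 ∧ σ = -1) := by
    rw [← h6]
    have hpb := modBb_natCast hp3
    rcases h1 with rfl | rfl <;> rcases h3 with rfl | rfl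
    · exact ⟨1, by simp, Or.inl ⟨rfl, by simp⟩⟩
    · exact ⟨p, by simp, Or.inr ⟨by omega, by simp [hpb]⟩⟩
    · exact ⟨-1, by simp, Or.inr ⟨rfl, by simp⟩⟩
    · exact ⟨-p, by simp, Or.inl ⟨by omega, by simp [hpb]⟩⟩
  rw [hf] at h4
  have e1 : x.re = f * (t ^ 2).re := by rw [h4]; simp
  have e2 : x.im = f * (t ^ 2).im := by rw [h4]; simp
  have m1 := Int.mul_emod f (t ^ 2).re 8
  have m2 := Int.mul_emod f (t ^ 2).im 8
  rw [← e1] at m1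
  rw [← e2] at m2
  have hsq := sq_mod_eight ht
  have hsq' : ((t ^ 2).re % 8 = 1 ∧ ((t ^ 2).im % 8 = 0 ∨ (t ^ 2).im % 8 = 4)) ∨
    ((t ^ 2).re % 8 = 7 ∧ ((t ^ 2).im % 8 = 2 ∨ (t ^ 2).im % 8 = 6)) := by tauto
  rcases hf' with ⟨f1, rfl⟩ | ⟨f1, rfl⟩
  · refine Or.inl ⟨rfl, ?_⟩
    rcases hsq' with ⟨q1, q2 | q2⟩ | ⟨q1, q2 | q2⟩ <;> rw [f1, q1] at m1 <;> rw [f1, q2] at m2 <;>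
      omega
  · refine Or.inr ⟨rfl, ?_⟩
    rcases hsq' with ⟨q1, q2 | q2⟩ | ⟨q1, q2 | q2⟩ <;> rw [f1, q1] at m1 <;> rw [f1, q2] at m2 <;>
      omega

lemma SignClass.re_of_mul (h : SignClass p σ x) (h8 : p % 8 = 7) (hp3 : p % 3 = 2)
    (hwx : (w * x).re % 2 = 1) (hwx' : (w * x).im % 2 = 0) :
    w.re % 8 = (w * x).re % 8 ∨ w.re % 8 = -(w * x).re % 8 := by
  have hx : x.re % 2 = 1 := by
    by_contra hc
    have : s ∣ w * x := ((s_dvd_iff x).2 (by omega)).mul_left _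
    rw [s_dvd_iff] at this
    omega
  have hx' : x.im % 2 = 0 ∧ (x.re % 8 = 1 ∨ x.re % 8 = 7) := by
    rcases h.two_adic h8 hp3 hx with ⟨-, ⟨h1, h2⟩ | ⟨h1, h2⟩⟩ | ⟨-, ⟨h1, h2⟩ | ⟨h1, h2⟩⟩ <;> omega
  obtain ⟨hx2, hx3⟩ := hx'
  rw [re_mul] at *
  rw [im_mul] at hwx'
  have m1 := Int.mul_emod w.re x.re 8
  have hwi : w.im % 2 = 0 := by
    by_contra hc
    have h1 : w.im % 2 = 1 := by omega
    simp [Int.add_emod, Int.mul_emod, hx, hx2, h1] at hwx'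
  obtain ⟨y, hy⟩ : ∃ y, x.im = 2 * y := ⟨x.im / 2, by omega⟩
  obtain ⟨v, hv⟩ : ∃ y, w.im = 2 * y := ⟨w.im / 2, by omega⟩
  have e : -2 * w.im * x.im = 8 * (-(v * y)) := by rw [hy, hv]; ring
  obtain ⟨n, hn⟩ : ∃ n, x.re = 8 * n + 1 ∨ x.re = 8 * n + 7 := ⟨x.re / 8, by omega⟩
  rcases hn with hn | hn
  · have e' : w.re * x.re = 8 * (w.re * n) + w.re := by rw [hn]; ring
    omega
  · have e' : w.re * x.re = 8 * (w.re * n) + 7 * w.re := by rw [hn]; ring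
    omega

lemma signClass_conic {p : ℕ} (hp : p.Prime) (h8 : p % 8 = 7) {B C z b0 c0 : O}
    (hcop : ∀ q, Prime q → q ∣ B → q ∣ C → q ∣ z → False)
    (h : B ^ 2 + C ^ 2 = 2 * p * z ^ 2) (h0 : b0 ^ 2 + c0 ^ 2 = 2 * p)
    (hl : B * b0 + C * c0 - 2 * p * z ≠ 0) :
    ∃ σ, SignClass p σ (B * b0 + C * c0 - 2 * p * z) := by
  have hpP : Prime (p : O) := prime_natCast hp h8
  refine signClass_of (exists_class_two prime_s hpP hl
    (l' := B * b0 + C * c0 + 2 * p * z) (δ := -1) (m := B * c0 - C * b0) ?_ ?_)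
  · linear_combination (b0 ^ 2 + c0 ^ 2) * h + (2 * p * z ^ 2) * h0
  · intro q hq hql hql'
    have hql' : q ∣ B * b0 + C * c0 + 2 * p * z :=
      hql'.resolve_left fun hu => hq.not_isUnit (isUnit_of_dvd_unit hu (by simp))
    have hm : q ∣ B * c0 - C * b0 := by
      refine hq.dvd_of_dvd_pow (n := 2) ?_
      have : (B * c0 - C * b0) ^ 2 =
          (B * b0 + C * c0 - 2 * p * z) * -(B * b0 + C * c0 + 2 * p * z) := by
        linear_combination (b0 ^ 2 + c0 ^ 2) * h + (2 * p * z ^ 2) * h0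
      rw [this]
      exact hql.mul_right _
    have h4 : q ∣ 2 * 2 * (p * z) := by
      convert dvd_sub hql' hql using 1; ring
    have h2 : ∀ {x}, q ∣ 2 * p * x → (q ∣ s ∨ q ∣ (p : O)) ∨ q ∣ x := by
      intro x hx
      rcases hq.dvd_or_dvd hx with hx | hx
      · exact Or.inl ((hq.dvd_or_dvd hx).imp_left (dvd_s_of_dvd_two hq))
      · exact Or.inr hx
    rcases hq.dvd_or_dvd h4 with h4 | h4
    · exact Or.inl (dvd_s_of_dvd_two hq ((hq.dvd_or_dvd h4).elim id id))
    rcases hq.dvd_or_dvd h4 with h4 | hz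
    · exact Or.inr h4
    have hs : q ∣ B * b0 + C * c0 := by
      convert dvd_add hql (hz.mul_left (2 * p)) using 1; ring
    have hB : q ∣ 2 * p * B := by
      convert dvd_add (hs.mul_left b0) (hm.mul_left c0) using 1
      linear_combination -B * h0
    have hC : q ∣ 2 * p * C := by
      convert dvd_sub (hs.mul_left c0) (hm.mul_left b0) using 1
      linear_combination -C * h0
    rcases h2 hB with h | hB
    · exact h
    rcases h2 hC with h | hC
    · exact h
    exact (hcop q hq hB hC hz).elim

lemma odd_sq_mod_sixteen {x : ℤ} (h : x % 2 = 1) :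
    (x ^ 2 % 16 = 1 ∧ (x % 8 = 1 ∨ x % 8 = 7)) ∨ (x ^ 2 % 16 = 9 ∧ (x % 8 = 3 ∨ x % 8 = 5)) := by
  obtain ⟨n, hn⟩ : ∃ n, x = 8 * n + 1 ∨ x = 8 * n + 3 ∨ x = 8 * n + 5 ∨ x = 8 * n + 7 :=
    ⟨x / 8, by omega⟩
  rcases hn with rfl | rfl | rfl | rfl <;> ring_nf <;> omega

lemma exists_conic_point {p : ℕ} (hp : p.Prime) (h16 : p % 16 = 7) :
    ∃ x y : ℤ, (x % 8 = 3 ∨ x % 8 = 5) ∧ y % 2 = 1 ∧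
      (⟨x, y⟩ : O) ^ 2 + (⟨x, -y⟩ : O) ^ 2 = 2 * p := by
  obtain ⟨x, y, h⟩ := exists_eq_sq_sub_two_sq hp (by omega)
  have e : ∀ t : ℤ, t % 2 = 0 → t ^ 2 % 4 = 0 := by
    rintro t ht
    obtain ⟨n, rfl⟩ : ∃ n, t = 2 * n := ⟨t / 2, by omega⟩
    ring_nf; omega
  have hx : x % 2 = 1 := by
    have := e x
    omega
  have hy : y % 2 = 1 := by
    have := e y
    have := odd_sq_mod_sixteen hx
    omega
  have hx' := odd_sq_mod_sixteen hx
  have hy' := odd_sq_mod_sixteen hy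
  refine ⟨x, y, by omega, hy, ?_⟩
  ext
  · simp [pow_two]; linarith
  · simp [pow_two]; ring

set_option maxHeartbeats 4000000 in
/-- The two possible shapes of a solution modulo powers of `s`. -/
lemma mulR_types {p : ℕ} (h16 : p % 16 = 7) {a b c z : O}
    (hz : z.re % 16 = 1) (hz' : z.im % 16 = 0)
    (h1 : be ^ 2 * a ^ 2 - c ^ 2 = p * bb ^ 2 * z ^ 2) (h3 : a ^ 2 + b ^ 2 = -(p * z ^ 2)) :
    (a.re % 4 = 0 ∧ a.im % 2 = 0 ∧ b.re % 2 = 1 ∧ b.im % 4 = 0 ∧ c.re % 2 = 1 ∧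
      (c.im + c.re) % 4 = 0) ∨
    (a.re % 2 = 1 ∧ b.re % 4 = 0 ∧ b.im % 2 = 0 ∧ c.re % 4 = 0 ∧ c.im % 2 = 1) := by
  obtain ⟨k1, k2⟩ := one_sq_mod h16 hz hz'
  have e1 := congrArg Zsqrtd.re h1
  have e2 := congrArg Zsqrtd.im h1
  have e5 := congrArg Zsqrtd.re h3
  have e6 := congrArg Zsqrtd.im h3
  rw [show be ^ 2 = (⟨-1, 2⟩ : O) by decide, show bb ^ 2 = (⟨-1, -2⟩ : O) by decide] at e1 e2
  simp at e1 e2 e5 e6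
  ring_nf at e1 e2 e5 e6
  generalize (p : ℤ) * (z ^ 2).re = P1 at *
  generalize (p : ℤ) * (z ^ 2).im = P2 at *
  have hc6 : c.re % 2 = 1 → (c ^ 2).im % 8 = 6 → (c.im + c.re) % 4 = 0 := by
    intro h h'
    have e : (c ^ 2).im = 2 * (c.re * c.im) := by simp [pow_two]; ring
    obtain ⟨n, hn⟩ : ∃ n, c.re = 4 * n + 1 ∨ c.re = 4 * n + 3 := ⟨c.re / 4, by omega⟩
    rcases hn with hn | hn
    · have e' : c.re * c.im = 4 * (n * c.im) + c.im := by rw [hn]; ring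
      omega
    · have e' : c.re * c.im = 4 * (n * c.im) + 3 * c.im := by rw [hn]; ring
      omega
  have a1 := re_sq_mod_two a
  have b1 := re_sq_mod_two b
  have c1 := re_sq_mod_two c
  rcases Int.emod_two_eq_zero_or_one a.re with ha | ha
  swap
  · have ha' := sq_mod_eight ha
    have hb : b.re % 2 = 0 := by omega
    have hc : c.re % 2 = 0 := by omega
    have hb' := even_sq_mod_eight hb
    have hc' := even_sq_mod_eight hc
    clear hc6 a1 b1 c1
    rcases ha' with ha' | ha' | ha' <;> rcases hb' with hb' | hb' | hb' | hb' <;>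
      rcases hc' with hc' | hc' | hc' | hc' <;> omega
  · have ha' := even_sq_mod_eight ha
    have hb : b.re % 2 = 1 := by omega
    have hc : c.re % 2 = 1 := by omega
    have hb' := sq_mod_eight hb
    have hc' := sq_mod_eight hc
    replace hc6 := hc6 hc
    clear a1 b1 c1
    rcases ha' with ha' | ha' | ha' | ha' <;> rcases hb' with hb' | hb' | hb' <;>
      rcases hc' with hc' | hc' | hc' <;> omega

lemma emod_two_pow_of_odd_mul {x y : ℤ} (n : ℕ) (hx : x % 2 = 1) (h : (x * y) % 2 ^ n = 0) :
    y % 2 ^ n = 0 := by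
  have hc : IsCoprime (2 ^ n) x := IsCoprime.pow_left ⟨-(x / 2), 1, by omega⟩
  exact Int.emod_eq_zero_of_dvd (hc.dvd_of_dvd_mul_left (Int.dvd_of_emod_eq_zero h))

/-- Refinement of the second case of `mulR_types`. -/
lemma mulR_typeII {p : ℕ} (h16 : p % 16 = 7) {a b c z : O}
    (hz : z.re % 16 = 1) (hz' : z.im % 16 = 0)
    (h3 : a ^ 2 + b ^ 2 = -(p * z ^ 2)) (h5 : bb ^ 2 * b ^ 2 - c ^ 2 = 2 * a ^ 2)
    (ha : a.re % 2 = 1) (hb : b.re % 4 = 0) (hb' : b.im % 2 = 0) (hc : c.re % 4 = 0)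
    (hc' : c.im % 2 = 1) :
    (a.re % 8 = 3 ∨ a.re % 8 = 5) ∧ a.im % 8 = 0 ∧ b.im % 4 = 0 ∧ c.re % 16 = 0 ∧
      (b.re % 8 = 0 ∧ (c.im % 8 = a.re % 8 ∨ c.im % 8 = -a.re % 8) ∨
       b.re % 8 = 4 ∧ (c.im % 8 = (a.re + 4) % 8 ∨ c.im % 8 = (-a.re + 4) % 8)) := by
  obtain ⟨k1, k2⟩ := one_sq_mod h16 hz hz'
  have sr : ∀ x : O, (x ^ 2).re = x.re ^ 2 - 2 * x.im ^ 2 := by intro x; simp [pow_two]; ring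
  have si : ∀ x : O, (x ^ 2).im = 2 * (x.re * x.im) := by intro x; simp [pow_two]; ring
  have e1 := congrArg Zsqrtd.re h3
  have e2 := congrArg Zsqrtd.im h3
  have e3 := congrArg Zsqrtd.re h5
  have e4 := congrArg Zsqrtd.im h5
  rw [show bb ^ 2 = (⟨-1, -2⟩ : O) by decide] at e3 e4
  simp at e1 e2 e3 e4
  generalize (p : ℤ) * (z ^ 2).re = P1 at *
  generalize (p : ℤ) * (z ^ 2).im = P2 at *
  simp only [sr, si] at e1 e2 e3 e4
  obtain ⟨u, v⟩ := a
  obtain ⟨m, n⟩ := b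
  obtain ⟨k, l⟩ := c
  simp only at *
  obtain ⟨m, rfl⟩ : ∃ t, m = 4 * t := ⟨m / 4, by omega⟩
  obtain ⟨n, rfl⟩ : ∃ t, n = 2 * t := ⟨n / 2, by omega⟩
  obtain ⟨k, rfl⟩ : ∃ t, k = 4 * t := ⟨k / 4, by omega⟩
  have hv : v % 8 = 0 := emod_two_pow_of_odd_mul 3 ha (by
    have : u * v = -8 * (m * n) - (P2 / 2) := by
      have : 4 * m * (2 * n) = 8 * (m * n) := by ring
      omega
    omega)
  obtain ⟨v, rfl⟩ : ∃ t, v = 8 * t := ⟨v / 8, by omega⟩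
  have g1 : u ^ 2 - 128 * v ^ 2 + 16 * m ^ 2 - 8 * n ^ 2 = -P1 := by linarith
  have g3 : -16 * m ^ 2 + 8 * n ^ 2 + 64 * (m * n) - 16 * k ^ 2 + 2 * l ^ 2 =
    2 * u ^ 2 - 256 * v ^ 2 := by linarith
  have g4 : l * k = -4 * m ^ 2 + 2 * n ^ 2 - 2 * (m * n) - 4 * (u * v) := by linarith
  have hu := odd_sq_mod_sixteen ha
  have hl := odd_sq_mod_sixteen hc'
  have hn : n % 2 = 0 := by
    by_contra hn
    have := odd_sq_mod_sixteen (x := n) (by omega)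
    omega
  obtain ⟨n, rfl⟩ : ∃ t, n = 2 * t := ⟨n / 2, by omega⟩
  have hk : k % 4 = 0 := emod_two_pow_of_odd_mul 2 hc' (by
    have : l * k = 4 * (-m ^ 2 + 2 * n ^ 2 - m * n - u * v) := by linarith
    omega)
  have g5 : (2 * n) ^ 2 = 4 * n ^ 2 := by ring
  have g6 : m * (2 * n) = 2 * (m * n) := by ring
  obtain ⟨r, hr⟩ : ∃ r, m = 2 * r ∨ m = 2 * r + 1 := ⟨m / 2, by omega⟩
  obtain ⟨k, rfl⟩ : ∃ t, k = 4 * t := ⟨k / 4, by omega⟩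
  have g7 : (4 * k) ^ 2 = 16 * k ^ 2 := by ring
  have g8 : m ^ 2 % 2 = m % 2 := by
    rcases hr with rfl | rfl
    · have : (2 * r) ^ 2 = 2 * (2 * r ^ 2) := by ring
      omega
    · have : (2 * r + 1) ^ 2 = 2 * (2 * r ^ 2 + 2 * r) + 1 := by ring
      omega
  refine ⟨by omega, by omega, by omega, by omega, ?_⟩
  rcases hr with rfl | rfl
  · left; omega
  · right; omega

lemma natCast_mul_emod_eight {p : ℕ} (h8 : p % 8 = 7) (x : ℤ) : (p * x) % 8 = (-x) % 8 := by
  obtain ⟨k, hk⟩ : ∃ k : ℤ, (p : ℤ) = 8 * k + 7 := ⟨p / 8, by omega⟩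
  have : p * x = 8 * (k * x) + 7 * x := by rw [hk]; ring
  omega

lemma mulR_odd {p : ℕ} (h8 : p % 8 = 7) {a b c z : O}
    (hcop : ∀ q, Prime q → q ∣ a → q ∣ z → False)
    (h3 : a ^ 2 + b ^ 2 = -(p * z ^ 2)) (h5 : bb ^ 2 * b ^ 2 - c ^ 2 = 2 * a ^ 2) :
    z.re % 2 = 1 := by
  by_contra hz
  replace hz : z.re % 2 = 0 := by omega
  have ha : a.re % 2 = 1 := by
    by_contra ha
    exact hcop s prime_s ((s_dvd_iff a).2 (by omega)) ((s_dvd_iff z).2 (by omega))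
  have e1 := congrArg Zsqrtd.re h3
  have e2 := congrArg Zsqrtd.im h3
  have e3 := congrArg Zsqrtd.re h5
  have e4 := congrArg Zsqrtd.im h5
  rw [show bb ^ 2 = (⟨-1, -2⟩ : O) by decide] at e3 e4
  simp at e1 e2 e3 e4
  have k1 := natCast_mul_emod_eight h8 (z ^ 2).re
  have k2 := natCast_mul_emod_eight h8 (z ^ 2).im
  generalize (p : ℤ) * (z ^ 2).re = P1 at *
  generalize (p : ℤ) * (z ^ 2).im = P2 at *
  have a1 := re_sq_mod_two a
  have b1 := re_sq_mod_two b
  have c1 := re_sq_mod_two c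
  have hz' := even_sq_mod_eight hz
  have hb : b.re % 2 = 1 := by omega
  have hc : c.re % 2 = 1 := by omega
  have ha' := sq_mod_eight ha
  have hb' := sq_mod_eight hb
  have hc' := sq_mod_eight hc
  clear a1 b1 c1
  rcases ha' with ha' | ha' | ha' <;> rcases hb' with hb' | hb' | hb' <;>
      rcases hc' with hc' | hc' | hc' <;> omega

lemma exists_eq_s_mul {w l : O} (hw : w.re % 2 = 1) (h : (w * l).re % 2 = 0) : ∃ x, l = s * x := by
  have : s ∣ w * l := (s_dvd_iff _).2 (by omega)
  refine (prime_s.dvd_or_dvd this).resolve_left fun h => ?_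
  rw [s_dvd_iff] at h
  omega

lemma re_mul_emod_eight (x y : O) :
    (x * y).re % 8 = (x.re % 8 * (y.re % 8) - 2 * (x.im % 4 * (y.im % 4))) % 8 := by
  obtain ⟨x1, x2⟩ := x
  obtain ⟨y1, y2⟩ := y
  simp only [re_mul]
  rw [show x1 * y1 + -2 * x2 * y2 = x1 * y1 - 2 * (x2 * y2) by ring]
  refine Int.ModEq.sub ((Int.mod_modEq _ _).symm.mul (Int.mod_modEq _ _).symm) ?_
  exact Int.ModEq.mul_left' (n := 4) ((Int.mod_modEq _ _).symm.mul (Int.mod_modEq _ _).symm)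

lemma im_mul_emod_four (x y : O) :
    (x * y).im % 4 = (x.re % 4 * (y.im % 4) + x.im % 4 * (y.re % 4)) % 4 := by
  rw [im_mul]
  exact ((Int.mod_modEq _ _).symm.mul (Int.mod_modEq _ _).symm).add
    ((Int.mod_modEq _ _).symm.mul (Int.mod_modEq _ _).symm)

lemma mulR_typeI_conic {p : ℕ} (h16 : p % 16 = 7) {b c z : O} {x y : ℤ}
    (hz : z.re % 16 = 1) (hz' : z.im % 16 = 0)
    (hx : x % 8 = 3 ∨ x % 8 = 5) (hy : y % 2 = 1) (hb' : b.im % 4 = 0) (hc : (c.im + c.re) % 4 = 0)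
    (hbc : (b.re + c.re) % 4 = 0) :
    (be * b * ⟨x, y⟩ + c * ⟨x, -y⟩ - 2 * p * z).re % 4 = 2 ∧
      (be * b * ⟨x, y⟩ + c * ⟨x, -y⟩ - 2 * p * z).im % 4 = 0 := by
  obtain ⟨b, b'⟩ := b
  obtain ⟨c, c'⟩ := c
  obtain ⟨z, z'⟩ := z
  simp only at *
  obtain ⟨b', rfl⟩ : ∃ t, b' = 4 * t := ⟨b' / 4, by omega⟩
  obtain ⟨i, rfl⟩ : ∃ t, b = 4 * t - c := ⟨(b + c) / 4, by omega⟩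
  obtain ⟨j, rfl⟩ : ∃ t, c' = 4 * t - c := ⟨(c' + c) / 4, by omega⟩
  obtain ⟨z, rfl⟩ : ∃ t, z = 16 * t + 1 := ⟨z / 16, by omega⟩
  obtain ⟨z', rfl⟩ : ∃ t, z' = 16 * t := ⟨z' / 16, by omega⟩
  obtain ⟨r, hr⟩ : ∃ r : ℤ, (p : ℤ) = 16 * r + 7 := ⟨p / 16, by omega⟩
  obtain ⟨k, rfl⟩ : ∃ t, x = 2 * t + y := ⟨(x - y) / 2, by omega⟩
  simp [hr]
  ring_nf
  omega

lemma mulR_typeII_conic {p : ℕ} (h16 : p % 16 = 7) {b c z l : O} {x y : ℤ}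
    (hz : z.re % 16 = 1) (hz' : z.im % 16 = 0)
    (hx : x % 8 = 3 ∨ x % 8 = 5) (hy : y % 2 = 1) (hb : b.re % 8 = 0) (hb' : b.im % 8 = 0)
    (hc : c.re % 16 = 0) (hc' : c.im % 8 = 3 ∨ c.im % 8 = 5)
    (hl : s * l = be * b * ⟨x, y⟩ + c * ⟨x, -y⟩ - 2 * p * z) :
    (l.re % 8 = 1 ∨ l.re % 8 = 7) ∧ l.im % 2 = 0 := by
  have e1 := congrArg Zsqrtd.re hl
  have e2 := congrArg Zsqrtd.im hl
  obtain ⟨b, b'⟩ := b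
  obtain ⟨c, c'⟩ := c
  obtain ⟨z, z'⟩ := z
  simp only at *
  obtain ⟨b', rfl⟩ : ∃ t, b' = 8 * t := ⟨b' / 8, by omega⟩
  obtain ⟨b, rfl⟩ : ∃ t, b = 8 * t := ⟨b / 8, by omega⟩
  obtain ⟨c, rfl⟩ : ∃ t, c = 16 * t := ⟨c / 16, by omega⟩
  obtain ⟨z, rfl⟩ : ∃ t, z = 16 * t + 1 := ⟨z / 16, by omega⟩
  obtain ⟨z', rfl⟩ : ∃ t, z' = 16 * t := ⟨z' / 16, by omega⟩
  obtain ⟨r, hr⟩ : ∃ r : ℤ, (p : ℤ) = 16 * r + 7 := ⟨p / 16, by omega⟩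
  obtain ⟨y, rfl⟩ : ∃ t, y = 2 * t + 1 := ⟨y / 2, by omega⟩
  obtain ⟨x, hx⟩ : ∃ t, x = 8 * t + 3 ∨ x = 8 * t + 5 := ⟨x / 8, by omega⟩
  obtain ⟨c', hc'⟩ : ∃ t, c' = 8 * t + 3 ∨ c' = 8 * t + 5 := ⟨c' / 8, by omega⟩
  rcases hx with rfl | rfl <;> rcases hc' with rfl | rfl <;> simp [hr] at e1 e2 <;>
    ring_nf at e1 e2 <;> omega

lemma mulR_typeII_mul {a b c l : O} (ha : a.re % 8 = 3 ∨ a.re % 8 = 5) (ha' : a.im % 8 = 0)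
    (hb : b.im % 4 = 0) (hc : c.re % 16 = 0)
    (hbc : b.re % 8 = 0 ∧ b.im % 8 = 4 ∧ (c.im % 8 = a.re % 8 ∨ c.im % 8 = -a.re % 8) ∨
       b.re % 8 = 4 ∧ (c.im % 8 = (a.re + 4) % 8 ∨ c.im % 8 = (-a.re + 4) % 8))
    (hl : s * l = bb * b - c) :
    ((be * a - c) * l).re % 2 = 1 ∧
      ¬ (((be * a - c) * l).re % 8 = 7 ∧ ((be * a - c) * l).im % 4 = 0 ∨
        ((be * a - c) * l).re % 8 = 1 ∧ ((be * a - c) * l).im % 4 = 2) := by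
  have e1 := congrArg Zsqrtd.re hl
  have e2 := congrArg Zsqrtd.im hl
  simp at e1 e2
  have r1 : (be * a - c).re = a.re - 2 * a.im - c.re := by simp; ring
  have r2 : (be * a - c).im = a.re + a.im - c.im := by simp; ring
  have m1 := re_mul_emod_eight (be * a - c) l
  have m2 := im_mul_emod_four (be * a - c) l
  generalize (be * a - c) * l = P at *
  generalize be * a - c = L at *
  have c1 : L.re % 8 = 3 ∨ L.re % 8 = 5 := by omega
  have c2 : L.im % 4 = 0 ∨ L.im % 4 = 2 := by omega
  have c3 : l.re % 8 = 1 ∨ l.re % 8 = 3 ∨ l.re % 8 = 5 ∨ l.re % 8 = 7 := by omega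
  have c4 : l.im % 4 = 0 ∨ l.im % 4 = 2 := by omega
  rw [show L.re % 4 = L.re % 8 % 4 by omega, show l.re % 4 = l.re % 8 % 4 by omega] at m2
  rcases c1 with c1 | c1 <;> rcases c2 with c2 | c2 <;> rcases c3 with c3 | c3 | c3 | c3 <;>
    rcases c4 with c4 | c4 <;> rw [c1, c2, c3, c4] at m1 m2 <;>
    refine ⟨by clear * - m1; omega, fun h => ?_⟩ <;>
    first | (clear * - m1 m2 h; omega) | omega

lemma re_conic (p : ℕ) (b c z : O) (x y : ℤ) :
    (be * b * ⟨x, y⟩ + c * ⟨x, -y⟩ - 2 * p * z).re =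
      b.re * (x - 2 * y) - 2 * (b.im * (x + y)) + c.re * x + 2 * (c.im * y) - 2 * (p * z.re) := by
  simp; ring

set_option maxHeartbeats 1000000 in
/-- The case in which `a` is prime to `bb`. -/
lemma no_mulR_of_not_dvd {p : ℕ} (hp : p.Prime) (h16 : p % 16 = 7) (hp3 : p % 3 = 2) {a b c z : O}
    (hcop : ∀ q, Prime q → q ∣ a → q ∣ z → False)
    (h1 : be ^ 2 * a ^ 2 - c ^ 2 = p * bb ^ 2 * z ^ 2) (h3 : a ^ 2 + b ^ 2 = -(p * z ^ 2))
    (ha : modBb a ≠ 0) : False := by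
  have h2 : (be * b) ^ 2 + c ^ 2 = 2 * p * z ^ 2 := by
    rw [be_eq] at *
    rw [bb_eq] at h1
    linear_combination -h1 + (1 + s) ^ 2 * h3 - 2 * p * z ^ 2 * s_sq
  have h5 : bb ^ 2 * b ^ 2 - c ^ 2 = 2 * a ^ 2 := by
    rw [be_eq] at *; rw [bb_eq] at *; linear_combination h1 + (1 - s) ^ 2 * h3 - 2 * a ^ 2 * s_sq
  have hpP : Prime (p : O) := prime_natCast hp (by omega)
  obtain ⟨w, hw, hwz, hwz'⟩ := exists_inverse_mod (mulR_odd (by omega) hcop h3 h5)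
  have hw0 : w ≠ 0 := by rintro rfl; simp at hw
  have hbb2 : modBb c ^ 2 = modBb a ^ 2 := by
    have := congrArg modBb h1
    simp only [map_sub, map_mul, map_pow, modBb_bb, modBb_be] at this
    linear_combination -this
  obtain ⟨c', hc', hca⟩ : ∃ c', (c' = c ∨ c' = -c) ∧ modBb c' = modBb a := by
    rcases sq_eq_sq_iff_eq_or_eq_neg.1 hbb2 with h | h
    · exact ⟨c, Or.inl rfl, h⟩
    · exact ⟨-c, Or.inr rfl, by rw [map_neg, h, neg_neg]⟩
  rw [← sq_eq_of_eq_or_neg hc'] at h1 h2 h5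
  clear hbb2 hc'
  clear c
  rename' c' => c
  have H1 : be ^ 2 * (w * a) ^ 2 - (w * c) ^ 2 = p * bb ^ 2 * (w * z) ^ 2 := by
    linear_combination w ^ 2 * h1
  have H3 : (w * a) ^ 2 + (w * b) ^ 2 = -(p * (w * z) ^ 2) := by
    linear_combination w ^ 2 * h3
  have H5 : bb ^ 2 * (w * b) ^ 2 - (w * c) ^ 2 = 2 * (w * a) ^ 2 := by
    linear_combination w ^ 2 * h5
  have hbz : ¬ be ∣ z := by
    intro hz
    have hbz := (modBe_eq_zero _).2 hz
    have m3 := congrArg modBe h3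
    simp only [map_neg, map_add, map_mul, map_pow, hbz, modBe_natCast hp3] at m3
    have ha0 : modBe a = 0 := by
      generalize modBe a = x at *
      generalize modBe b = y at *
      clear * - m3
      decide +revert
    exact hcop _ prime_be ((modBe_eq_zero _).1 ha0) hz
  have mb : modBb (be * a - c) = modBb a := by
    simp only [map_sub, map_mul, modBb_be, hca]
    generalize modBb a = x
    decide +revert
  have mz : modBb (bb * b - c) = -modBb a := by
    simp only [map_sub, map_mul, modBb_bb, hca]; ring
  have cb : ∃ σ, SignClass p σ (be * a - c) := by
    refine signClass_of (exists_class_two prime_s hpP (l' := be * a + c) (δ := p) (m := bb * z) ?_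
      (by linear_combination h1) ?_)
    · intro h; rw [h, map_zero] at mb; exact ha mb.symm
    · rintro q hq hl (h | hl')
      · exact Or.inr h
      have hz : q ∣ p * (bb * z) ^ 2 := by
        convert hl.mul_right (be * a + c) using 1; linear_combination -h1
      rcases hq.dvd_or_dvd hz with h | hz
      · exact Or.inr h
      have hqb : ¬ q ∣ bb := by
        intro h
        have := (dvd_of_prime_dvd hq prime_bb h).trans hl
        rw [← modBb_eq_zero, mb] at this
        exact ha this
      have hz := (hq.dvd_or_dvd (hq.dvd_of_dvd_pow hz)).resolve_left hqb
      have : q ∣ 2 * (be * a) := by convert dvd_add hl hl' using 1; ring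
      rcases hq.dvd_or_dvd this with h | h
      · exact Or.inl (dvd_s_of_dvd_two hq h)
      rcases hq.dvd_or_dvd h with h | h
      · exact (hbz ((dvd_of_prime_dvd hq prime_be h).trans hz)).elim
      · exact (hcop q hq h hz).elim
  have cz : ∃ σ, SignClass p σ (bb * b - c) := by
    refine signClass_of (exists_class_two prime_s hpP (l' := bb * b + c) (δ := -1) (m := s * a) ?_
      (by linear_combination h5 + a ^ 2 * s_sq) ?_)
    · intro h; rw [h, map_zero] at mz; exact ha (neg_eq_zero.1 mz.symm)
    · intro q hq hl hl'
      have hl' : q ∣ bb * b + c :=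
        hl'.resolve_left fun hu => hq.not_isUnit (isUnit_of_dvd_unit hu (by simp))
      have hqa : q ∣ (s * a) ^ 2 := by
        convert (dvd_neg (b := (bb * b - c) * (bb * b + c))).2 (hl.mul_right _) using 1
        linear_combination h5 + a ^ 2 * s_sq
      rcases hq.dvd_or_dvd (hq.dvd_of_dvd_pow hqa) with h | hqa
      · exact Or.inl h
      have : q ∣ 2 * (bb * b) := by convert dvd_add hl hl' using 1; ring
      rcases hq.dvd_or_dvd this with h | h
      · exact Or.inl (dvd_s_of_dvd_two hq h)
      rcases hq.dvd_or_dvd h with h | h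
      · have := (dvd_of_prime_dvd hq prime_bb h).trans hl
        rw [← modBb_eq_zero, mz] at this
        exact (ha (neg_eq_zero.1 this)).elim
      · have : q ∣ p * z ^ 2 := by
          rw [← dvd_neg, ← h3]
          exact dvd_add (dvd_pow hqa two_ne_zero) (dvd_pow h two_ne_zero)
        rcases hq.dvd_or_dvd this with h | h
        · exact Or.inr h
        · exact (hcop q hq hqa (hq.dvd_of_dvd_pow h)).elim
  obtain ⟨x, y, hx, hy, hxy⟩ := exists_conic_point hp h16
  obtain ⟨σb, cb⟩ := cb
  obtain ⟨σz, cz⟩ := cz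
  have ca : ∀ b', (b' = b ∨ b' = -b) → be * b' * ⟨x, y⟩ + c * ⟨x, -y⟩ - 2 * p * z ≠ 0 →
      ∃ σ, SignClass p σ (be * b' * ⟨x, y⟩ + c * ⟨x, -y⟩ - 2 * p * z) := by
    intro b' hb' h0
    refine signClass_conic hp (by omega) ?_ ?_ hxy h0
    · intro q hq hqb hqc hqz
      have h7 : q ∣ (be * a) ^ 2 := by
        rw [show (be * a) ^ 2 = c ^ 2 + p * bb ^ 2 * z ^ 2 by linear_combination h1]
        exact dvd_add (dvd_pow hqc two_ne_zero) ((dvd_pow hqz two_ne_zero).mul_left _)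
      rcases hq.dvd_or_dvd (hq.dvd_of_dvd_pow h7) with h | h
      · exact hbz ((dvd_of_prime_dvd hq prime_be h).trans hqz)
      · exact hcop q hq h hqz
    · rw [mul_pow, sq_eq_of_eq_or_neg hb', ← mul_pow, h2]
  have hp1 : p % 2 = 1 := by omega
  rcases mulR_types h16 hwz hwz' H1 H3 with ⟨t1, t2, t3, t4, t5, t6⟩ | ⟨t1, t2, t3, t4, t5⟩
  · obtain ⟨b', hb', hbc⟩ := exists_sign_add_mod_four w t3 t5
    have ht4 : (w * b').im % 4 = 0 := by
      rcases hb' with rfl | rfl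
      · exact t4
      · rw [mul_neg, im_neg]; omega
    obtain ⟨g1, g2⟩ := mulR_typeI_conic h16 hwz hwz' hx hy ht4 t6 hbc
    have e : be * (w * b') * ⟨x, y⟩ + w * c * ⟨x, -y⟩ - 2 * p * (w * z) =
      w * (be * b' * ⟨x, y⟩ + c * ⟨x, -y⟩ - 2 * p * z) := by ring
    obtain ⟨σ, cla⟩ := ca b' hb' (by
      intro h; rw [e, h] at g1; simp at g1)
    have o1 := OddNorm.one_of_two g1 g2
    have o2 : OddNorm 3 (be * (w * a) - w * c) := by
      apply OddNorm.of_odd_odd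
      · rw [show (be * (w * a) - w * c).re = (w * a).re - 2 * (w * a).im - (w * c).re by simp; ring]
        omega
      · rw [show (be * (w * a) - w * c).im = (w * a).re + (w * a).im - (w * c).im by simp; ring]
        omega
    exact ((OddNorm.sq hw0).mul ((cb.oddNorm hp1).mul (cla.oddNorm hp1))).false (o1.mul o2)
      (by ring)
  · obtain ⟨ha8, hai, hbi, hcr, hbc⟩ := mulR_typeII h16 hwz hwz' H3 H5 t1 t2 t3 t4 t5
    by_cases hb0 : (w * b).re % 8 = 0 ∧ (w * b).im % 8 = 0
    · obtain ⟨b1, b2⟩ := hb0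
      have e : be * (w * b) * ⟨x, y⟩ + w * c * ⟨x, -y⟩ - 2 * p * (w * z) =
        w * (be * b * ⟨x, y⟩ + c * ⟨x, -y⟩ - 2 * p * z) := by ring
      obtain ⟨l, hl⟩ := exists_eq_s_mul (l := be * b * ⟨x, y⟩ + c * ⟨x, -y⟩ - 2 * p * z) hw (by
        rw [← e, re_conic]
        obtain ⟨k, hk⟩ : ∃ k, (w * b).re = 2 * k := ⟨(w * b).re / 2, by omega⟩
        obtain ⟨m, hm⟩ : ∃ k, (w * c).re = 2 * k := ⟨(w * c).re / 2, by omega⟩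
        rw [hk, hm]
        ring_nf
        omega)
      obtain ⟨g1, g2⟩ := mulR_typeII_conic (l := w * l) h16 hwz hwz' hx hy b1 b2 hcr (by omega)
        (by rw [e, hl]; ring)
      have hl0 : s * l ≠ 0 := by
        intro h
        rw [(mul_eq_zero.1 h).resolve_left prime_s.ne_zero] at g1
        simp at g1
      rw [← hl] at hl0
      obtain ⟨σ, cla⟩ := ca b (Or.inl rfl) hl0
      rw [hl] at cla
      have u1 := (cla.of_mul_s hp1).re_of_mul (w := w) (by omega) hp3 (by omega) g2
      have r1 : (w * (be * a - c)).re = (w * a).re - 2 * (w * a).im - (w * c).re := by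
        rw [show w * (be * a - c) = be * (w * a) - w * c by ring]
        generalize w * a = A
        generalize w * c = C
        simp; ring
      have r2 : (w * (be * a - c)).im = (w * a).re + (w * a).im - (w * c).im := by
        rw [show w * (be * a - c) = be * (w * a) - w * c by ring]
        generalize w * a = A
        generalize w * c = C
        simp; ring
      have u2 := cb.re_of_mul (w := w) (by omega) hp3 (by omega) (by omega)
      omega
    · obtain ⟨l, hl⟩ := exists_eq_s_mul (l := bb * b - c) hw (by
        rw [show w * (bb * b - c) = bb * (w * b) - w * c by ring]
        rw [show (bb * (w * b) - w * c).re = (w * b).re + 2 * (w * b).im - (w * c).re by simp]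
        omega)
      have mz' := cz.modBb_eq (by rw [mz]; exact neg_ne_zero.2 ha)
      obtain ⟨q1, q2⟩ := mulR_typeII_mul (a := w * a) (b := w * b) (c := w * c) (l := w * l)
        ha8 hai hbi hcr (by omega) (by linear_combination -w * hl)
      rw [hl] at cz
      have cc := (cb.mul hp.ne_zero hp3 (cz.of_mul_s hp1)).mul_sq hw0
      rw [show w ^ 2 * ((be * a - c) * l) = (be * (w * a) - w * c) * (w * l) by ring] at cc
      rcases cc.two_adic (by omega) hp3 q1 with ⟨h, -⟩ | ⟨-, h⟩
      · rw [← cb.modBb_eq (by rw [mb]; exact ha), ← mz', mb, mz] at h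
        generalize modBb a = x at *
        clear * - ha h
        revert x
        decide
      · exact q2 h

lemma SignClass.of_mul_bb_sq {p : ℕ} {σ : ZMod 3} {x : O} (h : SignClass p σ (bb ^ 2 * x))
    (hp3 : p % 3 = 2) : SignClass p σ x := by
  obtain ⟨e, i, j, t, h1, h2, h3, h4, h5, h6⟩ := h
  have hi : modBb i = 1 := by rcases h2 with rfl | rfl <;> simp [modBb_s]
  have hej : modBb (e * j) ≠ 0 := by
    rw [map_mul]
    rcases h1 with rfl | rfl <;> rcases h3 with rfl | rfl <;>
      simp [modBb_natCast hp3]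
  have ht : bb ∣ t := by
    have := congrArg modBb h4
    rw [← modBb_eq_zero]
    rw [show modBb (e * i * j * t ^ 2) = modBb (e * j) * modBb i * modBb t ^ 2 by
      simp only [map_mul, map_pow]; ring, hi, map_mul, map_pow, modBb_bb] at this
    have := (mul_eq_zero.1
      (by linear_combination -this : modBb (e * j) * modBb t ^ 2 = 0)).resolve_left hej
    exact pow_eq_zero_iff two_ne_zero |>.1 this
  obtain ⟨t, rfl⟩ := ht
  refine ⟨e, i, j, t, h1, h2, h3, ?_, right_ne_zero_of_mul h5, h6⟩
  exact mul_left_cancel₀ (pow_ne_zero 2 prime_bb.ne_zero) (by linear_combination h4)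

lemma SignClass.eq_of_neg_sq {p : ℕ} {σ : ZMod 3} {m : O} (h : SignClass p σ (-m ^ 2))
    (hp3 : p % 3 = 2) (hm : m ≠ 0) : σ = -1 := by
  obtain ⟨n, m, hbm, rfl⟩ := WfDvdMonoid.max_power_factor hm prime_bb.irreducible
  clear hm
  induction n with
  | zero =>
    rw [bb_not_dvd] at hbm
    have h0 : modBb (-(bb ^ 0 * m) ^ 2) = -1 := by
      simp only [pow_zero, one_mul, map_neg, map_pow]
      generalize modBb m = x at *
      revert x
      decide
    rw [← h.modBb_eq (by rw [h0]; decide), h0]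
  | succ n ih =>
    refine ih (SignClass.of_mul_bb_sq (x := -(bb ^ n * m) ^ 2) ?_ hp3)
    convert h using 1
    ring

lemma mulR'_odd {p : ℕ} (h8 : p % 8 = 7) {a b c z : O}
    (hcop : ∀ q, Prime q → q ∣ a → q ∣ z → False)
    (h3 : bb ^ 2 * a ^ 2 + b ^ 2 = -(p * z ^ 2)) (h5 : b ^ 2 - c ^ 2 = 2 * a ^ 2) :
    z.re % 2 = 1 := by
  by_contra hz
  replace hz : z.re % 2 = 0 := by omega
  have ha : a.re % 2 = 1 := by
    by_contra ha
    exact hcop s prime_s ((s_dvd_iff a).2 (by omega)) ((s_dvd_iff z).2 (by omega))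
  have e1 := congrArg Zsqrtd.re h3
  have e2 := congrArg Zsqrtd.im h3
  have e3 := congrArg Zsqrtd.re h5
  have e4 := congrArg Zsqrtd.im h5
  rw [show bb ^ 2 = (⟨-1, -2⟩ : O) by decide] at e1 e2
  simp at e1 e2 e3 e4
  have k1 := natCast_mul_emod_eight h8 (z ^ 2).re
  have k2 := natCast_mul_emod_eight h8 (z ^ 2).im
  generalize (p : ℤ) * (z ^ 2).re = P1 at *
  generalize (p : ℤ) * (z ^ 2).im = P2 at *
  have a1 := re_sq_mod_two a
  have b1 := re_sq_mod_two b
  have c1 := re_sq_mod_two c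
  have hz' := even_sq_mod_eight hz
  have hb : b.re % 2 = 1 := by omega
  have hc : c.re % 2 = 1 := by omega
  have ha' := sq_mod_eight ha
  have hb' := sq_mod_eight hb
  have hc' := sq_mod_eight hc
  clear a1 b1 c1
  rcases ha' with ha' | ha' | ha' <;> rcases hb' with hb' | hb' | hb' <;>
      rcases hc' with hc' | hc' | hc' <;> omega

set_option maxHeartbeats 4000000 in
lemma mulR'_types {p : ℕ} (h16 : p % 16 = 7) {a b c z : O}
    (hz : z.re % 16 = 1) (hz' : z.im % 16 = 0)
    (h1 : be ^ 2 * a ^ 2 - c ^ 2 = p * z ^ 2) (h3 : bb ^ 2 * a ^ 2 + b ^ 2 = -(p * z ^ 2)) :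
    (a.re % 4 = 0 ∧ a.im % 2 = 0 ∧ b.re % 2 = 1 ∧ b.im % 4 = 0 ∧ c.re % 2 = 1 ∧ c.im % 4 = 0) ∨
    (a.re % 2 = 1 ∧ a.im % 2 = 1 ∧ b.re % 4 = 0 ∧ b.im % 2 = 0 ∧ c.re % 4 = 2 ∧ c.im % 2 = 1) := by
  obtain ⟨k1, k2⟩ := one_sq_mod h16 hz hz'
  have e1 := congrArg Zsqrtd.re h1
  have e2 := congrArg Zsqrtd.im h1
  have e5 := congrArg Zsqrtd.re h3
  have e6 := congrArg Zsqrtd.im h3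
  rw [show be ^ 2 = (⟨-1, 2⟩ : O) by decide] at e1 e2
  rw [show bb ^ 2 = (⟨-1, -2⟩ : O) by decide] at e5 e6
  simp at e1 e2 e5 e6
  ring_nf at e1 e2 e5 e6
  generalize (p : ℤ) * (z ^ 2).re = P1 at *
  generalize (p : ℤ) * (z ^ 2).im = P2 at *
  have a1 := re_sq_mod_two a
  have b1 := re_sq_mod_two b
  have c1 := re_sq_mod_two c
  rcases Int.emod_two_eq_zero_or_one a.re with ha | ha
  swap
  · have ha' := sq_mod_eight ha
    have hb : b.re % 2 = 0 := by omega
    have hc : c.re % 2 = 0 := by omega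
    have hb' := even_sq_mod_eight hb
    have hc' := even_sq_mod_eight hc
    clear a1 b1 c1
    rcases ha' with ha' | ha' | ha' <;> rcases hb' with hb' | hb' | hb' | hb' <;>
      rcases hc' with hc' | hc' | hc' | hc' <;> omega
  · have ha' := even_sq_mod_eight ha
    have hb : b.re % 2 = 1 := by omega
    have hc : c.re % 2 = 1 := by omega
    have hb' := sq_mod_eight hb
    have hc' := sq_mod_eight hc
    clear a1 b1 c1
    rcases ha' with ha' | ha' | ha' | ha' <;> rcases hb' with hb' | hb' | hb' <;>
      rcases hc' with hc' | hc' | hc' <;> omega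

lemma mulR'_typeII_conic {p : ℕ} {b c z : O} {x y : ℤ} (h16 : p % 16 = 7)
    (hz : z.re % 16 = 1) (hx : x % 8 = 3 ∨ x % 8 = 5) (hy : y % 2 = 1)
    (hb : b.re % 4 = 0) (hb' : b.im % 2 = 0) (hc : c.re % 4 = 2) (hc' : c.im % 2 = 1) :
    (be * b * ⟨x, y⟩ + bb * c * ⟨x, -y⟩ - 2 * p * z).re % 4 = 0 ∧
      (be * b * ⟨x, y⟩ + bb * c * ⟨x, -y⟩ - 2 * p * z).im % 2 = 1 := by
  obtain ⟨b, b'⟩ := b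
  obtain ⟨c, c'⟩ := c
  obtain ⟨z, z'⟩ := z
  simp only at *
  obtain ⟨b, rfl⟩ : ∃ t, b = 4 * t := ⟨b / 4, by omega⟩
  obtain ⟨b', rfl⟩ : ∃ t, b' = 2 * t := ⟨b' / 2, by omega⟩
  obtain ⟨c, rfl⟩ : ∃ t, c = 4 * t + 2 := ⟨c / 4, by omega⟩
  obtain ⟨c', rfl⟩ : ∃ t, c' = 2 * t + 1 := ⟨c' / 2, by omega⟩
  obtain ⟨z, rfl⟩ : ∃ t, z = 16 * t + 1 := ⟨z / 16, by omega⟩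
  obtain ⟨r, hr⟩ : ∃ r : ℤ, (p : ℤ) = 16 * r + 7 := ⟨p / 16, by omega⟩
  obtain ⟨y, rfl⟩ : ∃ t, y = 2 * t + 1 := ⟨y / 2, by omega⟩
  obtain ⟨x, rfl⟩ : ∃ t, x = 2 * t + 1 := ⟨x / 2, by omega⟩
  simp [hr]
  ring_nf
  omega

lemma emod_of_add_emod_four {a b c : O} (h5 : b ^ 2 - c ^ 2 = 2 * a ^ 2) (ha : a.re % 4 = 0)
    (ha' : a.im % 2 = 0) (hc : c.re % 2 = 1) (hc' : c.im % 4 = 0) (hb' : b.im % 4 = 0)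
    (hbc : (b.re + c.re) % 4 = 0) :
    (b.im + c.im) % 16 = 0 ∧
      ((b.re + c.re) % 16 = 0 ∧ a.im % 4 = 0 ∨ (b.re + c.re) % 16 = 8 ∧ a.im % 4 = 2) := by
  have sr : ∀ x : O, (x ^ 2).re = x.re ^ 2 - 2 * x.im ^ 2 := by intro x; simp [pow_two]; ring
  have si : ∀ x : O, (x ^ 2).im = 2 * (x.re * x.im) := by intro x; simp [pow_two]; ring
  have e3 := congrArg Zsqrtd.re h5
  have e4 := congrArg Zsqrtd.im h5
  simp at e3 e4
  simp only [sr, si] at e3 e4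
  obtain ⟨a, a'⟩ := a
  obtain ⟨b, b'⟩ := b
  obtain ⟨c, c'⟩ := c
  simp only at *
  obtain ⟨a, rfl⟩ : ∃ t, a = 4 * t := ⟨a / 4, by omega⟩
  obtain ⟨a', rfl⟩ : ∃ t, a' = 2 * t := ⟨a' / 2, by omega⟩
  obtain ⟨k, rfl⟩ : ∃ t, b = 4 * t - c := ⟨(b + c) / 4, by omega⟩
  obtain ⟨k', rfl⟩ : ∃ t, b' = 4 * t - c' := ⟨(b' + c') / 4, by omega⟩
  obtain ⟨c', rfl⟩ : ∃ t, c' = 4 * t := ⟨c' / 4, by omega⟩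
  have g1 : c * k = 2 * (k ^ 2 + 4 * c' * k' - 2 * k' ^ 2 - 2 * a ^ 2 + a' ^ 2) := by linarith
  have hk : k % 2 ^ 1 = 0 := emod_two_pow_of_odd_mul 1 hc (by omega)
  obtain ⟨k, rfl⟩ : ∃ t, k = 2 * t := ⟨k / 2, by omega⟩
  have g2 : c * k' = 4 * (2 * k * k' - 2 * k * c' - a * a') := by linarith
  have hk' : k' % 2 ^ 2 = 0 := emod_two_pow_of_odd_mul 2 hc (by omega)
  obtain ⟨c, rfl⟩ : ∃ t, c = 2 * t + 1 := ⟨c / 2, by omega⟩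
  have g3 : k = 2 * (-c * k + 2 * k ^ 2 + 2 * c' * k' - k' ^ 2 - a ^ 2) + a' ^ 2 := by linarith
  have g4 : a' ^ 2 % 2 = a' % 2 := by
    obtain ⟨r, rfl | rfl⟩ : ∃ r, a' = 2 * r ∨ a' = 2 * r + 1 := ⟨a' / 2, by omega⟩
    · have : (2 * r) ^ 2 = 2 * (2 * r ^ 2) := by ring
      omega
    · have : (2 * r + 1) ^ 2 = 2 * (2 * r ^ 2 + 2 * r) + 1 := by ring
      omega
  omega

/-- Refinement of the first case of `mulR'_types`. -/
lemma mulR'_typeI {a b c l : O} (h5 : b ^ 2 - c ^ 2 = 2 * a ^ 2) (ha : a.re % 4 = 0)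
    (ha' : a.im % 2 = 0) (hc : c.re % 2 = 1) (hc' : c.im % 4 = 0) (hb' : b.im % 4 = 0)
    (hbc : (b.re + c.re) % 4 = 0) (hl : 2 * l = c - b) :
    ((be * a - c) * l).re % 2 = 1 ∧
      (((be * a - c) * l).re % 8 = 7 ∧ ((be * a - c) * l).im % 4 = 0 ∨
        ((be * a - c) * l).re % 8 = 1 ∧ ((be * a - c) * l).im % 4 = 2 →
        a.re % 8 = 0 ∧ a.im % 4 = 0 ∧ (b.re + c.re) % 16 = 0 ∧ (b.im + c.im) % 16 = 0) := by
  obtain ⟨f1, f2⟩ := emod_of_add_emod_four h5 ha ha' hc hc' hb' hbc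
  have e1 := congrArg Zsqrtd.re hl
  have e2 := congrArg Zsqrtd.im hl
  simp at e1 e2
  have r1 : (be * a - c).re = a.re - 2 * a.im - c.re := by simp; ring
  have r2 : (be * a - c).im = a.re + a.im - c.im := by simp; ring
  have m1 := re_mul_emod_eight (be * a - c) l
  have m2 := im_mul_emod_four (be * a - c) l
  generalize (be * a - c) * l = P at *
  generalize be * a - c = L at *
  have c1 : L.re % 8 = 1 ∨ L.re % 8 = 3 ∨ L.re % 8 = 5 ∨ L.re % 8 = 7 := by omega
  have c2 : L.im % 4 = 0 ∨ L.im % 4 = 2 := by omega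
  have c3 : l.re % 8 = 1 ∨ l.re % 8 = 3 ∨ l.re % 8 = 5 ∨ l.re % 8 = 7 := by omega
  have c4 : l.im % 4 = 0 ∨ l.im % 4 = 2 := by omega
  rw [show L.re % 4 = L.re % 8 % 4 by omega, show l.re % 4 = l.re % 8 % 4 by omega] at m2
  clear h5 hl
  rcases c1 with c1 | c1 | c1 | c1 <;> rcases c2 with c2 | c2 <;>
    rcases c3 with c3 | c3 | c3 | c3 <;>
    rcases c4 with c4 | c4 <;> rw [c1, c2, c3, c4] at m1 m2 <;>
    refine ⟨by clear * - m1; omega, fun h => ?_⟩ <;>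
    first | (exfalso; clear * - m1 m2 h; omega) | omega

lemma mulR'_typeI_re {p : ℕ} {a c z : O} (h16 : p % 16 = 7)
    (hz : z.re % 16 = 1) (hz' : z.im % 16 = 0) (h1 : be ^ 2 * a ^ 2 - c ^ 2 = p * z ^ 2)
    (ha : a.re % 8 = 0) (ha' : a.im % 4 = 0) (hc : c.re % 2 = 1) (hc' : c.im % 4 = 0) :
    c.re % 8 = 3 ∨ c.re % 8 = 5 := by
  obtain ⟨k1, -⟩ := one_sq_mod h16 hz hz'
  have sr : ∀ x : O, (x ^ 2).re = x.re ^ 2 - 2 * x.im ^ 2 := by intro x; simp [pow_two]; ring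
  have si : ∀ x : O, (x ^ 2).im = 2 * (x.re * x.im) := by intro x; simp [pow_two]; ring
  have e1 := congrArg Zsqrtd.re h1
  rw [show be ^ 2 = (⟨-1, 2⟩ : O) by decide] at e1
  simp at e1
  generalize (p : ℤ) * (z ^ 2).re = P1 at *
  simp only [sr, si] at e1
  have h := odd_sq_mod_sixteen hc
  obtain ⟨x, hx⟩ : ∃ t, a.re = 8 * t := ⟨a.re / 8, by omega⟩
  obtain ⟨y, hy⟩ : ∃ t, a.im = 4 * t := ⟨a.im / 4, by omega⟩
  obtain ⟨t, ht⟩ : ∃ t, c.im = 4 * t := ⟨c.im / 4, by omega⟩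
  rw [hx, hy, ht] at e1
  generalize c.re ^ 2 = C at *
  ring_nf at e1
  omega

lemma mulR'_typeI_conic {p : ℕ} {b c z l : O} {x y : ℤ} (h16 : p % 16 = 7)
    (hz : z.re % 16 = 1) (hz' : z.im % 16 = 0) (hx : x % 8 = 3 ∨ x % 8 = 5) (hy : y % 2 = 1)
    (hbc : (b.re + c.re) % 16 = 0) (hbc' : (b.im + c.im) % 16 = 0) (hc' : c.im % 4 = 0)
    (hl : -2 * l = be * b * ⟨x, y⟩ + bb * c * ⟨x, -y⟩ - 2 * p * z) :
    l.re % 8 = 7 ∧ l.im % 2 = 0 := by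
  have e1 := congrArg Zsqrtd.re hl
  have e2 := congrArg Zsqrtd.im hl
  obtain ⟨b, b'⟩ := b
  obtain ⟨c, c'⟩ := c
  obtain ⟨z, z'⟩ := z
  simp only at *
  obtain ⟨b, rfl⟩ : ∃ t, b = 16 * t - c := ⟨(b + c) / 16, by omega⟩
  obtain ⟨b', rfl⟩ : ∃ t, b' = 16 * t - c' := ⟨(b' + c') / 16, by omega⟩
  obtain ⟨c', rfl⟩ : ∃ t, c' = 4 * t := ⟨c' / 4, by omega⟩
  obtain ⟨z, rfl⟩ : ∃ t, z = 16 * t + 1 := ⟨z / 16, by omega⟩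
  obtain ⟨z', rfl⟩ : ∃ t, z' = 16 * t := ⟨z' / 16, by omega⟩
  obtain ⟨r, hr⟩ : ∃ r : ℤ, (p : ℤ) = 16 * r + 7 := ⟨p / 16, by omega⟩
  obtain ⟨y, rfl⟩ : ∃ t, y = 2 * t + 1 := ⟨y / 2, by omega⟩
  obtain ⟨x, rfl⟩ : ∃ t, x = 2 * t + 1 := ⟨x / 2, by omega⟩
  simp [hr] at e1 e2
  ring_nf at e1 e2
  omega

lemma exists_eq_two_mul {w l : O} (hw : w.re % 2 = 1) (h : (w * l).re % 2 = 0)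
    (h' : (w * l).im % 2 = 0) : ∃ x, l = 2 * x := by
  obtain ⟨x, rfl⟩ := exists_eq_s_mul hw h
  obtain ⟨y, rfl⟩ := exists_eq_s_mul (l := x) hw (by
    rw [mul_left_comm] at h'
    generalize w * x = X at *
    simpa using h')
  exact ⟨-y, by linear_combination y * s_sq⟩

lemma re_conic' (p : ℕ) (b c z : O) (x y : ℤ) :
    (be * b * ⟨x, y⟩ + bb * c * ⟨x, -y⟩ - 2 * p * z).re =
      (b.re + c.re) * x - 2 * (b.re * y) - 2 * (c.re * y) - 2 * (b.im * (x + y)) +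
        2 * (c.im * (x + y)) - 2 * (p * z.re) := by
  simp; ring

lemma im_conic' (p : ℕ) (b c z : O) (x y : ℤ) :
    (be * b * ⟨x, y⟩ + bb * c * ⟨x, -y⟩ - 2 * p * z).im =
      (b.im + c.im) * (x - 2 * y) + (b.re + c.re) * (x + y) - 2 * (c.re * (x + y))
        - 2 * (p * z.im) := by
  simp; ring

set_option maxHeartbeats 1000000 in
theorem no_mulR_of_dvd {p : ℕ} (hp : p.Prime) (h16 : p % 16 = 7) (hp3 : p % 3 = 2) {a b c z : O}
    (hcop : ∀ q, Prime q → q ∣ a → q ∣ z → False) (hbbz : ¬ bb ∣ z)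
    (h1 : be ^ 2 * a ^ 2 - c ^ 2 = p * z ^ 2)
    (h3 : bb ^ 2 * a ^ 2 + b ^ 2 = -(p * z ^ 2)) : False := by
  have hpP := prime_natCast hp (by omega : p % 8 = 7)
  have hbe : be ^ 2 + bb ^ 2 = (-2 : O) := by decide
  have h5 : b ^ 2 - c ^ 2 = 2 * a ^ 2 := by linear_combination h3 + h1 - a ^ 2 * hbe
  have h2 : (be * b) ^ 2 + (bb * c) ^ 2 = 2 * p * z ^ 2 := by
    linear_combination be ^ 2 * h3 - bb ^ 2 * h1
      - p * z ^ 2 * hbe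
  have hz := mulR'_odd (by omega) hcop h3 h5
  obtain ⟨w, hw, hwz, hwz'⟩ := exists_inverse_mod hz
  have hw0 : w ≠ 0 := by rintro rfl; simp at hw
  rw [bb_not_dvd] at hbbz
  have hma : modBb a = 0 ∧ modBb c ≠ 0 ∧ (modBb b) ^ 2 = (modBb c) ^ 2 := by
    have m1 := congrArg modBb h1
    have m3 := congrArg modBb h3
    simp only [map_sub, map_add, map_neg, map_mul, map_pow, modBb_be, modBb_bb,
      modBb_natCast hp3] at m1 m3
    generalize modBb a = x at *
    generalize modBb b = y at *
    generalize modBb c = u at *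
    generalize modBb z = v at *
    clear * - m1 m3 hbbz
    revert x y u v
    decide
  obtain ⟨hma, hmc, hmb⟩ := hma
  have hbz : ¬ be ∣ z := by
    intro hz
    have hbz := (modBe_eq_zero _).2 hz
    have m3 := congrArg modBe h3
    simp only [map_neg, map_add, map_mul, map_pow, hbz, modBe_bb, modBe_natCast hp3] at m3
    have ha0 : modBe a = 0 := by
      generalize modBe a = x at *
      generalize modBe b = y at *
      clear * - m3
      decide +revert
    exact hcop _ prime_be ((modBe_eq_zero _).1 ha0) hz
  have ha0 : a ≠ 0 := by
    rintro rfl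
    have hz0 := eq_zero_of_odd_eq_even (q := (p : O)) (u := 1) (w := -1) hpP
      (fun h => hpP.not_isUnit (isUnit_of_dvd_unit h isUnit_one))
      (fun h => hpP.not_isUnit (isUnit_of_dvd_unit h (by simp))) z c (by linear_combination -h1)
    exact hcop s prime_s (dvd_zero s) (hz0 ▸ dvd_zero s)
  have H1 : be ^ 2 * (w * a) ^ 2 - (w * c) ^ 2 = p * (w * z) ^ 2 := by
    linear_combination w ^ 2 * h1
  have H3 : bb ^ 2 * (w * a) ^ 2 + (w * b) ^ 2 = -(p * (w * z) ^ 2) := by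
    linear_combination w ^ 2 * h3
  have mb : modBb (be * a - c) = -modBb c := by
    simp only [map_sub, map_mul, hma]; ring
  have cb : ∃ σ, SignClass p σ (be * a - c) := by
    refine signClass_of (exists_class_two prime_s hpP (l' := be * a + c) (δ := p) (m := z) ?_
      (by linear_combination h1) ?_)
    · intro h; rw [h, map_zero] at mb; exact hmc (neg_eq_zero.1 mb.symm)
    · rintro q hq hl (h | hl')
      · exact Or.inr h
      have hz : q ∣ p * z ^ 2 := by
        convert hl.mul_right (be * a + c) using 1; linear_combination -h1
      rcases hq.dvd_or_dvd hz with h | hz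
      · exact Or.inr h
      have hz := hq.dvd_of_dvd_pow hz
      have : q ∣ 2 * (be * a) := by convert dvd_add hl hl' using 1; ring
      rcases hq.dvd_or_dvd this with h | h
      · exact Or.inl (dvd_s_of_dvd_two hq h)
      rcases hq.dvd_or_dvd h with h | h
      · exact (hbz ((dvd_of_prime_dvd hq prime_be h).trans hz)).elim
      · exact (hcop q hq h hz).elim
  have cz : ∀ b', (b' = b ∨ b' = -b) →
      (∃ σ, SignClass p σ (b' - c)) ∧ (∃ σ, SignClass p σ (b' + c)) := by
    intro b' hb'
    have hb2 := sq_eq_of_eq_or_neg hb'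
    have hm : (b' - c) * (b' + c) = -1 * (s * a) ^ 2 := by
      linear_combination h5 + hb2 + a ^ 2 * s_sq
    have hm0 : (b' - c) * (b' + c) ≠ 0 := by
      rw [hm]
      exact mul_ne_zero (by decide) (pow_ne_zero _ (mul_ne_zero prime_s.ne_zero ha0))
    have key : ∀ q, Prime q → q ∣ b' - c → q ∣ b' + c → q ∣ s ∨ q ∣ (p : O) := by
      intro q hq hl hl'
      have hqa : q ∣ (s * a) ^ 2 := by
        have := hl.mul_right (b' + c)
        rw [hm, neg_one_mul, dvd_neg] at this
        exact this
      rcases hq.dvd_or_dvd (hq.dvd_of_dvd_pow hqa) with h | hqa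
      · exact Or.inl h
      have : q ∣ 2 * b' := by convert dvd_add hl hl' using 1; ring
      rcases hq.dvd_or_dvd this with h | h
      · exact Or.inl (dvd_s_of_dvd_two hq h)
      · have : q ∣ p * z ^ 2 := by
          rw [← dvd_neg, ← h3, ← hb2]
          exact dvd_add ((dvd_pow hqa two_ne_zero).mul_left _) (dvd_pow h two_ne_zero)
        rcases hq.dvd_or_dvd this with h | h
        · exact Or.inr h
        · exact (hcop q hq hqa (hq.dvd_of_dvd_pow h)).elim
    have unit : ∀ q : O, Prime q → ¬ q ∣ -1 :=
      fun q hq hu => hq.not_isUnit (isUnit_of_dvd_unit hu (by simp))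
    exact ⟨signClass_of (exists_class_two prime_s hpP (left_ne_zero_of_mul hm0) hm
        fun q hq hl hl' => key q hq hl (hl'.resolve_left (unit q hq))),
      signClass_of (exists_class_two prime_s hpP (right_ne_zero_of_mul hm0)
        ((mul_comm _ _).trans hm)
        fun q hq hl hl' => key q hq (hl'.resolve_left (unit q hq)) hl)⟩
  have cz' : ∀ b', (b' = b ∨ b' = -b) → SignClass p (modBb c) (b' - c) := by
    intro b' hb'
    obtain ⟨⟨σ, k1⟩, ⟨σ', k2⟩⟩ := cz b' hb'
    have hb2 := sq_eq_of_eq_or_neg hb'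
    have hm : (b' - c) * (b' + c) = -(s * a) ^ 2 := by
      linear_combination h5 + hb2 + a ^ 2 * s_sq
    have k3 := k1.mul hp.ne_zero hp3 k2
    rw [hm] at k3
    have k4 := k3.eq_of_neg_sq hp3 (mul_ne_zero prime_s.ne_zero ha0)
    have hb3 : modBb b' ^ 2 = modBb c ^ 2 := by rw [← map_pow, hb2, map_pow, hmb]
    suffices σ = modBb c from this ▸ k1
    have k5 := k1.modBb_eq
    have k6 := k2.modBb_eq
    simp only [map_sub, map_add] at k5 k6
    generalize modBb b' = x at *
    generalize modBb c = y at *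
    clear * - k4 k5 k6 hb3 hmc
    revert x y σ σ'
    decide
  obtain ⟨x, y, hx, hy, hxy⟩ := exists_conic_point hp h16
  obtain ⟨σb, cb⟩ := cb
  have hσb := cb.modBb_eq (by rw [mb]; exact neg_ne_zero.2 hmc)
  have ca : ∀ b', (b' = b ∨ b' = -b) → be * b' * ⟨x, y⟩ + bb * c * ⟨x, -y⟩ - 2 * p * z ≠ 0 →
      ∃ σ, SignClass p σ (be * b' * ⟨x, y⟩ + bb * c * ⟨x, -y⟩ - 2 * p * z) := by
    intro b' hb' h0
    refine signClass_conic hp (by omega) ?_ ?_ hxy h0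
    · intro q hq hqb hqc hqz
      rcases hq.dvd_or_dvd hqc with h | h
      · have := (dvd_of_prime_dvd hq prime_bb h).trans hqz
        rw [← modBb_eq_zero] at this
        exact hbbz this
      have h7 : q ∣ (be * a) ^ 2 := by
        rw [show (be * a) ^ 2 = c ^ 2 + p * z ^ 2 by linear_combination h1]
        exact dvd_add (dvd_pow h two_ne_zero) ((dvd_pow hqz two_ne_zero).mul_left _)
      rcases hq.dvd_or_dvd (hq.dvd_of_dvd_pow h7) with h | h
      · exact hbz ((dvd_of_prime_dvd hq prime_be h).trans hqz)
      · exact hcop q hq h hqz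
    · rw [mul_pow, sq_eq_of_eq_or_neg hb', ← mul_pow, h2]
  have hp1 : p % 2 = 1 := by omega
  have r1 : (w * (be * a - c)).re = (w * a).re - 2 * (w * a).im - (w * c).re := by
    rw [show w * (be * a - c) = be * (w * a) - w * c by ring]
    generalize w * a = A
    generalize w * c = C
    simp; ring
  have r2 : (w * (be * a - c)).im = (w * a).re + (w * a).im - (w * c).im := by
    rw [show w * (be * a - c) = be * (w * a) - w * c by ring]
    generalize w * a = A
    generalize w * c = C
    simp; ring
  have e : ∀ b', be * (w * b') * ⟨x, y⟩ + bb * (w * c) * ⟨x, -y⟩ - 2 * p * (w * z) =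
      w * (be * b' * ⟨x, y⟩ + bb * c * ⟨x, -y⟩ - 2 * p * z) := by intro b'; ring
  rcases mulR'_types h16 hwz hwz' H1 H3 with ⟨t1, t2, t3, t4, t5, t6⟩ | ⟨t1, t2, t3, t4, t5, t6⟩
  · obtain ⟨b', hb', hbc⟩ := exists_sign_add_mod_four w t3 t5
    have ht4 : (w * b').im % 4 = 0 := by
      rcases hb' with rfl | rfl
      · exact t4
      · rw [mul_neg, im_neg]; omega
    have H5 : (w * b') ^ 2 - (w * c) ^ 2 = 2 * (w * a) ^ 2 := by
      linear_combination w ^ 2 * h5 + w ^ 2 * sq_eq_of_eq_or_neg hb'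
    have f1 := emod_of_add_emod_four H5 t1 t2 t5 t6 ht4 hbc
    obtain ⟨l, hl⟩ := exists_eq_two_mul (l := c - b') hw
      (by rw [mul_sub, re_sub]; omega) (by rw [mul_sub, im_sub]; omega)
    obtain ⟨g1, g2⟩ := mulR'_typeI (l := w * l) H5 t1 t2 t5 t6 ht4 hbc
      (by linear_combination -w * hl)
    have k1 := cz' b' hb'
    rw [show b' - c = s ^ 2 * l by linear_combination -hl - l * s_sq] at k1
    have cc := (cb.mul hp.ne_zero hp3 (k1.of_mul_s_sq hp1)).mul_sq hw0
    rw [show w ^ 2 * ((be * a - c) * l) = (be * (w * a) - w * c) * (w * l) by ring] at cc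
    rcases cc.two_adic (by omega) hp3 g1 with ⟨h, -⟩ | ⟨-, h⟩
    · rw [← hσb, mb] at h
      generalize modBb c = x at *
      clear * - hmc h
      revert x
      decide
    obtain ⟨f2, f3, f4, f5⟩ := g2 h
    have f6 := mulR'_typeI_re h16 hwz hwz' H1 f2 f3 t5 t6
    have u1 := cb.re_of_mul (w := w) (by omega) hp3 (by omega) (by omega)
    obtain ⟨m, hm⟩ := exists_eq_two_mul
      (l := be * b' * ⟨x, y⟩ + bb * c * ⟨x, -y⟩ - 2 * p * z) hw
      (by
        rw [← e, re_conic']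
        obtain ⟨k, hk⟩ : ∃ k, (w * b').re + (w * c).re = 2 * k :=
          ⟨((w * b').re + (w * c).re) / 2, by omega⟩
        rw [hk]
        ring_nf
        omega)
      (by
        rw [← e, im_conic']
        obtain ⟨k, hk⟩ : ∃ k, (w * b').re + (w * c).re = 2 * k :=
          ⟨((w * b').re + (w * c).re) / 2, by omega⟩
        obtain ⟨k', hk'⟩ : ∃ k, (w * b').im + (w * c).im = 2 * k :=
          ⟨((w * b').im + (w * c).im) / 2, by omega⟩
        rw [hk, hk']
        ring_nf
        omega)
    obtain ⟨v1, v2⟩ := mulR'_typeI_conic (l := w * (-m)) h16 hwz hwz' hx hy f4 f5 t6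
      (by rw [e, hm]; ring)
    have hm0 : 2 * m ≠ 0 := by
      intro h
      rw [(mul_eq_zero.1 h).resolve_left (by decide)] at v1
      simp at v1
    obtain ⟨σ, cla⟩ := ca b' hb' (hm ▸ hm0)
    rw [hm, show 2 * m = s ^ 2 * (-m) by linear_combination m * s_sq] at cla
    have u2 := (cla.of_mul_s_sq hp1).re_of_mul (w := w) (by omega) hp3 (by omega) v2
    omega
  · obtain ⟨g1, g2⟩ := mulR'_typeII_conic (z := w * z) h16 hwz hx hy t3 t4 t5 t6
    rw [e] at g1 g2
    obtain ⟨σ, cla⟩ := ca b (Or.inl rfl) (by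
      intro h; rw [h] at g2; simp at g2)
    have o1 := OddNorm.one_of_s g1 g2
    have o2 : OddNorm 3 (w * (be * a - c)) := OddNorm.of_odd_odd (by omega) (by omega)
    exact ((cb.oddNorm hp1).mul (cla.oddNorm hp1)).mul (OddNorm.sq hw0) |>.false (o2.mul o1)
      (by ring)

theorem no_mulR {p : ℕ} (hp : p.Prime) (h16 : p % 16 = 7) (hp3 : p % 3 = 2) {a b c z : O}
    (hcop : ∀ q, Prime q → q ∣ a → q ∣ z → False)
    (h1 : be ^ 2 * a ^ 2 - c ^ 2 = p * bb ^ 2 * z ^ 2)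
    (h3 : a ^ 2 + b ^ 2 = -(p * z ^ 2)) : False := by
  by_cases ha : modBb a = 0
  · have hc : modBb c = 0 := by
      have m1 := congrArg modBb h1
      simp only [map_sub, map_mul, map_pow, modBb_be, modBb_bb, ha] at m1
      have m2 : modBb c ^ 2 = 0 := by linear_combination -m1
      exact pow_eq_zero_iff two_ne_zero |>.1 m2
    have hbz : ¬ bb ∣ z := fun hz => hcop bb prime_bb ((modBb_eq_zero _).1 ha) hz
    obtain ⟨a, rfl⟩ := (modBb_eq_zero _).1 ha
    obtain ⟨c, rfl⟩ := (modBb_eq_zero _).1 hc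
    refine no_mulR_of_dvd hp h16 hp3 (a := a) (b := b) (c := c) (z := z)
      (fun q hq h h' => hcop q hq (h.mul_left _) h') hbz ?_ (by linear_combination h3)
    exact mul_left_cancel₀ (pow_ne_zero 2 prime_bb.ne_zero) (by linear_combination h1)
  · exact no_mulR_of_not_dvd hp h16 hp3 hcop h1 h3 ha

lemma class_be {p : ℕ} (hp3 : p % 3 = 2) {A B C z d d' : O}
    (hcop : ∀ q, Prime q → q ∣ A → q ∣ z → False) (hd : modBe d ≠ 0) (hd' : modBe d' ≠ 0)
    (h1 : d * A ^ 2 - d' * B ^ 2 = p * be * z ^ 2)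
    (h2 : d * d' * C ^ 2 - be * d * A ^ 2 = p * bb ^ 2 * z ^ 2) : False := by
  have m1 := congrArg modBe h1
  have m2 := congrArg modBe h2
  simp only [map_sub, map_mul, map_pow, modBe_be, modBe_bb, modBe_natCast hp3] at m1 m2
  by_cases hA : modBe A = 0
  · have hB : modBe B = 0 := by
      rw [hA] at m1
      generalize modBe B = x at *
      generalize modBe z = y at *
      generalize modBe d = u at *
      generalize modBe d' = v at *
      clear * - m1 hd'
      revert x y u v
      decide
    obtain ⟨a, rfl⟩ := (modBe_eq_zero _).1 hA
    obtain ⟨b, rfl⟩ := (modBe_eq_zero _).1 hB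
    have h3 : be * (d * a ^ 2 - d' * b ^ 2) = p * z ^ 2 :=
      mul_left_cancel₀ prime_be.ne_zero (by linear_combination h1)
    have m3 := congrArg modBe h3
    simp only [map_mul, map_pow, modBe_be, modBe_natCast hp3, zero_mul] at m3
    have hz : modBe z = 0 := pow_eq_zero_iff two_ne_zero |>.1 (by linear_combination m3)
    exact hcop be prime_be ⟨a, rfl⟩ ((modBe_eq_zero _).1 hz)
  · have hCz : modBe C = 0 ∧ modBe z = 0 := by
      generalize modBe A = w at *
      generalize modBe B = x at *
      generalize modBe C = t at *
      generalize modBe z = y at *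
      generalize modBe d = u at *
      generalize modBe d' = v at *
      have huv : u * v = 1 := by
        clear * - m1 hd hd' hA
        revert w x y u v
        decide
      rw [huv] at m2
      clear * - m2
      revert t y w u
      decide
    obtain ⟨c, rfl⟩ := (modBe_eq_zero _).1 hCz.1
    obtain ⟨y, rfl⟩ := (modBe_eq_zero _).1 hCz.2
    have h3 : d * A ^ 2 = be * (d * d' * c ^ 2 - p * bb ^ 2 * y ^ 2) :=
      mul_left_cancel₀ prime_be.ne_zero (by linear_combination -h2)
    have m3 := congrArg modBe h3
    simp only [map_mul, map_pow, modBe_be, zero_mul] at m3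
    rcases mul_eq_zero.1 m3 with h | h
    · exact hd h
    · exact hA (pow_eq_zero_iff two_ne_zero |>.1 h)

lemma class_bb {p : ℕ} (hp3 : p % 3 = 2) {A B z d d' : O}
    (hcop : ∀ q, Prime q → q ∣ A → q ∣ z → False) (hd : modBb d ≠ 0) (hd' : modBb d' = -1)
    (h1 : bb * d * A ^ 2 - d' * B ^ 2 = p * be ^ 2 * z ^ 2) : False := by
  have m1 := congrArg modBb h1
  simp only [map_sub, map_mul, map_pow, modBb_be, modBb_bb, modBb_natCast hp3, hd'] at m1
  have hBz : modBb B = 0 ∧ modBb z = 0 := by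
    generalize modBb A = w at *
    generalize modBb B = x at *
    generalize modBb z = y at *
    generalize modBb d = u at *
    clear * - m1
    revert w x y u
    decide
  obtain ⟨b, rfl⟩ := (modBb_eq_zero _).1 hBz.1
  obtain ⟨y, rfl⟩ := (modBb_eq_zero _).1 hBz.2
  have h3 : d * A ^ 2 = bb * (d' * b ^ 2 + p * be ^ 2 * y ^ 2) :=
    mul_left_cancel₀ prime_bb.ne_zero (by linear_combination h1)
  have m3 := congrArg modBb h3
  simp only [map_mul, map_pow, modBb_bb, zero_mul] at m3
  rcases mul_eq_zero.1 m3 with h | h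
  · exact hd h
  · exact hcop bb prime_bb ((modBb_eq_zero _).1 (pow_eq_zero_iff two_ne_zero |>.1 h)) ⟨y, rfl⟩

/-- The parity of the imaginary part after reduction modulo `2` of the squares. -/
lemma sq_mod_two (x : O) : (x ^ 2).re % 2 = x.re % 2 ∧ (x ^ 2).im % 2 = 0 := by
  constructor
  · have : (x ^ 2).re = x.re * x.re - 2 * (x.im * x.im) := by simp [pow_two]; ring
    rw [this]
    rcases Int.emod_two_eq_zero_or_one x.re with h | h
    · rw [Int.sub_mul_emod_self_left, Int.mul_emod, h]; rfl
    · rw [Int.sub_mul_emod_self_left, Int.mul_emod, h]; rfl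
  · have : (x ^ 2).im = 2 * (x.re * x.im) := by simp [pow_two]; ring
    omega

lemma odd_of_coprime {A z : O} (hcop : ∀ q, Prime q → q ∣ A → q ∣ z → False) :
    A.re % 2 = 1 ∨ z.re % 2 = 1 := by
  by_contra! h
  exact hcop s prime_s ((s_dvd_iff _).2 (by omega)) ((s_dvd_iff _).2 (by omega))

lemma natCast_mul_sq_mod_two {p : ℕ} (hp : p % 2 = 1) (z : O) :
    (p * z ^ 2 : O).re % 2 = z.re % 2 ∧ (p * z ^ 2 : O).im % 2 = 0 := by
  obtain ⟨h1, h2⟩ := sq_mod_two z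
  have hp' : (p : ℤ) % 2 = 1 := by omega
  generalize z ^ 2 = w at *
  simp [Int.mul_emod, hp', h1, h2]

/-- The class `(bb, 1, bb)`, up to sign. -/
lemma no_class_bb_one {p : ℕ} (hp : p % 2 = 1) {A B C z e : O} (he : e = 1 ∨ e = -1)
    (hcop : ∀ q, Prime q → q ∣ A → q ∣ z → False)
    (h1 : e * bb * A ^ 2 - B ^ 2 = p * be ^ 2 * z ^ 2)
    (h2 : e * bb * C ^ 2 - e * bb * A ^ 2 = p * bb ^ 2 * z ^ 2) : False := by
  have h3 : C ^ 2 - A ^ 2 = e * bb * (p * z ^ 2) := by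
    refine mul_left_cancel₀ prime_bb.ne_zero ?_
    rcases he with rfl | rfl
    · linear_combination h2
    · linear_combination -h2
  rw [mul_right_comm (p : O)] at h1
  have e1 := congrArg Zsqrtd.im h1
  have e3 := congrArg Zsqrtd.im h3
  rw [show be ^ 2 = (⟨-1, 2⟩ : O) by decide] at e1
  obtain ⟨a1, a2⟩ := sq_mod_two A
  obtain ⟨b1, b2⟩ := sq_mod_two B
  obtain ⟨c1, c2⟩ := sq_mod_two C
  obtain ⟨z1, z2⟩ := natCast_mul_sq_mod_two hp z
  have ho := odd_of_coprime hcop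
  generalize A ^ 2 = A2 at *
  generalize B ^ 2 = B2 at *
  generalize C ^ 2 = C2 at *
  generalize (p * z ^ 2 : O) = P at *
  rcases he with rfl | rfl <;> simp at e1 e3 <;> omega

/-- The class `(1, s, s)`, up to signs. -/
lemma no_class_one_s {p : ℕ} (hp : p % 2 = 1) {A B C z e e' : O} (he : e = 1 ∨ e = -1)
    (he' : e' = 1 ∨ e' = -1) (hcop : ∀ q, Prime q → q ∣ A → q ∣ z → False)
    (h1 : e * A ^ 2 - e' * s * B ^ 2 = p * be ^ 2 * z ^ 2)
    (h2 : e * e' * s * C ^ 2 - e * A ^ 2 = p * bb ^ 2 * z ^ 2) : False := by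
  have hbe : be ^ 2 + bb ^ 2 = (s ^ 2 : O) := by decide
  have h3 : e * e' * C ^ 2 - e' * B ^ 2 = p * s * z ^ 2 :=
    mul_left_cancel₀ prime_s.ne_zero (by linear_combination h1 + h2 + p * z ^ 2 * hbe)
  rw [mul_right_comm (p : O)] at h1 h3
  have e1 := congrArg Zsqrtd.re h1
  have e3 := congrArg Zsqrtd.im h3
  rw [show be ^ 2 = (⟨-1, 2⟩ : O) by decide] at e1
  obtain ⟨a1, a2⟩ := sq_mod_two A
  obtain ⟨b1, b2⟩ := sq_mod_two B
  obtain ⟨c1, c2⟩ := sq_mod_two C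
  obtain ⟨z1, z2⟩ := natCast_mul_sq_mod_two hp z
  have ho := odd_of_coprime hcop
  generalize A ^ 2 = A2 at *
  generalize B ^ 2 = B2 at *
  generalize C ^ 2 = C2 at *
  generalize (p * z ^ 2 : O) = P at *
  rcases he with rfl | rfl <;> rcases he' with rfl | rfl <;> simp at e1 e3 <;> omega

/-- The squares modulo `8`. -/
def sqModEight : List (ZMod 8 × ZMod 8) :=
  [(1, 0), (1, 4), (7, 2), (7, 6), (0, 0), (6, 0), (4, 0), (2, 4)]

lemma sq_mem_sqModEight (x : O) :
    ((((x ^ 2).re : ℤ) : ZMod 8), (((x ^ 2).im : ℤ) : ZMod 8)) ∈ sqModEight := by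
  have h1 : (x ^ 2).re = x.re * x.re - 2 * (x.im * x.im) := by simp [pow_two]; ring
  have h2 : (x ^ 2).im = 2 * (x.re * x.im) := by simp [pow_two]; ring
  rw [h1, h2]
  push_cast
  generalize (x.re : ZMod 8) = u
  generalize (x.im : ZMod 8) = v
  revert u v
  decide

set_option synthInstance.maxSize 1000 in
set_option synthInstance.maxHeartbeats 400000 in
set_option maxRecDepth 10000 in
lemma sqModEight_class : ∀ e : ZMod 8, (e = 1 ∨ e = -1) → ∀ a ∈ sqModEight, ∀ z ∈ sqModEight,
    ∀ b ∈ sqModEight, e * a.1 + b.1 = z.1 + 4 * z.2 → e * a.2 + b.2 = z.2 - 2 * z.1 →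
    ∀ c ∈ sqModEight, -e * c.1 - e * a.1 = z.1 - 4 * z.2 → -e * c.2 - e * a.2 = z.2 + 2 * z.1 →
    4 * a.1 = 0 ∧ 4 * z.1 = 0 := by
  decide

/-- The class `(1, -1, -1)`, up to signs. -/
lemma no_class_one_neg_one {p : ℕ} (h8 : p % 8 = 7) {A B C z : O} {e : O}
    (he : e = 1 ∨ e = -1) (hcop : ∀ q, Prime q → q ∣ A → q ∣ z → False)
    (h1 : e * A ^ 2 + B ^ 2 = p * be ^ 2 * z ^ 2)
    (h2 : -e * C ^ 2 - e * A ^ 2 = p * bb ^ 2 * z ^ 2) : False := by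
  have hp : (p : ZMod 8) = -1 := by
    rw [← ZMod.natCast_mod, h8]; decide
  rw [show be ^ 2 = (⟨-1, 2⟩ : O) by decide] at h1
  rw [show bb ^ 2 = (⟨-1, -2⟩ : O) by decide] at h2
  obtain ⟨a1, a2⟩ := sq_mod_two A
  obtain ⟨z1, z2⟩ := sq_mod_two z
  have ho := odd_of_coprime hcop
  have mA := sq_mem_sqModEight A
  have mB := sq_mem_sqModEight B
  have mC := sq_mem_sqModEight C
  have mz := sq_mem_sqModEight z
  generalize A ^ 2 = A2 at *
  generalize B ^ 2 = B2 at *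
  generalize C ^ 2 = C2 at *
  generalize z ^ 2 = Z2 at *
  have key : (4 * A2.re : ZMod 8) = 0 ∧ (4 * Z2.re : ZMod 8) = 0 := by
    have e1 := congrArg (fun x : O => (x.re : ZMod 8)) h1
    have e2 := congrArg (fun x : O => (x.im : ZMod 8)) h1
    have e3 := congrArg (fun x : O => (x.re : ZMod 8)) h2
    have e4 := congrArg (fun x : O => (x.im : ZMod 8)) h2
    rcases he with rfl | rfl
    · simp [hp] at e1 e2 e3 e4
      have := sqModEight_class 1 (Or.inl rfl) _ mA _ mz _ mB (by linear_combination e1)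
        (by linear_combination e2) _ mC (by linear_combination e3) (by linear_combination e4)
      exact this
    · simp [hp] at e1 e2 e3 e4
      have := sqModEight_class (-1) (Or.inr rfl) _ mA _ mz _ mB (by linear_combination e1)
        (by linear_combination e2) _ mC (by linear_combination e3) (by linear_combination e4)
      exact this
  obtain ⟨k1, k2⟩ := key
  have k1 : ((4 * A2.re : ℤ) : ZMod 8) = 0 := by push_cast; exact k1
  have k2 : ((4 * Z2.re : ℤ) : ZMod 8) = 0 := by push_cast; exact k2
  rw [ZMod.intCast_zmod_eq_zero_iff_dvd] at k1 k2
  omega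

/-- The class `(-1, 1, -1)`. -/
lemma no_class_R {p : ℕ} (hp : p.Prime) (h16 : p % 16 = 7) (hp3 : p % 3 = 2) {A B C z : O}
    (hcop : ∀ q, Prime q → q ∣ A → q ∣ z → False)
    (h1 : -A ^ 2 - B ^ 2 = p * be ^ 2 * z ^ 2) (h2 : -C ^ 2 + A ^ 2 = p * bb ^ 2 * z ^ 2) :
    False := by
  have m1 := congrArg modBe h1
  simp only [map_sub, map_neg, map_mul, map_pow, modBe_be] at m1
  have hAB : modBe A = 0 ∧ modBe B = 0 := by
    generalize modBe A = x at *
    generalize modBe B = y at *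
    generalize modBe z = u at *
    generalize modBe p = v at *
    clear * - m1
    revert x y u v
    decide
  obtain ⟨a, rfl⟩ := (modBe_eq_zero _).1 hAB.1
  obtain ⟨b, rfl⟩ := (modBe_eq_zero _).1 hAB.2
  refine no_mulR hp h16 hp3 (a := a) (b := b) (c := C) (z := z)
    (fun q hq h h' => hcop q hq (h.mul_left _) h') (by linear_combination h2) ?_
  exact mul_left_cancel₀ (pow_ne_zero 2 prime_be.ne_zero) (by linear_combination -h1)

/-- The class `(bb, s, s * bb)`. -/
lemma no_class_S {p : ℕ} (hp : p.Prime) (h16 : p % 16 = 7) (hp3 : p % 3 = 2) {A B C z : O}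
    (hcop : ∀ q, Prime q → q ∣ A → q ∣ z → False)
    (h1 : bb * A ^ 2 - s * B ^ 2 = p * be ^ 2 * z ^ 2)
    (h2 : s * bb * C ^ 2 - bb * A ^ 2 = p * bb ^ 2 * z ^ 2) : False := by
  have hbe : be ^ 2 + bb ^ 2 = (s ^ 2 : O) := by decide
  have e1 : s * C ^ 2 - A ^ 2 = p * bb * z ^ 2 :=
    mul_left_cancel₀ prime_bb.ne_zero (by linear_combination h2)
  have e3 : bb * C ^ 2 - B ^ 2 = s * p * z ^ 2 :=
    mul_left_cancel₀ prime_s.ne_zero (by linear_combination h1 + h2 + p * z ^ 2 * hbe)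
  exact no_mulS hp h16 hp3 hcop e1
    (by linear_combination s * e1 - bb * e3 + C ^ 2 * hbe) e3

/-- The class `(-bb, s, -s * bb)`. -/
lemma no_class_RS {p : ℕ} (hp : p.Prime) (h16 : p % 16 = 7) (hp3 : p % 3 = 2) {A B C z : O}
    (hcop : ∀ q, Prime q → q ∣ A → q ∣ z → False)
    (h1 : -bb * A ^ 2 - s * B ^ 2 = p * be ^ 2 * z ^ 2)
    (h2 : -s * bb * C ^ 2 + bb * A ^ 2 = p * bb ^ 2 * z ^ 2) : False := by
  have hbe : be ^ 2 + bb ^ 2 = (s ^ 2 : O) := by decide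
  have m1 := congrArg modBe h1
  simp only [map_sub, map_neg, map_mul, map_pow, modBe_be, modBe_bb, modBe_s] at m1
  have hAB : modBe A = 0 ∧ modBe B = 0 := by
    generalize modBe A = x at *
    generalize modBe B = y at *
    generalize modBe z = u at *
    generalize modBe p = v at *
    clear * - m1
    revert x y u v
    decide
  obtain ⟨a, rfl⟩ := (modBe_eq_zero _).1 hAB.1
  obtain ⟨b, rfl⟩ := (modBe_eq_zero _).1 hAB.2
  have e1 : s * C ^ 2 - be ^ 2 * a ^ 2 = -(p * bb * z ^ 2) :=
    mul_left_cancel₀ prime_bb.ne_zero (by linear_combination -h2)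
  have e4 : bb * a ^ 2 + s * b ^ 2 = -(p * z ^ 2) :=
    mul_left_cancel₀ (pow_ne_zero 2 prime_be.ne_zero) (by linear_combination -h1)
  have e3 : -bb * C ^ 2 - be ^ 2 * b ^ 2 = s * p * z ^ 2 :=
    mul_left_cancel₀ prime_s.ne_zero (by linear_combination h1 + h2 + p * z ^ 2 * hbe)
  refine no_mulRS hp h16 hp3 (a := a) (b := b) (c := C) (z := z)
    (fun q hq h h' => hcop q hq (h.mul_left _) h') e1 ?_ e4
  exact mul_left_cancel₀ prime_bb.ne_zero
    (by linear_combination -e3 - s * e4 - b ^ 2 * hbe)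

lemma modBe_unit {e : O} (h : e = 1 ∨ e = -1) : modBe e ≠ 0 := by
  rcases h with rfl | rfl <;> simp

lemma modBb_unit {e : O} (h : e = 1 ∨ e = -1) : modBb e ≠ 0 := by
  rcases h with rfl | rfl <;> simp

lemma class_trivial {p : ℕ} (hp : p.Prime) (h16 : p % 16 = 7) (hp3 : p % 3 = 2)
    {A B C z e e' i j k : O} (hcop : ∀ q, Prime q → q ∣ A → q ∣ z → False)
    (he : e = 1 ∨ e = -1) (he' : e' = 1 ∨ e' = -1) (hi : i = 1 ∨ i = be) (hj : j = 1 ∨ j = bb)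
    (hk : k = 1 ∨ k = s) (h1 : e * i * j * A ^ 2 - e' * i * k * B ^ 2 = p * be ^ 2 * z ^ 2)
    (h2 : e * e' * j * k * C ^ 2 - e * i * j * A ^ 2 = p * bb ^ 2 * z ^ 2) :
    e = 1 ∧ e' = 1 ∧ i = 1 ∧ j = 1 ∧ k = 1 := by
  have hp1 : p % 2 = 1 := by omega
  rcases hi with rfl | rfl
  swap
  · refine (class_be (A := A) (B := B) (C := C) hp3 (d := e * j) (d' := e' * k) hcop ?_ ?_
      (mul_left_cancel₀ prime_be.ne_zero ?_) (by linear_combination h2)).elim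
    · rw [map_mul]
      exact mul_ne_zero (modBe_unit he) (by rcases hj with rfl | rfl <;> simp [modBe_bb])
    · rw [map_mul]
      exact mul_ne_zero (modBe_unit he') (by rcases hk with rfl | rfl <;> simp [modBe_s])
    · linear_combination h1
  rcases hj with rfl | rfl
  · rcases hk with rfl | rfl
    · rcases he' with rfl | rfl
      · rcases he with rfl | rfl
        · exact ⟨rfl, rfl, rfl, rfl, rfl⟩
        · exact (no_class_R (A := A) (B := B) (C := C) hp h16 hp3 hcop (by linear_combination h1)
            (by linear_combination h2)).elim
      · exact (no_class_one_neg_one (A := A) (B := B) (C := C) (by omega : p % 8 = 7) he hcop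
          (by linear_combination h1)
          (by linear_combination h2)).elim
    · exact (no_class_one_s (A := A) (B := B) (C := C) hp1 he he' hcop (by linear_combination h1)
        (by linear_combination h2)).elim
  · rcases he' with rfl | rfl
    · rcases hk with rfl | rfl
      · exact (no_class_bb_one (A := A) (B := B) (C := C) hp1 he hcop (by linear_combination h1)
          (by linear_combination h2)).elim
      · rcases he with rfl | rfl
        · exact (no_class_S (A := A) (B := B) (C := C) hp h16 hp3 hcop (by linear_combination h1)
            (by linear_combination h2)).elim
        · exact (no_class_RS (A := A) (B := B) (C := C) hp h16 hp3 hcop (by linear_combination h1)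
            (by linear_combination h2)).elim
    · refine (class_bb (A := A) (B := B) hp3 (d := e) (d' := -1 * k) hcop (modBb_unit he) ?_
        (by linear_combination h1)).elim
      rcases hk with rfl | rfl <;> simp [modBb_s]

lemma dvd_of_sq_dvd_class {P P' e i k q x : O} (hP : Prime P) (hP' : Prime P') (hPP : ¬ P' ∣ P)
    (he : e = 1 ∨ e = -1) (hi : i = 1 ∨ i = P) (hk : k = 1 ∨ k = P') (hq : Prime q)
    (h : q ^ 2 ∣ e * i * k * x ^ 2) : q ∣ x := by
  have h' : q ^ 2 ∣ i * (k * x ^ 2) := by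
    rcases he with rfl | rfl
    · simpa [mul_assoc] using h
    · rw [← dvd_neg]
      convert h using 1; ring
  have key : ∀ w, q ^ 2 ∣ i * w → q ∣ w := by
    intro w hw
    rcases hi with rfl | rfl
    · rw [one_mul] at hw
      exact (dvd_pow_self q two_ne_zero).trans hw
    · exact dvd_of_sq_dvd_mul hq hP hw
  rcases hk with rfl | rfl
  · exact hq.dvd_of_dvd_pow (by simpa using key _ h')
  rcases hq.dvd_or_dvd (key _ h') with h2 | h2
  · rcases hi with rfl | rfl
    · exact hq.dvd_of_dvd_pow (dvd_of_sq_dvd_mul hq hP' (by simpa using h'))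
    · have h3 := dvd_of_prime_dvd hq hP' h2
      have h4 : k ^ 2 ∣ k * (i * x ^ 2) := by
        convert (pow_dvd_pow_of_dvd h3 2).trans h' using 1; ring
      have h5 := (hP'.dvd_or_dvd (dvd_of_sq_dvd_mul hP' hP' h4)).resolve_left hPP
      exact h2.trans (hP'.dvd_of_dvd_pow h5)
  · exact hq.dvd_of_dvd_pow h2

/-- A solution of a homogeneous pair of equations can be made primitive. -/
lemma exists_primitive {d d' d'' m n : O} (hd' : ∀ q x, Prime q → q ^ 2 ∣ d' * x ^ 2 → q ∣ x)
    (hd'' : ∀ q x, Prime q → q ^ 2 ∣ d'' * x ^ 2 → q ∣ x) {A B C z : O} (hz : z ≠ 0)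
    (h1 : d * A ^ 2 - d' * B ^ 2 = m * z ^ 2) (h2 : d'' * C ^ 2 - d * A ^ 2 = n * z ^ 2) :
    ∃ a b c y : O, y ≠ 0 ∧ (∀ q, Prime q → q ∣ a → q ∣ y → False) ∧
      d * a ^ 2 - d' * b ^ 2 = m * y ^ 2 ∧ d'' * c ^ 2 - d * a ^ 2 = n * y ^ 2 ∧
      y.norm.natAbs ≤ z.norm.natAbs ∧
      ((∃ q, Prime q ∧ q ∣ A ∧ q ∣ z) → y.norm.natAbs < z.norm.natAbs) := by
  induction hn : z.norm.natAbs using Nat.strong_induction_on generalizing A B C z with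
  | _ N ih =>
    by_cases hq : ∃ q, Prime q ∧ q ∣ A ∧ q ∣ z
    · obtain ⟨q, hq, ⟨A, rfl⟩, ⟨z, rfl⟩⟩ := hq
      obtain ⟨B, rfl⟩ := hd' q B hq ⟨d * A ^ 2 - m * z ^ 2, by linear_combination -h1⟩
      obtain ⟨C, rfl⟩ := hd'' q C hq ⟨d * A ^ 2 + n * z ^ 2, by linear_combination h2⟩
      have hz0 := right_ne_zero_of_mul hz
      have hlt := norm_sq_lt hq.not_isUnit hq.ne_zero hz0
      obtain ⟨a, b, c, y, g1, g2, g3, g4, g5, -⟩ := ih _ (hn ▸ hlt) (A := A) (B := B) (C := C) hz0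
        (mul_left_cancel₀ (pow_ne_zero 2 hq.ne_zero) (by linear_combination h1))
        (mul_left_cancel₀ (pow_ne_zero 2 hq.ne_zero) (by linear_combination h2)) rfl
      exact ⟨a, b, c, y, g1, g2, g3, g4, by omega, fun _ => by omega⟩
    · exact ⟨A, B, C, z, hz, fun q h h' h'' => hq ⟨q, h, h', h''⟩, h1, h2, hn.le,
        fun h => (hq h).elim⟩

lemma exists_class_unit {l l' δ m : O} (hl : l ≠ 0) (h : l * l' = δ * m ^ 2)
    (H : ∀ q, Prime q → q ∣ l → (q ∣ δ ∨ q ∣ l') → False) :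
    ∃ e t : O, (e = 1 ∨ e = -1) ∧ l = e * t ^ 2 ∧ t ≠ 0 := by
  obtain ⟨d, t, hd, h1, h2⟩ := exists_class hl h
  exact ⟨d, t, eq_one_or_of_no_prime hd.ne_zero
    (fun q hq hqd => H q hq (h2 q hq hqd).1 (h2 q hq hqd).2), h1,
    by rintro rfl; exact hl (by simp [h1])⟩

set_option maxHeartbeats 2000000 in
lemma cover_two_adic {p : ℕ} (h8 : p % 8 = 7) {a b c z : O}
    (hcop : ∀ q, Prime q → q ∣ a → q ∣ z → False)
    (h1 : a ^ 2 - b ^ 2 = p * be ^ 2 * z ^ 2) (h2 : c ^ 2 - a ^ 2 = p * bb ^ 2 * z ^ 2) :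
    a.re % 2 = 1 ∧ (z.re % 2 = 1 ∧ b.re % 2 = 0 ∧ c.re % 2 = 0 ∨
      z.re % 2 = 0 ∧ z.im % 2 = 0 ∧ b.re % 2 = 1 ∧ c.re % 2 = 1 ∧
        (a.im + b.im) % 2 = 0 ∧ (a.im + c.im) % 2 = 0) := by
  have ho := odd_of_coprime hcop
  rw [mul_right_comm (p : O)] at h1 h2
  rw [show be ^ 2 = (⟨-1, 2⟩ : O) by decide] at h1
  rw [show bb ^ 2 = (⟨-1, -2⟩ : O) by decide] at h2
  have e1 := congrArg Zsqrtd.re h1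
  have e2 := congrArg Zsqrtd.im h1
  have e3 := congrArg Zsqrtd.re h2
  have e4 := congrArg Zsqrtd.im h2
  have hP : (p * z ^ 2 : O).re % 8 = (-(z ^ 2).re) % 8 ∧
      (p * z ^ 2 : O).im % 8 = (-(z ^ 2).im) % 8 := by
    obtain ⟨k, hk⟩ : ∃ k : ℤ, (p : ℤ) = 8 * k + 7 := ⟨p / 8, by omega⟩
    generalize z ^ 2 = w at *
    simp [hk, add_mul, mul_assoc]
    omega
  have cases : ∀ x : O, x.re % 2 = 1 ∧ x.im % 2 = 0 ∧ (x ^ 2).re % 4 = 1 ∧ (x ^ 2).im % 4 = 0 ∨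
      x.re % 2 = 1 ∧ x.im % 2 = 1 ∧ (x ^ 2).re % 4 = 3 ∧ (x ^ 2).im % 4 = 2 ∨
      x.re % 2 = 0 ∧ x.im % 2 = 0 ∧ (x ^ 2).re % 4 = 0 ∧ (x ^ 2).im % 4 = 0 ∨
      x.re % 2 = 0 ∧ x.im % 2 = 1 ∧ (x ^ 2).re % 4 = 2 ∧ (x ^ 2).im % 4 = 0 := by
    intro x
    rcases Int.emod_two_eq_zero_or_one x.re with h | h
    · have := even_sq_mod_eight h
      omega
    · have := sq_mod_eight h
      omega
  have ca := cases a
  have cb := cases b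
  have cc := cases c
  have cz := cases z
  clear cases
  generalize a ^ 2 = A at *
  generalize b ^ 2 = B at *
  generalize c ^ 2 = C at *
  generalize (p * z ^ 2 : O) = P at *
  generalize z ^ 2 = Z at *
  simp at e1 e2 e3 e4
  have f1 : (A.re - B.re - Z.re) % 4 = 0 := by clear ca cb cc cz ho; omega
  have f2 : (A.im - B.im - Z.im - 2 * Z.re) % 4 = 0 := by clear ca cb cc cz ho; omega
  have f3 : (C.re - A.re - Z.re) % 4 = 0 := by clear ca cb cc cz ho; omega
  have f4 : (C.im - A.im - Z.im - 2 * Z.re) % 4 = 0 := by clear ca cb cc cz ho; omega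
  clear h1 h2 hcop e1 e2 e3 e4 hP
  revert cc
  rcases ca with ca | ca | ca | ca <;> rcases cz with cz | cz | cz | cz <;>
    rcases cb with cb | cb | cb | cb <;> first
    | (clear ho; exfalso; omega)
    | rintro (cc | cc | cc | cc)
  all_goals omega

lemma exists_class_one_of_coprime {p u u' m P : O} (hp : Prime p) (hP : Prime P) (hu : u ≠ 0)
    (hpu : ¬ p ∣ u) (h : u * u' = p * m ^ 2)
    (H : ∀ q, Prime q → q ∣ u → q ∣ u' → q ∣ m → q ∣ P) :
    ∃ e i t : O, (e = 1 ∨ e = -1) ∧ (i = 1 ∨ i = P) ∧ u = e * i * t ^ 2 := by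
  obtain ⟨e, i, t, he, hi, ht, -⟩ := exists_class_one hP hu h fun q hq hqu hqq => by
    rcases hqq with hqq | hqq
    · exact (hpu ((dvd_of_prime_dvd hq hp hqq).trans hqu)).elim
    · refine H q hq hqu hqq (hq.dvd_of_dvd_pow (n := 2) (dvd_of_sq_dvd_mul hq hp ?_))
      rw [← h, pow_two]
      exact mul_dvd_mul hqu hqq
  exact ⟨e, i, t, he, hi, ht⟩

lemma exists_class_unit_of_coprime {p u u' m : O} (hp : Prime p) (hu : u ≠ 0)
    (hpu : ¬ p ∣ u) (h : u * u' = p * m ^ 2)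
    (H : ∀ q, Prime q → q ∣ u → q ∣ u' → q ∣ m → False) :
    ∃ e t : O, (e = 1 ∨ e = -1) ∧ u = e * t ^ 2 := by
  obtain ⟨e, t, he, ht, -⟩ := exists_class_unit hu h fun q hq hqu hqq => by
    rcases hqq with hqq | hqq
    · exact (hpu ((dvd_of_prime_dvd hq hp hqq).trans hqu)).elim
    · refine H q hq hqu hqq (hq.dvd_of_dvd_pow (n := 2) (dvd_of_sq_dvd_mul hq hp ?_))
      rw [← h, pow_two]
      exact mul_dvd_mul hqu hqq
  exact ⟨e, t, he, ht⟩

lemma not_s_dvd {x : O} (h : x.re % 2 = 1) : ¬ s ∣ x := by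
  rw [s_dvd_iff]; omega

lemma not_s_dvd_be : ¬ s ∣ be := not_s_dvd rfl

lemma not_s_dvd_bb : ¬ s ∣ bb := not_s_dvd rfl

/-- Halving a point on the trivial cover. -/
lemma exists_half {p : ℕ} (hp : p.Prime) (h16 : p % 16 = 7) (hp3 : p % 3 = 2)
    {a b c z e₁ e₂ e₃ i j k r₁ r₂ r₃ : O} (hz : z ≠ 0)
    (he₁ : e₁ = 1 ∨ e₁ = -1) (he₂ : e₂ = 1 ∨ e₂ = -1) (he₃ : e₃ = 1 ∨ e₃ = -1)
    (hi : i = 1 ∨ i = be) (hj : j = 1 ∨ j = bb) (hk : k = 1 ∨ k = s)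
    (hab : a + b = e₁ * i * r₁ ^ 2) (hac : a + c = e₂ * j * r₂ ^ 2)
    (hbc : b + c = e₃ * k * r₃ ^ 2)
    (h1 : a ^ 2 - b ^ 2 = p * be ^ 2 * z ^ 2) (h2 : c ^ 2 - a ^ 2 = p * bb ^ 2 * z ^ 2) :
    k = 1 ∧ ∃ a' b' c' y : O, y ≠ 0 ∧ (∀ q, Prime q → q ∣ a' → q ∣ y → False) ∧
      a' ^ 2 - b' ^ 2 = p * be ^ 2 * y ^ 2 ∧ c' ^ 2 - a' ^ 2 = p * bb ^ 2 * y ^ 2 ∧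
      ((∃ q, Prime q ∧ q ∣ r₁ ∧ q ∣ z) → y.norm.natAbs < z.norm.natAbs) := by
  have sq₁ : e₁ ^ 2 = 1 := by rcases he₁ with rfl | rfl <;> ring
  have unit_mul : ∀ {e e' : O}, (e = 1 ∨ e = -1) → (e' = 1 ∨ e' = -1) →
      (e * e' = 1 ∨ e * e' = -1) := by
    rintro _ _ (rfl | rfl) (rfl | rfl) <;> simp
  have g1 : e₁ * e₂ * i * j * (r₁ * r₂) ^ 2 - e₁ * e₃ * i * k * (r₁ * r₃) ^ 2 =
      p * be ^ 2 * z ^ 2 := by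
    have : (a + b) * (a + c) - (a + b) * (b + c) = p * be ^ 2 * z ^ 2 := by
      linear_combination h1
    rw [← this, hab, hac, hbc]; ring
  have g2 : e₁ * e₂ * (e₁ * e₃) * j * k * (r₂ * r₃) ^ 2 - e₁ * e₂ * i * j * (r₁ * r₂) ^ 2 =
      p * bb ^ 2 * z ^ 2 := by
    have : (a + c) * (b + c) - (a + b) * (a + c) = p * bb ^ 2 * z ^ 2 := by
      linear_combination h2
    rw [← this, hab, hac, hbc]
    linear_combination e₂ * e₃ * j * k * (r₂ * r₃) ^ 2 * sq₁
  obtain ⟨a', b', c', y, hy, hcop, k1, k2, -, k4⟩ := exists_primitive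
    (d := e₁ * e₂ * i * j) (d' := e₁ * e₃ * i * k) (d'' := e₁ * e₂ * (e₁ * e₃) * j * k)
    (fun q x hq h => dvd_of_sq_dvd_class prime_be prime_s not_s_dvd_be (unit_mul he₁ he₃)
      hi hk hq h)
    (fun q x hq h => dvd_of_sq_dvd_class prime_bb prime_s not_s_dvd_bb
      (unit_mul (unit_mul he₁ he₂) (unit_mul he₁ he₃)) hj hk hq h) hz g1 g2
  obtain ⟨t1, t2, rfl, rfl, rfl⟩ := class_trivial hp h16 hp3 hcop (unit_mul he₁ he₂)
    (unit_mul he₁ he₃) hi hj hk k1 k2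
  refine ⟨rfl, a', b', c', y, hy, hcop, ?_, ?_, ?_⟩
  · rw [← k1, t1, t2]; ring
  · rw [← k2, t1, t2]; ring
  · rintro ⟨q, hq, h, h'⟩
    exact k4 ⟨q, hq, h.mul_right _, h'⟩

lemma natCast_not_dvd_s {p : ℕ} (hp : p ≠ 1) : ¬ (p : O) ∣ s := by
  rintro ⟨x, hx⟩
  have := congrArg Zsqrtd.im hx
  simp at this
  exact hp (by exact_mod_cast Int.eq_one_of_dvd_one (by positivity) ⟨x.im, this⟩)

lemma natCast_not_dvd_of_re {p : ℕ} (hp : p ≠ 1) {x : O} (h : x.re = 1) : ¬ (p : O) ∣ x := by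
  rintro ⟨x, rfl⟩
  simp at h
  exact hp (by exact_mod_cast Int.eq_one_of_dvd_one (by positivity) ⟨x.re, h.symm⟩)

lemma exists_sign {p : O} (hp : Prime p) {a b : O} (h : p ∣ a ^ 2 - b ^ 2) :
    ∃ b', (b' = b ∨ b' = -b) ∧ p ∣ a - b' := by
  rw [sq_sub_sq] at h
  rcases hp.dvd_or_dvd h with h | h
  · exact ⟨-b, Or.inr rfl, by simpa using h⟩
  · exact ⟨b, Or.inl rfl, h⟩

/-- The signs on the trivial cover can be chosen such that `a + b`, `a + c`, `b + c` are prime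
to `p`. -/
lemma exists_signs {p : ℕ} (hp : p.Prime) (h8 : p % 8 = 7) {a b c z : O}
    (hcop : ∀ q, Prime q → q ∣ a → q ∣ z → False)
    (h1 : a ^ 2 - b ^ 2 = p * be ^ 2 * z ^ 2) (h2 : c ^ 2 - a ^ 2 = p * bb ^ 2 * z ^ 2) :
    ∃ b' c' : O, a ^ 2 - b' ^ 2 = p * be ^ 2 * z ^ 2 ∧ c' ^ 2 - a ^ 2 = p * bb ^ 2 * z ^ 2 ∧
      ¬ (p : O) ∣ a + b' ∧ ¬ (p : O) ∣ a + c' ∧ ¬ (p : O) ∣ b' + c' := by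
  have hP := prime_natCast hp h8
  have hs := natCast_not_dvd_s hp.ne_one
  have h_two : ∀ x : O, (p : O) ∣ 2 * x → (p : O) ∣ x := fun x hx =>
    (hP.dvd_or_dvd hx).resolve_left fun h => hs (dvd_s_of_dvd_two hP h)
  have key : ∀ x : O, (p : O) ∣ a - x → a ^ 2 - x ^ 2 = p * be ^ 2 * z ^ 2 ∨
      x ^ 2 - a ^ 2 = p * bb ^ 2 * z ^ 2 → ¬ (p : O) ∣ a + x := by
    intro x hx hx2 hx'
    have ha : (p : O) ∣ a := h_two a (by convert dvd_add hx hx' using 1; ring)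
    have h3 : (p : O) ^ 2 ∣ a ^ 2 - x ^ 2 := by
      rw [sq_sub_sq, pow_two]; exact mul_dvd_mul hx' hx
    have hz : (p : O) ∣ be * z ∨ (p : O) ∣ bb * z := by
      rcases hx2 with hx2 | hx2
      · refine Or.inl (hP.dvd_of_dvd_pow (n := 2) (dvd_of_sq_dvd_mul hP hP ?_))
        convert h3 using 1; rw [hx2]; ring
      · refine Or.inr (hP.dvd_of_dvd_pow (n := 2) (dvd_of_sq_dvd_mul hP hP ?_))
        rw [← dvd_neg] at h3
        convert h3 using 1; linear_combination -hx2
    refine hcop _ hP ha ?_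
    rcases hz with hz | hz
    · exact (hP.dvd_or_dvd hz).resolve_left (natCast_not_dvd_of_re hp.ne_one rfl)
    · exact (hP.dvd_or_dvd hz).resolve_left (natCast_not_dvd_of_re hp.ne_one rfl)
  obtain ⟨b', hb, hpb⟩ := exists_sign hP (a := a) (b := b)
    ⟨be ^ 2 * z ^ 2, by rw [h1]; ring⟩
  obtain ⟨c', hc, hpc⟩ := exists_sign hP (a := a) (b := c)
    ⟨-(bb ^ 2 * z ^ 2), by linear_combination -h2⟩
  rw [← sq_eq_of_eq_or_neg hb] at h1
  rw [← sq_eq_of_eq_or_neg hc] at h2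
  refine ⟨b', c', h1, h2, key _ hpb (Or.inl h1), key _ hpc (Or.inr h2), fun hbc => ?_⟩
  have hb' : (p : O) ∣ a := by
    refine h_two a ?_
    convert dvd_add (dvd_add hpb hpc) hbc using 1; ring
  refine key _ hpb (Or.inl h1) ?_
  convert dvd_sub (dvd_mul_of_dvd_right hb' 2) hpb using 1; ring

/-- The trivial cover has no points. -/
theorem no_cover {p : ℕ} (hp : p.Prime) (h16 : p % 16 = 7) (hp3 : p % 3 = 2) {a b c z : O}
    (hz : z ≠ 0) (hcop : ∀ q, Prime q → q ∣ a → q ∣ z → False)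
    (h1 : a ^ 2 - b ^ 2 = p * be ^ 2 * z ^ 2) (h2 : c ^ 2 - a ^ 2 = p * bb ^ 2 * z ^ 2) :
    False := by
  induction hn : z.norm.natAbs using Nat.strong_induction_on generalizing a b c z with
  | _ N ih =>
  have h8 : p % 8 = 7 := by omega
  have hP := prime_natCast hp h8
  obtain ⟨b, c, h1, h2, hpab, hpac, hpbc⟩ := exists_signs hp h8 hcop h1 h2
  have hbe : be ^ 2 + bb ^ 2 = (s ^ 2 : O) := by decide
  have hss : (2 : O) = -s ^ 2 := by decide
  have hnz : ∀ x : O, ¬ (p : O) ∣ x → x ≠ 0 := by rintro x hx rfl; simp at hx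
  obtain ⟨hao, ⟨hzo, hbo, hco⟩ | ⟨hz1, hz2, hbo, hco, hab, hac⟩⟩ := cover_two_adic h8 hcop h1 h2
  · have hsab : ¬ s ∣ a + b := not_s_dvd (by simp; omega)
    have hsac : ¬ s ∣ a + c := not_s_dvd (by simp; omega)
    have h_two : ∀ q x : O, Prime q → ¬ s ∣ x → q ∣ x → q ∣ 2 * a → q ∣ a :=
      fun q x hq hx hqx h => (hq.dvd_or_dvd h).resolve_left fun h =>
        hx ((dvd_of_prime_dvd hq prime_s (dvd_s_of_dvd_two hq h)).trans hqx)
    obtain ⟨m, hm⟩ : s ∣ b + c := (s_dvd_iff _).2 (by simp; omega)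
    obtain ⟨m', hm'⟩ : s ∣ c - b := (s_dvd_iff _).2 (by simp; omega)
    have hpm : ¬ (p : O) ∣ m := fun h => hpbc (hm ▸ h.mul_left _)
    obtain ⟨e₁, i, r₁, he₁, hi, hr₁⟩ := exists_class_one_of_coprime (u := a + b) (u' := a - b)
      (m := be * z) hP prime_be (hnz _ hpab) hpab (by linear_combination h1)
      fun q hq hu hu' hqz => (hq.dvd_or_dvd hqz).resolve_right fun hqz =>
        hcop q hq (h_two q _ hq hsab hu (by convert dvd_add hu hu' using 1; ring)) hqz
    obtain ⟨e₂, j, r₂, he₂, hj, hr₂⟩ := exists_class_one_of_coprime (u := a + c) (u' := c - a)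
      (m := bb * z) hP prime_bb (hnz _ hpac) hpac (by linear_combination h2)
      fun q hq hu hu' hqz => (hq.dvd_or_dvd hqz).resolve_right fun hqz =>
        hcop q hq (h_two q _ hq hsac hu (by convert dvd_sub hu hu' using 1; ring)) hqz
    have hmm : m * m' = p * z ^ 2 := by
      refine mul_left_cancel₀ (pow_ne_zero 2 prime_s.ne_zero) ?_
      have : (b + c) * (c - b) = p * s ^ 2 * z ^ 2 := by
        linear_combination h1 + h2 + p * z ^ 2 * hbe
      rw [hm, hm'] at this
      linear_combination this
    obtain ⟨e₃, r₃, he₃, hr₃⟩ := exists_class_unit_of_coprime (u := m) (u' := m')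
      (m := z) hP (hnz _ hpm) hpm hmm fun q hq hu hu' hqz => by
        have hqc : q ∣ s * c := by
          rw [← dvd_neg]
          convert dvd_add hu hu' using 1
          refine mul_left_cancel₀ prime_s.ne_zero ?_
          linear_combination hm + hm' - c * hss
        have hqs : ¬ q ∣ s := fun h =>
          not_s_dvd hzo ((dvd_of_prime_dvd hq prime_s h).trans hqz)
        have hqa : q ∣ a ^ 2 := by
          rw [show a ^ 2 = c * c - p * bb ^ 2 * z * z by linear_combination -h2]
          exact dvd_sub (((hq.dvd_or_dvd hqc).resolve_left hqs).mul_left _) (hqz.mul_left _)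
        exact hcop q hq (hq.dvd_of_dvd_pow hqa) hqz
    have := (exists_half (r₃ := r₃) hp h16 hp3 hz he₁ he₂ he₃ hi hj (Or.inr rfl) hr₁ hr₂
      (by rw [hm, hr₃]; ring) h1 h2).1
    exact absurd this (by decide)
  · have half : ∀ x : O, x.re % 2 = 0 → x.im % 2 = 0 → ∃ y, x = 2 * y := fun x h h' =>
      exists_eq_two_mul (w := 1) rfl (by rwa [one_mul]) (by rwa [one_mul])
    obtain ⟨z, rfl⟩ := half z hz1 hz2
    obtain ⟨u, hu⟩ := half (a + b) (by simp; omega) (by simp; omega)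
    obtain ⟨v, hv⟩ := half (a + c) (by simp; omega) (by simp; omega)
    obtain ⟨w, hw⟩ := half (b + c) (by simp; omega) (by simp; omega)
    have hpu : ¬ (p : O) ∣ u := fun h => hpab (hu ▸ h.mul_left _)
    have hpv : ¬ (p : O) ∣ v := fun h => hpac (hv ▸ h.mul_left _)
    have hpw : ¬ (p : O) ∣ w := fun h => hpbc (hw ▸ h.mul_left _)
    have h_two : (2 : O) ≠ 0 := by decide
    have hu2 : u * (a - u) = p * (be * z) ^ 2 := by
      refine mul_left_cancel₀ (pow_ne_zero 2 h_two) ?_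
      have : (2 * u) * (2 * a - 2 * u) = p * be ^ 2 * (2 * z) ^ 2 := by
        rw [← hu, ← h1]; ring
      linear_combination this
    have hv2 : v * (v - a) = p * (bb * z) ^ 2 := by
      refine mul_left_cancel₀ (pow_ne_zero 2 h_two) ?_
      have : (2 * v) * (2 * v - 2 * a) = p * bb ^ 2 * (2 * z) ^ 2 := by
        rw [← hv, ← h2]; ring
      linear_combination this
    have hw2 : w * (c - w) = p * (s * z) ^ 2 := by
      refine mul_left_cancel₀ (pow_ne_zero 2 h_two) ?_
      have : (2 * w) * (2 * c - 2 * w) = p * s ^ 2 * (2 * z) ^ 2 := by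
        rw [← hw]; linear_combination h1 + h2 + p * (2 * z) ^ 2 * hbe
      linear_combination this
    obtain ⟨e₁, i, r₁, he₁, hi, hr₁⟩ := exists_class_one_of_coprime hP prime_be (hnz _ hpu)
      hpu hu2 fun q hq hu hu' hqz => (hq.dvd_or_dvd hqz).resolve_right fun hqz =>
        hcop q hq (by convert dvd_add hu hu' using 1; ring) (hqz.mul_left _)
    obtain ⟨e₂, j, r₂, he₂, hj, hr₂⟩ := exists_class_one_of_coprime hP prime_bb (hnz _ hpv)
      hpv hv2 fun q hq hu hu' hqz => (hq.dvd_or_dvd hqz).resolve_right fun hqz =>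
        hcop q hq (by convert dvd_sub hu hu' using 1; ring) (hqz.mul_left _)
    obtain ⟨e₃, r₃, he₃, hr₃⟩ := exists_class_unit_of_coprime hP (hnz _ hpw)
      hpw hw2 fun q hq hu hu' hqz => by
        have hqc : q ∣ c := by convert dvd_add hu hu' using 1; ring
        rcases hq.dvd_or_dvd hqz with hqz | hqz
        · exact not_s_dvd hco ((dvd_of_prime_dvd hq prime_s hqz).trans hqc)
        · have hqa : q ∣ a ^ 2 := by
            rw [show a ^ 2 = c * c - p * bb ^ 2 * 4 * z * z by linear_combination -h2]
            exact dvd_sub (hqc.mul_left _) (hqz.mul_left _)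
          exact hcop q hq (hq.dvd_of_dvd_pow hqa) (hqz.mul_left _)
    have neg : ∀ {e : O}, (e = 1 ∨ e = -1) → (-e = 1 ∨ -e = -1) := by
      rintro _ (rfl | rfl) <;> simp
    obtain ⟨-, a', b', c', y, hy, hcop', k1, k2, hlt⟩ := exists_half (r₁ := s * r₁)
      (r₂ := s * r₂) (r₃ := s * r₃) hp h16 hp3 hz (neg he₁) (neg he₂) (neg he₃) hi hj
      (Or.inl rfl) (by rw [hu, hr₁, hss]; ring) (by rw [hv, hr₂, hss]; ring)
      (by rw [hw, hr₃, hss]; ring) h1 h2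
    refine ih _ ?_ hy hcop' k1 k2 rfl
    rw [← hn]
    refine hlt ⟨s, prime_s, dvd_mul_right _ _, Dvd.dvd.mul_right ⟨-s, ?_⟩ _⟩
    rw [hss]; ring

/-- Duplication carries a point on `X₁ X₂ X₃ = w ^ 2` to a point on the trivial cover. -/
lemma no_point {p : ℕ} (hp : p.Prime) (h16 : p % 16 = 7) (hp3 : p % 3 = 2)
    {X₁ X₂ X₃ z w : O} (hz : z ≠ 0) (hw : w ≠ 0) (h : X₁ * X₂ * X₃ = w ^ 2)
    (h1 : X₁ - X₂ = p * be ^ 2 * z ^ 2) (h2 : X₃ - X₁ = p * bb ^ 2 * z ^ 2) : False := by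
  have h3 : ∀ q x : O, Prime q → q ^ 2 ∣ 1 * x ^ 2 → q ∣ x := fun q x hq h =>
    hq.dvd_of_dvd_pow (n := 2) ((dvd_pow_self q two_ne_zero).trans (by simpa using h))
  obtain ⟨a, b, c, y, hy, hcop, k1, k2, -⟩ := exists_primitive (d := 1) (m := p * be ^ 2)
    (n := p * bb ^ 2) h3 h3
    (A := X₁ ^ 2 - (X₁ - X₂) * (X₁ - X₃)) (B := X₂ ^ 2 - (X₂ - X₁) * (X₂ - X₃))
    (C := X₃ ^ 2 - (X₃ - X₁) * (X₃ - X₂)) (z := 2 * (w * z))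
    (mul_ne_zero (by decide) (mul_ne_zero hw hz))
    (by linear_combination 4 * (X₁ - X₂) * h + 4 * w ^ 2 * h1)
    (by linear_combination 4 * (X₃ - X₁) * h + 4 * w ^ 2 * h2)
  exact no_cover hp h16 hp3 hy hcop (by simpa using k1) (by simpa using k2)

lemma no_integral_point {p : ℕ} (hp : p.Prime) (h16 : p % 16 = 7) (hp3 : p % 3 = 2)
    {m n k : ℤ} (hm : m ≠ 0) (hn : n ≠ 0) (hk : k ≠ 0)
    (h : k ^ 2 = n * m * (m ^ 2 - n ^ 2 * p ^ 2) * (m ^ 2 - 4 * n ^ 2 * p ^ 2)) : False := by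
  have h' : (k ^ 2 : O) = n * m * (m ^ 2 - n ^ 2 * p ^ 2) * (m ^ 2 - 4 * n ^ 2 * p ^ 2) := by
    exact_mod_cast congrArg (Int.cast : ℤ → O) h
  have hs : (m + s * n * p : O) ≠ 0 := fun h0 => hm (by simpa using congrArg Zsqrtd.re h0)
  have hm' : (m : O) ≠ 0 := by exact_mod_cast hm
  have hn' : (n : O) ≠ 0 := by exact_mod_cast hn
  have hk' : (k : O) ≠ 0 := by exact_mod_cast hk
  have hbe : be ^ 2 = 2 * s - 1 := by decide
  have hbb : bb ^ 2 = -2 * s - 1 := by decide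
  have hss : s ^ 2 = -2 := by decide
  refine no_point hp h16 hp3 (z := n * m) (w := n * m * (m + s * n * p) * k)
    (X₁ := n * m * (m + s * n * p) ^ 2) (X₂ := n * m * ((m - n * p) * (m + 2 * n * p)))
    (X₃ := n * m * ((m + n * p) * (m - 2 * n * p)))
    (mul_ne_zero hn' hm') (mul_ne_zero (mul_ne_zero (mul_ne_zero hn' hm') hs) hk') ?_ ?_ ?_
  · linear_combination -(n * m * (m + s * n * p)) ^ 2 * h'
  · rw [hbe]; linear_combination n * m * n ^ 2 * p ^ 2 * hss
  · rw [hbb]; linear_combination -n * m * n ^ 2 * p ^ 2 * hss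

end ZsqrtdNegTwo

open ZsqrtdNegTwo in
/-- For a prime `p ≡ 23 (mod 48)`, every rational point on the genus 2 curve
`C_p : y² = x(x² − p²)(x² − 4p²)` satisfies `y = 0`, hence `x ∈ {0, ±p, ±2p}`;
i.e. the rational points of `C_p` are exactly its six Weierstrass points. -/
theorem rational_points_Cp_of_twentythree_mod_48 (p : ℕ) (hp : Nat.Prime p) (hmod : p % 48 = 23)
    (x y : ℚ) (h : y ^ 2 = x * (x ^ 2 - (p : ℚ) ^ 2) * (x ^ 2 - 4 * (p : ℚ) ^ 2)) :
    y = 0 ∧ (x = 0 ∨ x = p ∨ x = -p ∨ x = 2 * p ∨ x = -(2 * p)) := by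
  have hy : y = 0 := by
    by_contra hy
    have hx : x ≠ 0 := by rintro rfl; simp at h; exact hy h
    have hn : (x.den : ℚ) ≠ 0 := by exact_mod_cast x.den_nz
    have hxd : x * x.den = x.num := Rat.mul_den_eq_num x
    have hsq : (y * x.den ^ 3) ^ 2 = algebraMap ℤ ℚ (x.den * x.num *
        (x.num ^ 2 - (x.den : ℤ) ^ 2 * (p : ℤ) ^ 2) *
        (x.num ^ 2 - 4 * (x.den : ℤ) ^ 2 * (p : ℤ) ^ 2)) := by
      rw [eq_intCast]
      push_cast
      rw [← hxd, mul_pow, h]; ring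
    obtain ⟨k, hk⟩ := IsIntegrallyClosed.exists_algebraMap_eq_of_isIntegral_pow (R := ℤ)
      (x := y * x.den ^ 3) two_pos (hsq ▸ isIntegral_algebraMap)
    rw [eq_intCast] at hk
    refine no_integral_point hp (by omega) (by omega) (m := x.num) (n := x.den) (k := k)
      (Rat.num_ne_zero.2 hx) (by exact_mod_cast x.den_nz) ?_ ?_
    · rintro rfl
      rw [Int.cast_zero] at hk
      exact mul_ne_zero hy (pow_ne_zero 3 hn) hk.symm
    · rw [← hk, eq_intCast] at hsq
      exact_mod_cast hsq
  refine ⟨hy, ?_⟩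
  rw [hy, zero_pow two_ne_zero, eq_comm] at h
  have h' : x * ((x - p) * (x + p)) * ((x - 2 * p) * (x + 2 * p)) = 0 := by
    linear_combination h
  simp only [mul_eq_zero, sub_eq_zero, add_eq_zero_iff_eq_neg] at h'
  tauto
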